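/- Let d ∈ ℕ, α ∈ (0, min(2,d)) and δ ∈ (0, (d-α)/2] ∩ (0, α). There is a constant c > 0 such that for all t > 0 and x, y ∈ ℝ^d \ {0}, ∫_0^t ∫_{ℝ^d} p̃⁰_{V⁰_δ}(s,x,z) |z|^{δ-α} p̃⁰_{V⁰_δ}(t-s,z,y) dz ds ≤ c t^{δ/α} p̃⁰_{V⁰_δ}(t,x,y), where p̃⁰_{V⁰_δ} is the Schrödinger perturbation of p⁰ by V⁰_δ(z) = κ_δ|z|^{-α}. -/

import Mathlib

open MeasureTheory Real Set Filter RealInnerProductSpace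

noncomputable section

/-- Euclidean space `ℝ^d`. -/
abbrev Ed (d : ℕ) := EuclideanSpace ℝ (Fin d)

/-- Modified Bessel function of the second kind `K_ν(r)`. -/
def besselK (ν r : ℝ) : ℝ :=
  (1 / 2) * (r / 2) ^ ν * ∫ u in Ioi (0 : ℝ), u ^ (-ν - 1) * Real.exp (-u - r ^ 2 / (4 * u))

/-- Relativistic `α`-stable heat kernel with mass parameter `m`:
`p^m(t,x,y) = (2π)^{-d} ∫ exp(-i⟨y-x,z⟩) exp(-t(|z|²+m^{2/α})^{α/2}) dz`
(the integral is real, and equals the cosine integral below). -/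
def relKernel (d : ℕ) (α m t : ℝ) (x y : Ed d) : ℝ :=
  (2 * π) ^ (-(d : ℝ)) *
    ∫ z : Ed d, Real.cos ⟪y - x, z⟫ * Real.exp (-t * (‖z‖ ^ 2 + m ^ (2 / α)) ^ (α / 2))

/-- Fractional (`α`-stable) heat kernel `p⁰(t,x,y)`. -/
def fracKernel (d : ℕ) (α t : ℝ) (x y : Ed d) : ℝ :=
  (2 * π) ^ (-(d : ℝ)) * ∫ z : Ed d, Real.cos ⟪y - x, z⟫ * Real.exp (-t * ‖z‖ ^ α)

/-- The summands of the perturbation series. -/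
def pertN (d : ℕ) (k : ℝ → Ed d → Ed d → ℝ) (q : Ed d → ℝ) : ℕ → ℝ → Ed d → Ed d → ℝ
  | 0 => k
  | n + 1 => fun t x y =>
      ∫ s in Ioo (0 : ℝ) t, ∫ z : Ed d, pertN d k q n s x z * q z * k (t - s) z y

/-- Schrödinger perturbation of a transition density `k` by a potential `q`. -/
def pert (d : ℕ) (k : ℝ → Ed d → Ed d → ℝ) (q : Ed d → ℝ) (t : ℝ) (x y : Ed d) : ℝ :=
  ∑' n : ℕ, pertN d k q n t x y

/-- Radial profile of the potential `V_β`. -/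
def VProf (d : ℕ) (α β r : ℝ) : ℝ :=
  2 ^ (α / 2) * Real.Gamma (((d : ℝ) - β) / 2) / Real.Gamma (((d : ℝ) - β - α) / 2) *
    (besselK ((β + α) / 2) r / besselK (β / 2) r) * r ^ (-(α / 2))

/-- The potential `V_β(x)`. -/
def Vbeta (d : ℕ) (α β : ℝ) (x : Ed d) : ℝ := VProf d α β ‖x‖

/-- The Hardy constant `κ_β` for the fractional Laplacian. -/
def kappa (d : ℕ) (α β : ℝ) : ℝ :=
  2 ^ α * Real.Gamma ((β + α) / 2) * Real.Gamma (((d : ℝ) - β) / 2) /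
    (Real.Gamma (β / 2) * Real.Gamma (((d : ℝ) - β - α) / 2))

/-- `h^m_β(x) = ∫_0^∞ t^{(d-α-β)/α} p^m(t,x,0) dt`. -/
def hBetaM (d : ℕ) (α m β : ℝ) (x : Ed d) : ℝ :=
  ∫ t in Ioi (0 : ℝ), t ^ (((d : ℝ) - α - β) / α) * relKernel d α m t x 0

/-- `h_β = h^1_β`. -/
def hBeta (d : ℕ) (α β : ℝ) (x : Ed d) : ℝ := hBetaM d α 1 β x

/-- `V^m_β(x) = ((d-α-β)/α) h^m_{β+α}(x)/h^m_β(x)`. -/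
def VbetaM (d : ℕ) (α m β : ℝ) (x : Ed d) : ℝ :=
  (((d : ℝ) - α - β) / α) * hBetaM d α m (β + α) x / hBetaM d α m β x

/-- The function `H⁰(t,x)`. -/
def Hzero (d : ℕ) (α δ t : ℝ) (x : Ed d) : ℝ :=
  if δ ≤ ((d : ℝ) - α) / 2 then 1 + t ^ (δ / α) * ‖x‖ ^ (-δ)
  else 1 + t ^ (((d : ℝ) - α - δ) / α) * ‖x‖ ^ (-((d : ℝ) - α - δ))

/-- Density of the Lévy measure of the relativistic `α`-stable operator (mass 1). -/
def levyNu (d : ℕ) (α : ℝ) (x : Ed d) : ℝ :=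
  2 ^ ((α - (d : ℝ)) / 2 + 1) * π ^ (-(d : ℝ) / 2) * |Real.Gamma (-α / 2)|⁻¹ *
    besselK (((d : ℝ) + α) / 2) ‖x‖ / ‖x‖ ^ (((d : ℝ) + α) / 2)

/-! ## Positivity and monotonicity of the stable kernel -/

lemma integrable_gauss (d : ℕ) {v : ℝ} (hv : 0 < v) :
    Integrable (fun ξ : Ed d => Real.exp (-v * ‖ξ‖ ^ 2)) := by
  have h := (GaussianFourier.integrable_cexp_neg_mul_sq_norm_add (V := Ed d) (b := (v : ℂ))
    (by simpa using hv) 0 0).re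
  refine h.congr (Eventually.of_forall fun ξ => ?_)
  simp only [zero_mul, add_zero]
  have : (-(v:ℂ) * (‖ξ‖:ℂ) ^ 2) = ((-v * ‖ξ‖ ^ 2 : ℝ) : ℂ) := by push_cast; ring
  rw [this, ← Complex.ofReal_exp]; exact Complex.ofReal_re _

lemma gauss_cos (d : ℕ) {v : ℝ} (hv : 0 < v) (x : Ed d) :
    ∫ ξ : Ed d, Real.cos ⟪x, ξ⟫ * Real.exp (-v * ‖ξ‖ ^ 2) =
      (π / v) ^ ((d : ℝ) / 2) * Real.exp (-‖x‖ ^ 2 / (4 * v)) := by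
  have hb : 0 < ((v : ℂ)).re := by simpa using hv
  have h1 := GaussianFourier.integral_cexp_neg_mul_sq_norm_add (V := Ed d) hb Complex.I x
  have h2 := GaussianFourier.integrable_cexp_neg_mul_sq_norm_add (V := Ed d) hb Complex.I x
  have h3 := congrArg Complex.re h1
  have h4 : (∫ ξ : Ed d, Complex.exp (-(v:ℂ) * (‖ξ‖:ℂ) ^ 2 + Complex.I * (⟪x, ξ⟫ : ℝ))).re =
      ∫ ξ : Ed d, (Complex.exp (-(v:ℂ) * (‖ξ‖:ℂ) ^ 2 + Complex.I * (⟪x, ξ⟫ : ℝ))).re :=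
    (integral_re h2).symm
  rw [h4] at h3
  have e1 : ∀ ξ : Ed d, (Complex.exp (-(v:ℂ) * (‖ξ‖:ℂ) ^ 2 + Complex.I * (⟪x, ξ⟫ : ℝ))).re =
      Real.cos ⟪x, ξ⟫ * Real.exp (-v * ‖ξ‖ ^ 2) := by
    intro ξ
    rw [Complex.exp_re]
    have r1 : (-(v:ℂ) * (‖ξ‖:ℂ) ^ 2 + Complex.I * (⟪x, ξ⟫ : ℝ)) =
      ((-v * ‖ξ‖ ^ 2 : ℝ) : ℂ) + ((⟪x, ξ⟫ : ℝ) : ℂ) * Complex.I := by push_cast; ring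
    rw [r1, Complex.add_re, Complex.add_im, Complex.re_ofReal_mul, Complex.im_ofReal_mul,
      Complex.ofReal_re, Complex.ofReal_im, Complex.I_re, Complex.I_im]
    simp [mul_comm]
  simp_rw [e1] at h3
  rw [h3]
  have e2 : ((π : ℂ) / v) ^ ((Module.finrank ℝ (Ed d) : ℂ) / 2) *
      Complex.exp (Complex.I ^ 2 * (‖x‖:ℂ) ^ 2 / (4 * v)) =
      (((π / v) ^ ((d : ℝ) / 2) * Real.exp (-‖x‖ ^ 2 / (4 * v)) : ℝ) : ℂ) := by
    rw [Complex.ofReal_mul, Complex.ofReal_cpow (by positivity), Complex.ofReal_exp]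
    simp
  rw [e2, Complex.ofReal_re]

/-- cosine transform regularised by a Gaussian -/
def Kf (d : ℕ) (φ : ℝ → ℝ) (v : ℝ) (x : Ed d) : ℝ :=
  ∫ ξ : Ed d, Real.cos ⟪x, ξ⟫ * (Real.exp (-v * ‖ξ‖ ^ 2) * φ (‖ξ‖ ^ 2))

/-- class of radial profiles whose regularised transforms are nonnegative and radially decreasing -/
structure Good (d : ℕ) (φ : ℝ → ℝ) : Prop where
  meas : Measurable φ
  bdd : ∃ B, ∀ r, 0 ≤ r → |φ r| ≤ B
  mono : ∀ v, 0 < v → ∀ x y : Ed d, ‖x‖ ≤ ‖y‖ → 0 ≤ Kf d φ v y ∧ Kf d φ v y ≤ Kf d φ v x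

lemma Kf_integrable (d : ℕ) {φ : ℝ → ℝ} (hm : Measurable φ) {B : ℝ}
    (hB : ∀ r, 0 ≤ r → |φ r| ≤ B) {v : ℝ} (hv : 0 < v) (x : Ed d) :
    Integrable (fun ξ : Ed d => Real.cos ⟪x, ξ⟫ * (Real.exp (-v * ‖ξ‖ ^ 2) * φ (‖ξ‖ ^ 2))) := by
  refine ((integrable_gauss d hv).const_mul B).mono' ?_ (Eventually.of_forall fun ξ => ?_)
  · apply Measurable.aestronglyMeasurable
    have : Measurable (fun ξ : Ed d => φ (‖ξ‖ ^ 2)) := hm.comp (by fun_prop)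
    fun_prop
  · rw [norm_mul, norm_mul, Real.norm_eq_abs, Real.norm_eq_abs, Real.norm_eq_abs, Real.abs_exp]
    have h1 := Real.abs_cos_le_one ⟪x, ξ⟫
    have h2 := hB (‖ξ‖ ^ 2) (by positivity)
    have h3 : 0 ≤ B := (abs_nonneg _).trans h2
    calc |Real.cos ⟪x, ξ⟫| * (Real.exp (-v * ‖ξ‖ ^ 2) * |φ (‖ξ‖ ^ 2)|)
        ≤ 1 * (Real.exp (-v * ‖ξ‖ ^ 2) * B) := by gcongr
      _ = _ := by ring

lemma good_const (d : ℕ) {c : ℝ} (hc : 0 ≤ c) : Good d (fun _ => c) := by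
  refine ⟨measurable_const, ⟨|c|, fun _ _ => le_rfl⟩, fun v hv x y hxy => ?_⟩
  have : ∀ x : Ed d, Kf d (fun _ => c) v x =
      c * ((π / v) ^ ((d : ℝ) / 2) * Real.exp (-‖x‖ ^ 2 / (4 * v))) := by
    intro x
    rw [← gauss_cos d hv x, ← integral_const_mul]
    unfold Kf; congr 1; ext ξ; ring
  rw [this, this]
  refine ⟨by positivity, ?_⟩
  gcongr

lemma Good.add {d : ℕ} {φ ψ : ℝ → ℝ} (h : Good d φ) (h' : Good d ψ) :
    Good d (fun r => φ r + ψ r) := by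
  obtain ⟨B, hB⟩ := h.bdd
  obtain ⟨B', hB'⟩ := h'.bdd
  refine ⟨h.meas.add h'.meas, ⟨B + B', fun r hr => (abs_add_le _ _).trans
    (add_le_add (hB r hr) (hB' r hr))⟩, fun v hv x y hxy => ?_⟩
  have : ∀ x : Ed d, Kf d (fun r => φ r + ψ r) v x = Kf d φ v x + Kf d ψ v x := by
    intro x
    unfold Kf
    rw [← integral_add (Kf_integrable d h.meas hB hv x) (Kf_integrable d h'.meas hB' hv x)]
    congr 1; ext ξ; ring
  rw [this, this]
  have a := h.mono v hv x y hxy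
  have b := h'.mono v hv x y hxy
  exact ⟨add_nonneg a.1 b.1, add_le_add a.2 b.2⟩

lemma Good.smul {d : ℕ} {φ : ℝ → ℝ} (h : Good d φ) {c : ℝ} (hc : 0 ≤ c) :
    Good d (fun r => c * φ r) := by
  obtain ⟨B, hB⟩ := h.bdd
  refine ⟨h.meas.const_mul c, ⟨|c| * B, fun r hr => by
    rw [abs_mul]; exact mul_le_mul_of_nonneg_left (hB r hr) (abs_nonneg _)⟩, fun v hv x y hxy => ?_⟩
  have : ∀ x : Ed d, Kf d (fun r => c * φ r) v x = c * Kf d φ v x := by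
    intro x
    unfold Kf
    rw [← integral_const_mul]
    congr 1; ext ξ; ring
  rw [this, this]
  have a := h.mono v hv x y hxy
  exact ⟨mul_nonneg hc a.1, mul_le_mul_of_nonneg_left a.2 hc⟩

lemma good_lim {d : ℕ} {φ : ℕ → ℝ → ℝ} {ψ : ℝ → ℝ} (h : ∀ n, Good d (φ n)) (hψ : Measurable ψ)
    {B : ℝ} (hB : ∀ n r, 0 ≤ r → |φ n r| ≤ B)
    (hlim : ∀ r, 0 ≤ r → Tendsto (fun n => φ n r) atTop (nhds (ψ r))) : Good d ψ := by
  refine ⟨hψ, ⟨B, fun r hr => le_of_tendsto (hlim r hr).abs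
    (Eventually.of_forall fun n => hB n r hr)⟩, fun v hv x y hxy => ?_⟩
  have key : ∀ x : Ed d, Tendsto (fun n => Kf d (φ n) v x) atTop (nhds (Kf d ψ v x)) := by
    intro x
    refine tendsto_integral_of_dominated_convergence (fun ξ : Ed d => B * Real.exp (-v * ‖ξ‖ ^ 2))
      (fun n => (Kf_integrable d (h n).meas (hB n) hv x).aestronglyMeasurable)
      ((integrable_gauss d hv).const_mul B) (fun n => Eventually.of_forall fun ξ => ?_)
      (Eventually.of_forall fun ξ => ?_)
    · rw [norm_mul, norm_mul, Real.norm_eq_abs, Real.norm_eq_abs, Real.norm_eq_abs, Real.abs_exp]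
      have h1 := Real.abs_cos_le_one ⟪x, ξ⟫
      have h2 := hB n (‖ξ‖ ^ 2) (by positivity)
      have h3 : 0 ≤ B := (abs_nonneg _).trans h2
      calc |Real.cos ⟪x, ξ⟫| * (Real.exp (-v * ‖ξ‖ ^ 2) * |φ n (‖ξ‖ ^ 2)|)
          ≤ 1 * (Real.exp (-v * ‖ξ‖ ^ 2) * B) := by gcongr
        _ = _ := by ring
    · exact ((hlim _ (by positivity)).const_mul _).const_mul _
  exact ⟨ge_of_tendsto (key y) (Eventually.of_forall fun n => ((h n).mono v hv x y hxy).1),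
    le_of_tendsto_of_tendsto (key y) (key x)
      (Eventually.of_forall fun n => ((h n).mono v hv x y hxy).2)⟩

/-- mixing with exponentials -/
lemma good_mix {d : ℕ} {φ : ℝ → ℝ} (h : Good d φ) (g : ℝ → ℝ) (hg0 : ∀ u, 0 < u → 0 ≤ g u)
    {ε : ℝ} (hε : 0 ≤ ε) (hg : IntegrableOn g (Ioi ε)) :
    Good d (fun r => (∫ u in Ioi ε, g u * Real.exp (-u * r)) * φ r) := by
  obtain ⟨B, hB⟩ := h.bdd
  have hB0 : 0 ≤ B := (abs_nonneg _).trans (hB 0 le_rfl)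
  have hmeas : Measurable (fun r => ∫ u in Ioi ε, g u * Real.exp (-u * r)) := by
    -- replace g by a strongly measurable version
    obtain ⟨g', hg'm, hg'e⟩ := hg.aestronglyMeasurable
    have : (fun r => ∫ u in Ioi ε, g u * Real.exp (-u * r)) =
        (fun r => ∫ u in Ioi ε, g' u * Real.exp (-u * r)) := by
      ext r
      refine integral_congr_ae ?_
      filter_upwards [hg'e] with u hu
      rw [hu]
    rw [this]
    refine (StronglyMeasurable.integral_prod_right (f := fun r u => g' u * Real.exp (-u * r))
      (Measurable.stronglyMeasurable ?_)).measurable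
    have := hg'm.measurable
    simp only [Function.uncurry_def]
    fun_prop
  have hpos : ∀ᵐ u ∂(volume.restrict (Ioi ε)), 0 < u := by
    filter_upwards [ae_restrict_mem measurableSet_Ioi] with u hu
    exact hε.trans_lt hu
  have hle : ∀ r, 0 ≤ r → |∫ u in Ioi ε, g u * Real.exp (-u * r)| ≤ ∫ u in Ioi ε, g u := by
    intro r hr
    rw [← Real.norm_eq_abs]
    refine norm_integral_le_of_norm_le hg ?_
    filter_upwards [hpos] with u hu
    rw [norm_mul, Real.norm_of_nonneg (hg0 u hu), Real.norm_eq_abs, Real.abs_exp]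
    have : Real.exp (-u * r) ≤ 1 := Real.exp_le_one_iff.2 (by nlinarith)
    nlinarith [hg0 u hu]
  refine ⟨hmeas.mul h.meas, ⟨(∫ u in Ioi ε, g u) * B, fun r hr => ?_⟩, fun v hv x y hxy => ?_⟩
  · rw [abs_mul]
    exact mul_le_mul (hle r hr) (hB r hr) (abs_nonneg _) ((abs_nonneg _).trans (hle r hr))
  have hIntg : ∀ x : Ed d, Integrable (fun p : Ed d × ℝ => Real.cos ⟪x, p.1⟫ *
      (Real.exp (-v * ‖p.1‖ ^ 2) * ((g p.2 * Real.exp (-p.2 * ‖p.1‖ ^ 2)) * φ (‖p.1‖ ^ 2))))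
      (volume.prod (volume.restrict (Ioi ε))) := by
    intro x
    have base := (((integrable_gauss d hv).const_mul B).mul_prod hg)
    refine base.mono ?_ ?_
    · have m1 : AEStronglyMeasurable (fun p : Ed d × ℝ => g p.2)
        (volume.prod (volume.restrict (Ioi ε))) := hg.aestronglyMeasurable.comp_snd
      have m2 : Measurable (fun p : Ed d × ℝ => φ (‖p.1‖ ^ 2)) := h.meas.comp (by fun_prop)
      have m3 : Measurable (fun p : Ed d × ℝ => Real.cos ⟪x, p.1⟫) := by fun_prop
      have m4 : Measurable (fun p : Ed d × ℝ => Real.exp (-v * ‖p.1‖ ^ 2)) := by fun_prop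
      have m5 : Measurable (fun p : Ed d × ℝ => Real.exp (-p.2 * ‖p.1‖ ^ 2)) := by fun_prop
      exact m3.aestronglyMeasurable.mul (m4.aestronglyMeasurable.mul
        ((m1.mul m5.aestronglyMeasurable).mul m2.aestronglyMeasurable))
    · have : ∀ᵐ p : Ed d × ℝ ∂(volume.prod (volume.restrict (Ioi ε))), 0 < p.2 :=
        Measure.quasiMeasurePreserving_snd.ae hpos
      filter_upwards [this] with p hp
      simp only [norm_mul, Real.norm_eq_abs, Real.abs_exp]
      have h1 := Real.abs_cos_le_one ⟪x, p.1⟫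
      have h2 := hB (‖p.1‖ ^ 2) (by positivity)
      have h4 : Real.exp (-p.2 * ‖p.1‖ ^ 2) ≤ 1 := Real.exp_le_one_iff.2 (by
        have : 0 ≤ ‖p.1‖ ^ 2 := by positivity
        nlinarith)
      rw [abs_of_nonneg hB0]
      calc _ ≤ 1 * (Real.exp (-v * ‖p.1‖ ^ 2) * ((|g p.2| * 1) * B)) := by gcongr
        _ = _ := by ring
  have hswap : ∀ x : Ed d, Kf d (fun r => (∫ u in Ioi ε, g u * Real.exp (-u * r)) * φ r) v x =
      ∫ u in Ioi ε, g u * Kf d φ (v + u) x := by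
    intro x
    unfold Kf
    have e1 : ∀ ξ : Ed d, Real.cos ⟪x, ξ⟫ * (Real.exp (-v * ‖ξ‖ ^ 2) *
        ((∫ u in Ioi ε, g u * Real.exp (-u * ‖ξ‖ ^ 2)) * φ (‖ξ‖ ^ 2))) =
        ∫ u in Ioi ε, Real.cos ⟪x, ξ⟫ * (Real.exp (-v * ‖ξ‖ ^ 2) *
          ((g u * Real.exp (-u * ‖ξ‖ ^ 2)) * φ (‖ξ‖ ^ 2))) := by
      intro ξ
      rw [integral_const_mul, integral_const_mul, integral_mul_const]
    simp_rw [e1]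
    rw [integral_integral_swap (hIntg x)]
    refine integral_congr_ae (Eventually.of_forall fun u => ?_)
    simp only
    rw [← integral_const_mul]
    congr 1; ext ξ
    rw [show -(v + u) * ‖ξ‖ ^ 2 = -v * ‖ξ‖ ^ 2 + -u * ‖ξ‖ ^ 2 by ring, Real.exp_add]
    ring
  have hIntg2 : ∀ x : Ed d, IntegrableOn (fun u => g u * Kf d φ (v + u) x) (Ioi ε) := by
    intro x
    refine (hIntg x).integral_prod_right.congr (Eventually.of_forall fun u => ?_)
    simp only [Kf]
    rw [← integral_const_mul]
    congr 1; ext ξ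
    rw [show -(v + u) * ‖ξ‖ ^ 2 = -v * ‖ξ‖ ^ 2 + -u * ‖ξ‖ ^ 2 by ring, Real.exp_add]
    ring
  rw [hswap, hswap]
  constructor
  · refine integral_nonneg_of_ae ?_
    filter_upwards [hpos] with u hu
    exact mul_nonneg (hg0 u hu) (h.mono (v + u) (by linarith) x y hxy).1
  · refine integral_mono_ae (hIntg2 y) (hIntg2 x) ?_
    filter_upwards [hpos] with u hu
    exact mul_le_mul_of_nonneg_left (h.mono (v + u) (by linarith) x y hxy).2 (hg0 u hu)

lemma good_exp_mix {d : ℕ} (g : ℝ → ℝ) (hg0 : ∀ u, 0 < u → 0 ≤ g u)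
    {ε : ℝ} (hε : 0 ≤ ε) (hg : IntegrableOn g (Ioi ε)) :
    Good d (fun r => Real.exp (-(∫ u in Ioi ε, g u)) *
      Real.exp (∫ u in Ioi ε, g u * Real.exp (-u * r))) := by
  set N : ℝ → ℝ := fun r => ∫ u in Ioi ε, g u * Real.exp (-u * r) with hN
  set L := ∫ u in Ioi ε, g u with hL
  have hpos : ∀ᵐ u ∂(volume.restrict (Ioi ε)), 0 < u := by
    filter_upwards [ae_restrict_mem measurableSet_Ioi] with u hu
    exact hε.trans_lt hu
  have hpow : ∀ n, Good d (fun r => N r ^ n) := by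
    intro n
    induction n with
    | zero => simpa using good_const d (c := 1) zero_le_one
    | succ n ih =>
      have := good_mix ih g hg0 hε hg
      convert this using 2
      rw [pow_succ']
  have hN0 : ∀ r, 0 ≤ N r := fun r => integral_nonneg_of_ae (by
    filter_upwards [hpos] with u hu
    exact mul_nonneg (hg0 u hu) (Real.exp_pos _).le)
  have hNL : ∀ r, 0 ≤ r → N r ≤ L := by
    intro r hr
    refine (le_abs_self _).trans ?_
    rw [← Real.norm_eq_abs]
    refine norm_integral_le_of_norm_le hg ?_
    filter_upwards [hpos] with u hu
    rw [norm_mul, Real.norm_of_nonneg (hg0 u hu), Real.norm_eq_abs, Real.abs_exp]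
    have : Real.exp (-u * r) ≤ 1 := Real.exp_le_one_iff.2 (by nlinarith)
    nlinarith [hg0 u hu]
  have hsum : ∀ n, Good d (fun r => ∑ i ∈ Finset.range n, N r ^ i / (i.factorial : ℝ)) := by
    intro n
    induction n with
    | zero => simpa using good_const d (c := 0) le_rfl
    | succ n ih =>
      have := ih.add ((hpow n).smul (c := ((n.factorial : ℝ))⁻¹) (by positivity))
      convert this using 2
      rw [Finset.sum_range_succ, div_eq_inv_mul]
  have hmeas : Measurable N := by
    have := (hpow 1).meas
    simpa using this
  refine good_lim (φ := fun n r => Real.exp (-L) * ∑ i ∈ Finset.range n, N r ^ i / (i.factorial : ℝ))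
    (fun n => (hsum n).smul (Real.exp_pos _).le) ((Real.measurable_exp.comp hmeas).const_mul _) (B := 1) ?_ ?_
  · intro n r hr
    have h1 : ∑ i ∈ Finset.range n, N r ^ i / (i.factorial : ℝ) ≤ Real.exp (N r) :=
      Real.sum_le_exp_of_nonneg (hN0 r) n
    have h0 : 0 ≤ ∑ i ∈ Finset.range n, N r ^ i / (i.factorial : ℝ) :=
      Finset.sum_nonneg fun i _ => div_nonneg (pow_nonneg (hN0 r) _) (by positivity)
    rw [abs_of_nonneg (by positivity)]
    calc _ ≤ Real.exp (-L) * Real.exp L := by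
            gcongr
            exact h1.trans (Real.exp_le_exp.2 (hNL r hr))
      _ = 1 := by rw [← Real.exp_add]; simp
  · intro r hr
    refine Tendsto.const_mul _ ?_
    have := (NormedSpace.expSeries_div_hasSum_exp (N r)).tendsto_sum_nat
    rw [← Real.exp_eq_exp_ℝ] at this
    exact this

lemma intOn_levy {γ : ℝ} (h0 : 0 < γ) (h1 : γ < 1) {r : ℝ} (hr : 0 ≤ r) :
    IntegrableOn (fun u : ℝ => u ^ (-1 - γ) * (1 - Real.exp (-u * r))) (Ioi 0) := by
  have hm : Measurable (fun u : ℝ => u ^ (-1 - γ) * (1 - Real.exp (-u * r))) := by fun_prop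
  rw [← Ioc_union_Ioi_eq_Ioi (zero_le_one' ℝ)]
  refine IntegrableOn.union ?_ ?_
  · have hi : IntegrableOn (fun u : ℝ => r * u ^ (-γ)) (Ioc 0 1) := by
      refine Integrable.const_mul ?_ r
      have := (intervalIntegral.intervalIntegrable_rpow' (a := 0) (b := 1) (r := -γ) (by linarith))
      rwa [intervalIntegrable_iff_integrableOn_Ioc_of_le zero_le_one] at this
    refine hi.mono' hm.aestronglyMeasurable ?_
    filter_upwards [ae_restrict_mem measurableSet_Ioc] with u hu
    have hu0 : 0 < u := hu.1
    have e1 : 1 - Real.exp (-u * r) ≤ u * r := by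
      have := Real.add_one_le_exp (-u * r); linarith
    have e0 : 0 ≤ 1 - Real.exp (-u * r) := by
      have : Real.exp (-u * r) ≤ 1 := Real.exp_le_one_iff.2 (by nlinarith)
      linarith
    rw [Real.norm_of_nonneg (by positivity)]
    calc _ ≤ u ^ (-1 - γ) * (u * r) := by gcongr
      _ = r * u ^ (-γ) := by
        rw [show -γ = (-1 - γ) + 1 by ring, Real.rpow_add hu0, Real.rpow_one]; ring
  · have hi : IntegrableOn (fun u : ℝ => u ^ (-1 - γ)) (Ioi 1) :=
      integrableOn_Ioi_rpow_of_lt (by linarith) zero_lt_one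
    refine hi.mono' hm.aestronglyMeasurable ?_
    filter_upwards [ae_restrict_mem measurableSet_Ioi] with u hu
    have hu0 : (0:ℝ) < u := zero_lt_one.trans hu
    have e0 : 0 ≤ 1 - Real.exp (-u * r) := by
      have : Real.exp (-u * r) ≤ 1 := Real.exp_le_one_iff.2 (by nlinarith)
      linarith
    rw [Real.norm_of_nonneg (by positivity)]
    have : 1 - Real.exp (-u * r) ≤ 1 := by linarith [Real.exp_pos (-u * r)]
    have := Real.rpow_nonneg hu0.le (-1 - γ)
    nlinarith

lemma good_exp_rpow (d : ℕ) {γ : ℝ} (h0 : 0 < γ) (h1 : γ < 1) {t : ℝ} (ht : 0 ≤ t) :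
    Good d (fun r => Real.exp (-t * r ^ γ)) := by
  set C := ∫ u in Ioi (0:ℝ), u ^ (-1 - γ) * (1 - Real.exp (-u * 1)) with hC
  have hCpos : 0 < C := by
    rw [hC, setIntegral_pos_iff_support_of_nonneg_ae]
    · have : Ioi (0:ℝ) ⊆ (Function.support fun u : ℝ => u ^ (-1 - γ) * (1 - Real.exp (-u * 1))) ∩ Ioi 0 := by
        intro u hu
        refine ⟨?_, hu⟩
        have hu0 : (0:ℝ) < u := hu
        have : Real.exp (-u * 1) < 1 := Real.exp_lt_one_iff.2 (by linarith)
        exact (mul_pos (Real.rpow_pos_of_pos hu0 _) (by linarith)).ne'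
      refine lt_of_lt_of_le ?_ (measure_mono this)
      simp
    · filter_upwards [ae_restrict_mem measurableSet_Ioi] with u hu
      have hu0 : (0:ℝ) < u := hu
      have : Real.exp (-u * 1) < 1 := Real.exp_lt_one_iff.2 (by linarith)
      exact (mul_pos (Real.rpow_pos_of_pos hu0 _) (by linarith)).le
    · exact intOn_levy h0 h1 zero_le_one
  have hval : ∀ r, 0 ≤ r → ∫ u in Ioi (0:ℝ), u ^ (-1 - γ) * (1 - Real.exp (-u * r)) = C * r ^ γ := by
    intro r hr
    rcases hr.eq_or_lt with rfl | hr
    · simp [h0.ne']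
    have := integral_comp_mul_left_Ioi (fun u : ℝ => u ^ (-1 - γ) * (1 - Real.exp (-u * 1))) 0 hr
    rw [mul_zero] at this
    rw [smul_eq_mul, ← hC] at this
    have e : ∀ u ∈ Ioi (0:ℝ), (r * u) ^ (-1 - γ) * (1 - Real.exp (-(r * u) * 1)) =
        r ^ (-1 - γ) * (u ^ (-1 - γ) * (1 - Real.exp (-u * r))) := by
      intro u hu
      rw [Real.mul_rpow hr.le (le_of_lt hu)]
      ring_nf
    rw [setIntegral_congr_fun measurableSet_Ioi e, integral_const_mul] at this
    have hr' : r ^ (-1 - γ) * (r * r ^ γ) = 1 := by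
      rw [← Real.rpow_one_add' hr.le (by linarith), ← Real.rpow_add hr]; simp
    have hne := (Real.rpow_pos_of_pos hr (-1 - γ)).ne'
    apply mul_left_cancel₀ hne
    rw [this]
    have h3 : r⁻¹ * (r ^ (-1 - γ) * (r * r ^ γ)) = r ^ (-1 - γ) * r ^ γ := by
      field_simp
    rw [hr'] at h3
    rw [mul_one] at h3
    rw [h3]; ring
  set a := t / C with ha
  have ha0 : 0 ≤ a := by positivity
  set g : ℝ → ℝ := fun u => a * u ^ (-1 - γ) with hg
  have hg0 : ∀ u, 0 < u → 0 ≤ g u := fun u hu => by positivity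
  set ε : ℕ → ℝ := fun n => 1 / ((n:ℝ) + 1) with hε
  have hε0 : ∀ n, 0 < ε n := fun n => by positivity
  have hgi : ∀ n, IntegrableOn g (Ioi (ε n)) := fun n =>
    Integrable.const_mul (integrableOn_Ioi_rpow_of_lt (by linarith) (hε0 n)) a
  have hgi2 : ∀ n r, 0 ≤ r → IntegrableOn (fun u => g u * Real.exp (-u * r)) (Ioi (ε n)) := by
    intro n r hr
    refine Integrable.mono (hgi n) (by apply Measurable.aestronglyMeasurable; fun_prop) ?_
    filter_upwards [ae_restrict_mem measurableSet_Ioi] with u hu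
    have hu0 : 0 < u := (hε0 n).trans hu
    rw [norm_mul, Real.norm_eq_abs (Real.exp _), Real.abs_exp]
    have : Real.exp (-u * r) ≤ 1 := Real.exp_le_one_iff.2 (by nlinarith)
    nlinarith [norm_nonneg (g u)]
  have hrew : ∀ n r, 0 ≤ r → Real.exp (-(∫ u in Ioi (ε n), g u)) *
      Real.exp (∫ u in Ioi (ε n), g u * Real.exp (-u * r)) =
      Real.exp (-(a * ∫ u in Ioi (ε n), u ^ (-1 - γ) * (1 - Real.exp (-u * r)))) := by
    intro n r hr
    rw [← Real.exp_add, ← integral_const_mul]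
    congr 1
    rw [neg_add_eq_sub, ← neg_sub, ← integral_sub (hgi n) (hgi2 n r hr)]
    congr 2; ext u; simp only [hg]; ring
  refine good_lim (fun n => good_exp_mix g hg0 (hε0 n).le (hgi n)) (by fun_prop) (B := 1) ?_ ?_
  · intro n r hr
    rw [hrew n r hr, Real.abs_exp, Real.exp_le_one_iff, neg_nonpos]
    refine mul_nonneg ha0 (setIntegral_nonneg measurableSet_Ioi fun u hu => ?_)
    have hu0 : 0 < u := (hε0 n).trans hu
    have : Real.exp (-u * r) ≤ 1 := Real.exp_le_one_iff.2 (by nlinarith)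
    exact mul_nonneg (Real.rpow_nonneg hu0.le _) (by linarith)
  · intro r hr
    simp_rw [hrew _ r hr]
    have hU : (⋃ n, Ioi (ε n)) = Ioi (0:ℝ) := by
      ext u
      simp only [mem_iUnion, mem_Ioi]
      constructor
      · rintro ⟨n, hn⟩; exact (hε0 n).trans hn
      · intro hu; exact exists_nat_one_div_lt hu
    have hmono : Monotone (fun n => Ioi (ε n)) := by
      intro m n hmn
      apply Ioi_subset_Ioi
      exact one_div_le_one_div_of_le (by positivity) (by simpa using hmn)
    have := tendsto_setIntegral_of_monotone (fun n => measurableSet_Ioi) hmono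
      (by rw [hU]; exact intOn_levy h0 h1 hr)
    rw [hU, hval r hr] at this
    have h2 := (this.const_mul a).neg.rexp
    convert h2 using 2
    congr 1
    rw [ha]; field_simp

/-! ## The stable kernel -/

def sk (d : ℕ) (α t : ℝ) (x : Ed d) : ℝ := fracKernel d α t 0 x

lemma frac_eq_sk (d : ℕ) (α t : ℝ) (x y : Ed d) : fracKernel d α t x y = sk d α t (y - x) := by
  simp [sk, fracKernel]

lemma sk_def (d : ℕ) (α t : ℝ) (x : Ed d) : sk d α t x =
    (2 * π) ^ (-(d : ℝ)) * ∫ z : Ed d, Real.cos ⟪x, z⟫ * Real.exp (-t * ‖z‖ ^ α) := by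
  simp [sk, fracKernel]

/-- polar integrability with power weight -/
lemma integrable_radial_exp (d : ℕ) [NeZero d] {γ p b : ℝ} (hγ : γ < d) (hp : 0 < p) (hb : 0 < b) :
    Integrable (fun z : Ed d => ‖z‖ ^ (-γ) * Real.exp (-b * ‖z‖ ^ p)) := by
  refine (integrable_fun_norm_addHaar (E := Ed d) volume (f := fun r : ℝ => r ^ (-γ) * Real.exp (-b * r ^ p))).2 ?_
  have h := integrableOn_rpow_mul_exp_neg_mul_rpow (s := d - 1 - γ) (p := p) (b := b) (by linarith) hp hb
  refine h.congr_fun (fun r hr => ?_) measurableSet_Ioi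
  have hr0 : (0:ℝ) < r := hr
  have hd : 1 ≤ d := Nat.one_le_iff_ne_zero.2 (NeZero.ne d)
  simp only [smul_eq_mul, finrank_euclideanSpace, Fintype.card_fin]
  rw [← mul_assoc, ← Real.rpow_natCast, ← Real.rpow_add hr0, Nat.cast_sub hd]
  congr 2
  push_cast; ring

lemma integral_radial_exp (d : ℕ) [NeZero d] {γ p b : ℝ} (hγ : γ < d) (hp : 0 < p) (hb : 0 < b) :
    ∫ z : Ed d, ‖z‖ ^ (-γ) * Real.exp (-b * ‖z‖ ^ p) =
      d * (volume.real (Metric.ball (0 : Ed d) 1)) *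
        (b ^ (-(d - γ) / p) * (1 / p) * Real.Gamma ((d - γ) / p)) := by
  have h := integral_fun_norm_addHaar (E := Ed d) volume (fun r : ℝ => r ^ (-γ) * Real.exp (-b * r ^ p))
  have h2 := integral_rpow_mul_exp_neg_mul_rpow (q := d - 1 - γ) (p := p) (b := b) hp (by linarith) hb
  rw [h]
  simp only [smul_eq_mul, finrank_euclideanSpace, Fintype.card_fin, nsmul_eq_mul]
  rw [mul_assoc]
  congr 2
  have e : (d:ℝ) - 1 - γ + 1 = d - γ := by ring
  rw [e] at h2
  rw [← h2]
  refine setIntegral_congr_fun measurableSet_Ioi (fun r hr => ?_)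
  have hr0 : (0:ℝ) < r := hr
  have hd : 1 ≤ d := Nat.one_le_iff_ne_zero.2 (NeZero.ne d)
  rw [← mul_assoc, ← Real.rpow_natCast, ← Real.rpow_add hr0, Nat.cast_sub hd]
  congr 2
  push_cast; ring

lemma integrable_expo (d : ℕ) [NeZero d] {p b : ℝ} (hp : 0 < p) (hb : 0 < b) :
    Integrable (fun z : Ed d => Real.exp (-b * ‖z‖ ^ p)) := by
  have := integrable_radial_exp d (γ := 0) (p := p) (b := b)
    (by exact_mod_cast Nat.pos_of_ne_zero (NeZero.ne d)) hp hb
  simpa using this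

lemma integrable_cos_expo (d : ℕ) [NeZero d] {p b : ℝ} (hp : 0 < p) (hb : 0 < b) (x : Ed d) :
    Integrable (fun z : Ed d => Real.cos ⟪x, z⟫ * Real.exp (-b * ‖z‖ ^ p)) := by
  refine (integrable_expo d hp hb).mono (by apply Measurable.aestronglyMeasurable; fun_prop)
    (Eventually.of_forall fun z => ?_)
  rw [norm_mul]
  have := Real.abs_cos_le_one ⟪x, z⟫
  rw [Real.norm_eq_abs (Real.cos _)]
  nlinarith [norm_nonneg (Real.exp (-b * ‖z‖ ^ p))]

lemma sk_neg (d : ℕ) (α t : ℝ) (x : Ed d) : sk d α t (-x) = sk d α t x := by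
  simp [sk_def, inner_neg_left]

lemma sk_scale (d : ℕ) {α t : ℝ} (hα : 0 < α) (ht : 0 < t) (x : Ed d) :
    sk d α t x = t ^ (-(d:ℝ) / α) * sk d α 1 (t ^ (-1 / α) • x) := by
  rw [sk_def, sk_def]
  have h := Measure.integral_comp_smul (volume : Measure (Ed d))
    (fun z : Ed d => Real.cos ⟪t ^ (-1/α) • x, z⟫ * Real.exp (-1 * ‖z‖ ^ α)) (t ^ (1 / α))
  have hpos : 0 < t ^ (1/α) := Real.rpow_pos_of_pos ht _
  have e : ∀ z : Ed d, Real.cos ⟪t ^ (-1/α) • x, t ^ (1 / α) • z⟫ *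
      Real.exp (-1 * ‖t ^ (1/α) • z‖ ^ α) = Real.cos ⟪x, z⟫ * Real.exp (-t * ‖z‖ ^ α) := by
    intro z
    rw [inner_smul_left, inner_smul_right, norm_smul, Real.norm_of_nonneg hpos.le,
      Real.mul_rpow hpos.le (norm_nonneg _), ← Real.rpow_mul ht.le]
    have : (t ^ (-1/α)) * (t ^ (1/α) * ⟪x, z⟫) = ⟪x, z⟫ := by
      rw [← mul_assoc, ← Real.rpow_add ht]; ring_nf; simp
    simp only [conj_trivial]
    rw [this]
    have h3 : 1 / α * α = 1 := by field_simp
    rw [h3, Real.rpow_one]; ring_nf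
  simp_rw [e] at h
  rw [h, finrank_euclideanSpace, Fintype.card_fin, abs_of_nonneg (by positivity), smul_eq_mul]
  have : ((t ^ (1/α)) ^ d)⁻¹ = t ^ (-(d:ℝ)/α) := by
    rw [← Real.rpow_natCast, ← Real.rpow_mul ht.le, ← Real.rpow_neg ht.le]; congr 1; ring
  rw [this]; ring

lemma sk_mono (d : ℕ) [NeZero d] {α t : ℝ} (hα : 0 < α) (hα2 : α < 2) (ht : 0 < t) {x y : Ed d}
    (hxy : ‖x‖ ≤ ‖y‖) : 0 ≤ sk d α t y ∧ sk d α t y ≤ sk d α t x := by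
  have hg := good_exp_rpow d (γ := α / 2) (by linarith) (by linarith) ht.le
  have hp : ∀ z : Ed d, (‖z‖ ^ 2) ^ (α / 2) = ‖z‖ ^ α := by
    intro z
    rw [← Real.rpow_natCast, ← Real.rpow_mul (norm_nonneg _)]; congr 1; push_cast; ring
  have key : ∀ x : Ed d, Tendsto (fun n : ℕ => Kf d (fun r => Real.exp (-t * r ^ (α / 2))) (1 / ((n:ℝ) + 1)) x)
      atTop (nhds (∫ z : Ed d, Real.cos ⟪x, z⟫ * Real.exp (-t * ‖z‖ ^ α))) := by
    intro x
    refine tendsto_integral_of_dominated_convergence (fun z => Real.exp (-t * ‖z‖ ^ α)) ?_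
      (integrable_expo d hα ht) ?_ ?_
    · intro n
      apply Measurable.aestronglyMeasurable; fun_prop
    · intro n
      refine Eventually.of_forall fun z => ?_
      beta_reduce
      rw [hp, norm_mul, norm_mul, Real.norm_eq_abs, Real.norm_eq_abs, Real.norm_eq_abs,
        Real.abs_exp, Real.abs_exp]
      have h1 := Real.abs_cos_le_one ⟪x, z⟫
      have h2 : Real.exp (-(1 / ((n:ℝ) + 1)) * ‖z‖ ^ 2) ≤ 1 := Real.exp_le_one_iff.2 (by
        rw [neg_mul, neg_nonpos]; positivity)
      calc _ ≤ 1 * (1 * Real.exp (-t * ‖z‖ ^ α)) := by gcongr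
        _ = _ := by ring
    · refine Eventually.of_forall fun z => ?_
      beta_reduce
      rw [hp]
      have h1 : Tendsto (fun n : ℕ => Real.exp (-(1 / ((n:ℝ) + 1)) * ‖z‖ ^ 2)) atTop (nhds 1) := by
        have := ((tendsto_one_div_add_atTop_nhds_zero_nat (𝕜 := ℝ)).neg.mul_const (‖z‖ ^ 2)).rexp
        simpa using this
      have := (h1.mul_const (Real.exp (-t * ‖z‖ ^ α))).const_mul (Real.cos ⟪x, z⟫)
      simpa using this
  have hm := fun n : ℕ => hg.mono (1 / ((n:ℝ) + 1)) (by positivity) x y hxy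
  have a := ge_of_tendsto (key y) (Eventually.of_forall fun n => (hm n).1)
  have b := le_of_tendsto_of_tendsto (key y) (key x) (Eventually.of_forall fun n => (hm n).2)
  rw [sk_def, sk_def]
  exact ⟨by positivity, by gcongr⟩

lemma sk_measurable (d : ℕ) (α : ℝ) : Measurable (fun p : ℝ × Ed d => sk d α p.1 p.2) := by
  simp_rw [sk_def]
  refine Measurable.const_mul ?_ _
  refine (StronglyMeasurable.integral_prod_right (f := fun (p : ℝ × Ed d) (z : Ed d) =>
    Real.cos ⟪p.2, z⟫ * Real.exp (-p.1 * ‖z‖ ^ α)) (Measurable.stronglyMeasurable ?_)).measurable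
  simp only [Function.uncurry_def]
  fun_prop

lemma sk_continuous (d : ℕ) [NeZero d] {α t : ℝ} (hα : 0 < α) (ht : 0 < t) :
    Continuous (fun x : Ed d => sk d α t x) := by
  simp_rw [sk_def]
  refine Continuous.mul continuous_const ?_
  refine continuous_of_dominated (bound := fun z => Real.exp (-t * ‖z‖ ^ α)) (fun x => ?_) (fun x => ?_)
    (integrable_expo d hα ht) ?_
  · apply Measurable.aestronglyMeasurable; fun_prop
  · refine Eventually.of_forall fun z => ?_
    rw [norm_mul, Real.norm_eq_abs, Real.norm_eq_abs, Real.abs_exp]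
    have h1 := Real.abs_cos_le_one ⟪x, z⟫
    nlinarith [Real.exp_pos (-t * ‖z‖ ^ α)]
  · refine Eventually.of_forall fun z => ?_
    fun_prop

/-- Gaussian test -/
lemma sk_gauss (d : ℕ) [NeZero d] {α t v : ℝ} (hα : 0 < α) (ht : 0 < t) (hv : 0 < v) :
    Integrable (fun x : Ed d => sk d α t x * Real.exp (-v * ‖x‖ ^ 2)) ∧
    ∫ x : Ed d, sk d α t x * Real.exp (-v * ‖x‖ ^ 2) = (2 * π) ^ (-(d:ℝ)) * (π / v) ^ ((d:ℝ) / 2) *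
      ∫ z : Ed d, Real.exp (-t * ‖z‖ ^ α) * Real.exp (-‖z‖ ^ 2 / (4 * v)) := by
  have hIntg : Integrable (fun p : Ed d × Ed d => (Real.cos ⟪p.1, p.2⟫ * Real.exp (-t * ‖p.2‖ ^ α)) *
      Real.exp (-v * ‖p.1‖ ^ 2)) := by
    refine ((integrable_gauss d hv).mul_prod (integrable_expo d hα ht)).mono
      (by apply Measurable.aestronglyMeasurable; fun_prop) (Eventually.of_forall fun p => ?_)
    simp only [norm_mul, Real.norm_eq_abs, Real.abs_exp]
    have h1 := Real.abs_cos_le_one ⟪p.1, p.2⟫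
    calc _ ≤ 1 * Real.exp (-t * ‖p.2‖ ^ α) * Real.exp (-v * ‖p.1‖ ^ 2) := by gcongr
      _ = _ := by ring
  have e0 : ∀ x : Ed d, sk d α t x * Real.exp (-v * ‖x‖ ^ 2) = (2 * π) ^ (-(d:ℝ)) *
      ∫ z : Ed d, (Real.cos ⟪x, z⟫ * Real.exp (-t * ‖z‖ ^ α)) * Real.exp (-v * ‖x‖ ^ 2) := by
    intro x
    rw [sk_def, integral_mul_const]; ring
  constructor
  · simp_rw [e0]
    exact hIntg.integral_prod_left.const_mul _
  · simp_rw [e0]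
    rw [integral_const_mul, integral_integral_swap hIntg, mul_assoc]
    congr 1
    rw [← integral_const_mul]
    congr 1; ext z
    have : ∀ x : Ed d, (Real.cos ⟪x, z⟫ * Real.exp (-t * ‖z‖ ^ α)) * Real.exp (-v * ‖x‖ ^ 2) =
      Real.exp (-t * ‖z‖ ^ α) * (Real.cos ⟪z, x⟫ * Real.exp (-v * ‖x‖ ^ 2)) := by
      intro x; rw [real_inner_comm]; ring
    simp_rw [this]
    rw [integral_const_mul, gauss_cos d hv z]; ring

lemma sk_nonneg (d : ℕ) [NeZero d] {α t : ℝ} (hα : 0 < α) (hα2 : α < 2) (ht : 0 < t) (x : Ed d) :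
    0 ≤ sk d α t x := (sk_mono d hα hα2 ht (le_refl ‖x‖)).1

lemma gauss_one (d : ℕ) : ∫ z : Ed d, Real.exp (-‖z‖ ^ 2) = π ^ ((d:ℝ)/2) := by
  have := gauss_cos d (v := 1) one_pos 0
  simpa using this

lemma sk_gauss' (d : ℕ) [NeZero d] {α ρ : ℝ} (hα : 0 < α) (hρ : 0 < ρ) :
    ∫ x : Ed d, sk d α 1 x * Real.exp (-(ρ ^ 2 / 4) * ‖x‖ ^ 2) = π ^ (-(d:ℝ)/2) *
      ∫ z : Ed d, Real.exp (-ρ ^ α * ‖z‖ ^ α) * Real.exp (-‖z‖ ^ 2) := by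
  rw [(sk_gauss d hα one_pos (v := ρ ^ 2 / 4) (by positivity)).2]
  have h := Measure.integral_comp_smul (volume : Measure (Ed d))
    (fun z : Ed d => Real.exp (-1 * ‖z‖ ^ α) * Real.exp (-‖z‖ ^ 2 / (4 * (ρ ^ 2 / 4)))) ρ
  have e : ∀ z : Ed d, Real.exp (-1 * ‖ρ • z‖ ^ α) * Real.exp (-‖ρ • z‖ ^ 2 / (4 * (ρ ^ 2 / 4))) =
      Real.exp (-ρ ^ α * ‖z‖ ^ α) * Real.exp (-‖z‖ ^ 2) := by
    intro z
    rw [norm_smul, Real.norm_of_nonneg hρ.le, Real.mul_rpow hρ.le (norm_nonneg _)]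
    congr 2
    · ring
    · field_simp
  simp_rw [e] at h
  rw [h, finrank_euclideanSpace, Fintype.card_fin, abs_of_nonneg (by positivity), smul_eq_mul,
    ← mul_assoc]
  congr 1
  have h1 : (ρ ^ d)⁻¹ = ρ ^ (-(d:ℝ)) := by rw [Real.rpow_neg hρ.le, Real.rpow_natCast]
  have h2 : π / (ρ ^ 2 / 4) = π * (ρ ^ (-2 : ℝ) * 2 ^ (2:ℝ)) := by
    rw [Real.rpow_neg hρ.le]; norm_num; field_simp
  rw [h1, h2, Real.mul_rpow (x := π) Real.pi_pos.le (by positivity),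
    Real.mul_rpow (x := ρ ^ (-2 : ℝ)) (by positivity) (by positivity),
    ← Real.rpow_mul hρ.le, ← Real.rpow_mul (by norm_num), Real.mul_rpow (by norm_num) Real.pi_pos.le]
  have e1 : (-2:ℝ) * (d / 2) = -d := by ring
  have e2 : (2:ℝ) * (d / 2) = d := by ring
  have e3 : -(d:ℝ)/2 = -d + d/2 := by ring
  rw [e1, e2, e3, Real.rpow_add Real.pi_pos, Real.rpow_neg (by norm_num : (0:ℝ) ≤ 2)]
  field_simp

lemma integrable_Aint (d : ℕ) [NeZero d] {α ρ : ℝ} (hρ : 0 < ρ) :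
    Integrable (fun z : Ed d => Real.exp (-ρ ^ α * ‖z‖ ^ α) * Real.exp (-‖z‖ ^ 2)) := by
  have hg := integrable_gauss d (v := 1) one_pos
  refine hg.mono (by apply Measurable.aestronglyMeasurable; fun_prop) (Eventually.of_forall fun z => ?_)
  rw [norm_mul, Real.norm_eq_abs, Real.norm_eq_abs, Real.norm_eq_abs, Real.abs_exp, Real.abs_exp,
    Real.abs_exp]
  have : Real.exp (-ρ ^ α * ‖z‖ ^ α) ≤ 1 := Real.exp_le_one_iff.2 (by
    rw [neg_mul, neg_nonpos]; positivity)
  calc _ ≤ 1 * Real.exp (-‖z‖ ^ 2) := by gcongr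
    _ = _ := by ring_nf

/-- The deficit function. -/
def defA (d : ℕ) (α ρ : ℝ) : ℝ := π ^ (-(d:ℝ)/2) *
      ∫ z : Ed d, (1 - Real.exp (-ρ ^ α * ‖z‖ ^ α)) * Real.exp (-‖z‖ ^ 2)

lemma sk_gauss_defA (d : ℕ) [NeZero d] {α ρ : ℝ} (hα : 0 < α) (hρ : 0 < ρ) :
    ∫ x : Ed d, sk d α 1 x * Real.exp (-(ρ ^ 2 / 4) * ‖x‖ ^ 2) = 1 - defA d α ρ := by
  rw [sk_gauss' d hα hρ, defA]
  have hg := integrable_gauss d (v := 1) one_pos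
  simp only [neg_mul, one_mul] at hg
  have hh := integrable_Aint d (α := α) hρ
  have : ∫ z : Ed d, (1 - Real.exp (-ρ ^ α * ‖z‖ ^ α)) * Real.exp (-‖z‖ ^ 2) =
      ∫ z : Ed d, (Real.exp (-‖z‖ ^ 2) - Real.exp (-ρ ^ α * ‖z‖ ^ α) * Real.exp (-‖z‖ ^ 2)) := by
    congr 1; ext z; ring
  rw [this, integral_sub hg hh, gauss_one, mul_sub, ← Real.rpow_add Real.pi_pos]
  ring_nf; simp

lemma defA_le (d : ℕ) [NeZero d] {α : ℝ} (hα : 0 < α) :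
    ∃ C : ℝ, 0 < C ∧ ∀ ρ : ℝ, 0 < ρ → defA d α ρ ≤ C * ρ ^ α := by
  have hi : Integrable (fun z : Ed d => ‖z‖ ^ α * Real.exp (-‖z‖ ^ 2)) := by
    have := integrable_radial_exp d (γ := -α) (p := 2) (b := 1) (by
      have : (0:ℝ) ≤ d := Nat.cast_nonneg d
      linarith) (by norm_num) one_pos
    simpa using this
  have hnn : 0 ≤ ∫ z : Ed d, ‖z‖ ^ α * Real.exp (-‖z‖ ^ 2) := integral_nonneg fun z => by positivity
  refine ⟨π ^ (-(d:ℝ)/2) * (∫ z : Ed d, ‖z‖ ^ α * Real.exp (-‖z‖ ^ 2)) + 1, by positivity, fun ρ hρ => ?_⟩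
  have : (∫ z : Ed d, (1 - Real.exp (-ρ ^ α * ‖z‖ ^ α)) * Real.exp (-‖z‖ ^ 2)) ≤
      ∫ z : Ed d, ρ ^ α * (‖z‖ ^ α * Real.exp (-‖z‖ ^ 2)) := by
    refine integral_mono_of_nonneg (Eventually.of_forall fun z => ?_) (hi.const_mul _)
      (Eventually.of_forall fun z => ?_)
    · have : Real.exp (-ρ ^ α * ‖z‖ ^ α) ≤ 1 := Real.exp_le_one_iff.2 (by
        rw [neg_mul, neg_nonpos]; positivity)
      have : 0 ≤ 1 - Real.exp (-ρ ^ α * ‖z‖ ^ α) := by linarith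
      simp only [Pi.zero_apply]; positivity
    · simp only
      rw [← mul_assoc]
      have := Real.add_one_le_exp (-ρ ^ α * ‖z‖ ^ α)
      gcongr
      linarith
  rw [integral_const_mul] at this
  calc defA d α ρ ≤ π ^ (-(d:ℝ)/2) * (ρ ^ α * ∫ z : Ed d, ‖z‖ ^ α * Real.exp (-‖z‖ ^ 2)) := by
        unfold defA; gcongr
    _ ≤ _ := by nlinarith [Real.rpow_pos_of_pos hρ α]

lemma defA_ge (d : ℕ) [NeZero d] {α : ℝ} :
    ∃ c : ℝ, 0 < c ∧ ∀ ρ : ℝ, 0 < ρ → ρ ≤ 1 → 0 < α → c * ρ ^ α ≤ defA d α ρ := by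
  have hg := integrable_gauss d (v := 1) one_pos
  simp only [neg_mul, one_mul] at hg
  have hIntg : ∀ ρ : ℝ, 0 < ρ → Integrable (fun z : Ed d => (1 - Real.exp (-ρ ^ α * ‖z‖ ^ α)) * Real.exp (-‖z‖ ^ 2)) := by
    intro ρ hρ
    have := hg.sub (integrable_Aint d (α := α) hρ)
    refine this.congr (Eventually.of_forall fun z => ?_)
    simp only [Pi.sub_apply]; ring
  have hpos : 0 < defA d α 1 := by
    unfold defA
    refine mul_pos (by positivity) ?_
    rw [integral_pos_iff_support_of_nonneg _ (hIntg 1 one_pos)]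
    · have : ({0}ᶜ : Set (Ed d)) ⊆ Function.support (fun z : Ed d => (1 - Real.exp (-1 ^ α * ‖z‖ ^ α)) * Real.exp (-‖z‖ ^ 2)) := by
        intro z hz
        have hz0 : 0 < ‖z‖ := norm_pos_iff.2 hz
        have : Real.exp (-1 ^ α * ‖z‖ ^ α) < 1 := (Real.exp_lt_exp.2 (show -1 ^ α * ‖z‖ ^ α < 0 by
          rw [neg_mul, neg_lt_zero]; positivity)).trans_eq Real.exp_zero
        have h2 : 0 < (1 - Real.exp (-1 ^ α * ‖z‖ ^ α)) * Real.exp (-‖z‖ ^ 2) :=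
          mul_pos (by linarith) (Real.exp_pos _)
        exact h2.ne'
      refine lt_of_lt_of_le ?_ (measure_mono this)
      exact (isOpen_compl_singleton (x := (0 : Ed d))).measure_pos volume ⟨EuclideanSpace.single ⟨0, Nat.pos_of_ne_zero (NeZero.ne d)⟩ 1, by simp⟩
    · intro z
      have : Real.exp (-1 ^ α * ‖z‖ ^ α) ≤ 1 := Real.exp_le_one_iff.2 (by
        rw [neg_mul, neg_nonpos]; positivity)
      have : 0 ≤ 1 - Real.exp (-1 ^ α * ‖z‖ ^ α) := by linarith
      simp only [Pi.zero_apply]; positivity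
  refine ⟨_, hpos, fun ρ hρ hρ1 hα => ?_⟩
  unfold defA
  rw [mul_assoc]
  gcongr
  rw [mul_comm, ← integral_const_mul]
  refine integral_mono ((hIntg 1 one_pos).const_mul _) (hIntg ρ hρ) fun z => ?_
  simp only
  rw [← mul_assoc]
  gcongr
  have hs1 : ρ ^ α ≤ 1 := Real.rpow_le_one hρ.le hρ1 hα.le
  have hs0 : 0 ≤ ρ ^ α := by positivity
  have hc := convexOn_exp.2 (mem_univ 0) (mem_univ (-‖z‖ ^ α)) (show 0 ≤ 1 - ρ ^ α by linarith) hs0 (by ring)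
  simp only [smul_eq_mul, mul_zero, zero_add, Real.exp_zero, mul_one] at hc
  have e : ρ ^ α * -‖z‖ ^ α = -ρ ^ α * ‖z‖ ^ α := by ring
  rw [e] at hc
  have e' : (-1 ^ α * ‖z‖ ^ α : ℝ) = - ‖z‖ ^ α := by rw [Real.one_rpow]; ring
  rw [e']
  linarith

lemma sk_mass (d : ℕ) [NeZero d] {α : ℝ} (hα : 0 < α) (hα2 : α < 2) :
    ∫⁻ x : Ed d, ENNReal.ofReal (sk d α 1 x) = 1 := by
  obtain ⟨C, hC, hA⟩ := defA_le d hα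
  have hA0 : ∀ ρ, 0 < ρ → 0 ≤ defA d α ρ := by
    intro ρ hρ
    unfold defA
    refine mul_nonneg (by positivity) (integral_nonneg fun z => ?_)
    have : Real.exp (-ρ ^ α * ‖z‖ ^ α) ≤ 1 := Real.exp_le_one_iff.2 (by
        rw [neg_mul, neg_nonpos]; positivity)
    have : 0 ≤ 1 - Real.exp (-ρ ^ α * ‖z‖ ^ α) := by linarith
    simp only [Pi.zero_apply]; positivity
  have hm : Measurable (fun x : Ed d => sk d α 1 x) := (sk_continuous d hα one_pos).measurable
  have key : Tendsto (fun n : ℕ => ∫⁻ x : Ed d, ENNReal.ofReal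
      (sk d α 1 x * Real.exp (-((1/((n:ℝ)+1)) ^ 2 / 4) * ‖x‖ ^ 2))) atTop
      (nhds (∫⁻ x : Ed d, ENNReal.ofReal (sk d α 1 x))) := by
    refine lintegral_tendsto_of_tendsto_of_monotone (fun n => ?_) (Eventually.of_forall fun x => ?_)
      (Eventually.of_forall fun x => ?_)
    · apply Measurable.aemeasurable; fun_prop
    · intro n m hnm
      have h0 := sk_nonneg d hα hα2 one_pos x
      simp only
      gcongr
    · refine ENNReal.tendsto_ofReal ?_
      have h1 := (tendsto_one_div_add_atTop_nhds_zero_nat (𝕜 := ℝ))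
      have := (((((h1.pow 2).div_const 4).neg.mul_const (‖x‖ ^ 2)).rexp).const_mul (sk d α 1 x))
      simpa using this
  have key2 : Tendsto (fun n : ℕ => ∫⁻ x : Ed d, ENNReal.ofReal
      (sk d α 1 x * Real.exp (-((1/((n:ℝ)+1)) ^ 2 / 4) * ‖x‖ ^ 2))) atTop
      (nhds (ENNReal.ofReal 1)) := by
    have e : ∀ n : ℕ, ∫⁻ x : Ed d, ENNReal.ofReal
      (sk d α 1 x * Real.exp (-((1/((n:ℝ)+1)) ^ 2 / 4) * ‖x‖ ^ 2)) = ENNReal.ofReal (1 - defA d α (1/((n:ℝ)+1))) := by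
      intro n
      rw [← sk_gauss_defA d hα (by positivity), ofReal_integral_eq_lintegral_ofReal]
      · exact (sk_gauss d hα one_pos (by positivity)).1
      · exact Eventually.of_forall fun x => mul_nonneg (sk_nonneg d hα hα2 one_pos x) (Real.exp_pos _).le
    simp_rw [e]
    refine ENNReal.tendsto_ofReal ?_
    have h1 := (tendsto_one_div_add_atTop_nhds_zero_nat (𝕜 := ℝ))
    have h2 : Tendsto (fun n : ℕ => C * (1/((n:ℝ)+1)) ^ α) atTop (nhds 0) := by
      have := ((Real.continuousAt_rpow_const 0 α (Or.inr hα.le)).tendsto.comp h1).const_mul C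
      simpa [Real.zero_rpow hα.ne'] using this
    have h3 := squeeze_zero (fun n : ℕ => hA0 (1/((n:ℝ)+1)) (by positivity)) (fun n => hA _ (by positivity)) h2
    simpa using h3.const_sub 1
  rw [tendsto_nhds_unique key key2]; simp

lemma sk_integrable_one (d : ℕ) [NeZero d] {α : ℝ} (hα : 0 < α) (hα2 : α < 2) :
    Integrable (fun x : Ed d => sk d α 1 x) ∧ ∫ x : Ed d, sk d α 1 x = 1 := by
  have h := sk_mass d hα hα2
  have hm : Measurable (fun x : Ed d => sk d α 1 x) := (sk_continuous d hα one_pos).measurable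
  have hnn : 0 ≤ᵐ[volume] fun x : Ed d => sk d α 1 x :=
    Eventually.of_forall fun x => sk_nonneg d hα hα2 one_pos x
  constructor
  · refine (lintegral_ofReal_ne_top_iff_integrable hm.aestronglyMeasurable hnn).1 (by rw [h]; simp)
  · rw [integral_eq_lintegral_of_nonneg_ae hnn hm.aestronglyMeasurable, h]; simp

lemma sk_defA (d : ℕ) [NeZero d] {α ρ : ℝ} (hα : 0 < α) (hα2 : α < 2) (hρ : 0 < ρ) :
    Integrable (fun x : Ed d => sk d α 1 x * (1 - Real.exp (-(ρ ^ 2 / 4) * ‖x‖ ^ 2))) ∧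
    ∫ x : Ed d, sk d α 1 x * (1 - Real.exp (-(ρ ^ 2 / 4) * ‖x‖ ^ 2)) = defA d α ρ := by
  have h1 := sk_integrable_one d hα hα2
  have h2 := (sk_gauss d hα one_pos (v := ρ ^ 2 / 4) (by positivity)).1
  have h3 := sk_gauss_defA d hα hρ
  simp_rw [mul_sub, mul_one]
  refine ⟨h1.1.sub h2, ?_⟩
  rw [integral_sub h1.1 h2, h1.2, h3]; ring

lemma vol_ball (d : ℕ) [NeZero d] {R : ℝ} (hR : 0 < R) :
    volume.real (Metric.ball (0 : Ed d) R) = R ^ d * volume.real (Metric.ball (0 : Ed d) 1) := by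
  rw [measureReal_def, measureReal_def, Measure.addHaar_ball_of_pos volume 0 hR]
  simp [ENNReal.toReal_mul, hR.le]

lemma vol_ball_pos (d : ℕ) : 0 < volume.real (Metric.ball (0 : Ed d) 1) := by
  rw [measureReal_def]
  exact ENNReal.toReal_pos (Metric.measure_ball_pos _ _ one_pos).ne' measure_ball_lt_top.ne

lemma g_nonneg {v s : ℝ} (hv : 0 ≤ v) : 0 ≤ 1 - Real.exp (-v * s ^ 2) := by
  have : Real.exp (-v * s ^ 2) ≤ 1 := Real.exp_le_one_iff.2 (by rw [neg_mul, neg_nonpos]; positivity)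
  linarith

lemma half_le_one_sub {u : ℝ} (h1 : 1 ≤ u) : 1 / 2 ≤ 1 - Real.exp (-u) := by
  have h2 := Real.add_one_le_exp u
  have : Real.exp (-u) ≤ 1 / 2 := by
    rw [Real.exp_neg, inv_eq_one_div]
    exact one_div_le_one_div_of_le (by norm_num) (by linarith)
  linarith

lemma sk_tail (d : ℕ) [NeZero d] {α : ℝ} (hα : 0 < α) (hα2 : α < 2) :
    ∃ C : ℝ, 0 < C ∧ ∀ r : ℝ, 0 < r → ∫ x in {x : Ed d | r ≤ ‖x‖}, sk d α 1 x ≤ C * r ^ (-α) := by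
  obtain ⟨C, hC, hA⟩ := defA_le d hα
  refine ⟨2 * (C * 2 ^ α), by positivity, fun r hr => ?_⟩
  have h1 := sk_defA d hα hα2 (ρ := 2 / r) (by positivity)
  have hS : MeasurableSet {x : Ed d | r ≤ ‖x‖} := measurableSet_le measurable_const measurable_norm
  have hi := (sk_integrable_one d hα hα2).1
  calc ∫ x in {x : Ed d | r ≤ ‖x‖}, sk d α 1 x
      ≤ ∫ x in {x : Ed d | r ≤ ‖x‖}, 2 * (sk d α 1 x * (1 - Real.exp (-((2/r) ^ 2 / 4) * ‖x‖ ^ 2))) := by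
        refine setIntegral_mono_on hi.integrableOn (h1.1.const_mul 2).integrableOn hS fun x hx => ?_
        have hx' : r ≤ ‖x‖ := hx
        have h2 := half_le_one_sub (u := ((2/r) ^ 2 / 4) * ‖x‖ ^ 2) (by
          have : (2/r)^2/4 * ‖x‖^2 = (‖x‖/r)^2 := by field_simp; ring
          rw [this]
          have : 1 ≤ ‖x‖ / r := by rw [le_div_iff₀ hr]; linarith
          nlinarith)
        rw [neg_mul]
        nlinarith [sk_nonneg d hα hα2 one_pos x]
    _ ≤ ∫ x, 2 * (sk d α 1 x * (1 - Real.exp (-((2/r) ^ 2 / 4) * ‖x‖ ^ 2))) := by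
        refine setIntegral_le_integral (h1.1.const_mul 2) (Eventually.of_forall fun x => ?_)
        have := sk_nonneg d hα hα2 one_pos x
        have := g_nonneg (v := (2/r)^2/4) (s := ‖x‖) (by positivity)
        simp only [Pi.zero_apply]; positivity
    _ = 2 * defA d α (2 / r) := by rw [integral_const_mul, h1.2]
    _ ≤ 2 * (C * (2 / r) ^ α) := by gcongr; exact hA _ (by positivity)
    _ = _ := by rw [Real.div_rpow (by norm_num) hr.le, Real.rpow_neg hr.le]; ring

lemma sk_upper (d : ℕ) [NeZero d] {α : ℝ} (hα : 0 < α) (hα2 : α < 2) :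
    ∃ C : ℝ, 0 < C ∧ ∀ x : Ed d, x ≠ 0 → sk d α 1 x ≤ C * ‖x‖ ^ (-((d:ℝ) + α)) := by
  obtain ⟨C, hC, hT⟩ := sk_tail d hα hα2
  have hω := vol_ball_pos d
  set ω := volume.real (Metric.ball (0 : Ed d) 1) with hωd
  refine ⟨C * 2 ^ α * 2 / ω, by positivity, fun x hx => ?_⟩
  have hx0 : 0 < ‖x‖ := norm_pos_iff.2 hx
  have hi := (sk_integrable_one d hα hα2).1
  set S : Set (Ed d) := Metric.ball 0 ‖x‖ \ Metric.ball 0 (‖x‖/2) with hS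
  have hSm : MeasurableSet S := measurableSet_ball.diff measurableSet_ball
  have hSf : volume S ≠ ⊤ := ((measure_mono sdiff_subset).trans_lt measure_ball_lt_top).ne
  have hv : ω * ‖x‖ ^ d / 2 ≤ volume.real S := by
    rw [hS, measureReal_sdiff (Metric.ball_subset_ball (by linarith)) measurableSet_ball,
      vol_ball d hx0, vol_ball d (by positivity : 0 < ‖x‖/2), ← hωd, div_pow]
    have h1 : (2:ℝ) ≤ 2 ^ d := by
      calc (2:ℝ) = 2 ^ 1 := by norm_num
        _ ≤ 2 ^ d := pow_le_pow_right₀ (by norm_num) (Nat.one_le_iff_ne_zero.2 (NeZero.ne d))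
    have : ‖x‖ ^ d / 2 ^ d ≤ ‖x‖ ^ d / 2 := by gcongr
    nlinarith
  have h1 : sk d α 1 x * volume.real S ≤ C * (‖x‖/2) ^ (-α) := by
    calc sk d α 1 x * volume.real S = ∫ z in S, sk d α 1 x := by
          rw [setIntegral_const, smul_eq_mul]; ring
      _ ≤ ∫ z in S, sk d α 1 z := by
          refine setIntegral_mono_on (integrableOn_const hSf) hi.integrableOn hSm fun z hz => ?_
          refine (sk_mono d hα hα2 one_pos ?_).2
          have := hz.1
          simp at this
          exact this.le
      _ ≤ ∫ z in {z : Ed d | ‖x‖/2 ≤ ‖z‖}, sk d α 1 z := by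
          refine setIntegral_mono_set hi.integrableOn
            (Eventually.of_forall fun z => sk_nonneg d hα hα2 one_pos z) (LE.le.eventuallyLE fun z hz => ?_)
          have := hz.2
          simpa using this
      _ ≤ _ := hT _ (by positivity)
  have h2 : sk d α 1 x * (ω * ‖x‖ ^ d / 2) ≤ C * (‖x‖/2) ^ (-α) :=
    (mul_le_mul_of_nonneg_left hv (sk_nonneg d hα hα2 one_pos x)).trans h1
  have e1 : (‖x‖/2) ^ (-α) = 2 ^ α * ‖x‖ ^ (-α) := by
    rw [Real.div_rpow hx0.le (by norm_num), Real.rpow_neg (by norm_num : (0:ℝ) ≤ 2)]; field_simp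
  have e2 : ‖x‖ ^ (-((d:ℝ) + α)) = ‖x‖ ^ (-α) / ‖x‖ ^ d := by
    rw [neg_add, add_comm, Real.rpow_add hx0, Real.rpow_neg hx0.le (d:ℝ), Real.rpow_natCast]; rfl
  rw [e1] at h2
  rw [e2]
  have hxd : 0 < ‖x‖ ^ d := by positivity
  have : C * 2 ^ α * 2 / ω * (‖x‖ ^ (-α) / ‖x‖ ^ d) = (C * (2 ^ α * ‖x‖ ^ (-α))) / (ω * ‖x‖ ^ d / 2) := by
    field_simp
  rw [this, le_div_iff₀ (by positivity)]
  exact h2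

lemma exists_small_rpow {p ε : ℝ} (hp : 0 < p) (hε : 0 < ε) : ∃ a : ℝ, 0 < a ∧ a ≤ 1 ∧ a ^ p ≤ ε := by
  refine ⟨min 1 (ε ^ (1/p)), by positivity, min_le_left _ _, ?_⟩
  calc (min 1 (ε ^ (1/p))) ^ p ≤ (ε ^ (1/p)) ^ p := by gcongr; exact min_le_right _ _
    _ = ε := by rw [← Real.rpow_mul hε.le]; field_simp; simp

lemma elem_ineq {A u : ℝ} (hA : 0 ≤ A) (hu0 : 0 ≤ u) (hu1 : u ≤ 1) :
    1 - Real.exp (-(A * u)) ≤ 2 * A * (1 - Real.exp (-u)) := by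
  have l1 := Real.add_one_le_exp (-(A * u))
  have l2 : Real.exp (-u) ≤ 1 - u / 2 := by
    have h6 := Real.add_one_le_exp u
    have h7 : Real.exp (-u) * Real.exp u = 1 := by rw [← Real.exp_add]; simp
    have h8 := Real.exp_pos (-u)
    have : Real.exp (-u) * (1 + u) ≤ 1 := by nlinarith
    nlinarith
  nlinarith

set_option maxHeartbeats 800000 in
lemma sk_lower_aux (d : ℕ) [NeZero d] {α : ℝ} (hα : 0 < α) (hα2 : α < 2) :
    ∃ a c : ℝ, 0 < a ∧ a ≤ 1 ∧ 0 < c ∧ ∀ r : ℝ, 1 ≤ r → ∀ y : Ed d, ‖y‖ = a * r →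
      c * r ^ (-((d:ℝ) + α)) ≤ sk d α 1 y := by
  obtain ⟨C1, hC1, hA⟩ := defA_le d hα
  obtain ⟨C2, hC2, hT⟩ := sk_tail d hα hα2
  obtain ⟨c, hc, hL⟩ := defA_ge d (α := α)
  have hω := vol_ball_pos d
  set ω := volume.real (Metric.ball (0 : Ed d) 1) with hωd
  obtain ⟨a, ha0, ha1, ha⟩ := exists_small_rpow (p := 2 - α) (ε := c / (8 * C1)) (by linarith) (by positivity)
  obtain ⟨b', hb0, hb1, hb⟩ := exists_small_rpow (p := α) (ε := c / (4 * C2)) hα (by positivity)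
  refine ⟨a, c / 2 * b' ^ d / ω, ha0, ha1, by positivity, fun r hr y hy => ?_⟩
  have hr0 : 0 < r := by linarith
  have hi := (sk_integrable_one d hα hα2).1
  set R := r / b' with hR
  have hR0 : 0 < R := by positivity
  have hA1 := sk_defA d hα hα2 (ρ := 1 / r) (by positivity)
  have hA2 := sk_defA d hα hα2 (ρ := 1 / (a * r)) (by positivity)
  have hsy := sk_nonneg d hα hα2 one_pos y
  have hSm : MeasurableSet {x : Ed d | R ≤ ‖x‖} := measurableSet_le measurable_const measurable_norm
  have i2 : Integrable ((Metric.ball (0 : Ed d) R).indicator fun _ => sk d α 1 y) :=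
    (integrable_indicator_iff measurableSet_ball).2 (integrableOn_const measure_ball_lt_top.ne)
  have i3 : Integrable ({x : Ed d | R ≤ ‖x‖}.indicator fun x => sk d α 1 x) := hi.indicator hSm
  have hpt : ∀ x : Ed d, sk d α 1 x * (1 - Real.exp (-((1/r) ^ 2 / 4) * ‖x‖ ^ 2)) ≤
      2 * a ^ 2 * (sk d α 1 x * (1 - Real.exp (-((1/(a*r)) ^ 2 / 4) * ‖x‖ ^ 2))) +
      (Metric.ball (0 : Ed d) R).indicator (fun _ => sk d α 1 y) x +
      {x : Ed d | R ≤ ‖x‖}.indicator (fun x => sk d α 1 x) x := by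
    intro x
    have hsx := sk_nonneg d hα hα2 one_pos x
    have g1 := g_nonneg (v := (1/r)^2/4) (s := ‖x‖) (by positivity)
    have g2 := g_nonneg (v := (1/(a*r))^2/4) (s := ‖x‖) (by positivity)
    have g1' : 1 - Real.exp (-((1/r) ^ 2 / 4) * ‖x‖ ^ 2) ≤ 1 := by
      linarith [Real.exp_pos (-((1/r) ^ 2 / 4) * ‖x‖ ^ 2)]
    have t2 : 0 ≤ (Metric.ball (0 : Ed d) R).indicator (fun _ => sk d α 1 y) x :=
      indicator_nonneg (fun _ _ => hsy) _
    have t3 : 0 ≤ {x : Ed d | R ≤ ‖x‖}.indicator (fun x => sk d α 1 x) x :=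
      indicator_nonneg (fun z _ => sk_nonneg d hα hα2 one_pos z) _
    have t1 : 0 ≤ 2 * a ^ 2 * (sk d α 1 x * (1 - Real.exp (-((1/(a*r)) ^ 2 / 4) * ‖x‖ ^ 2))) := by positivity
    rcases le_or_gt R ‖x‖ with h | h
    · have e3 : {x : Ed d | R ≤ ‖x‖}.indicator (fun x => sk d α 1 x) x = sk d α 1 x :=
        indicator_of_mem (s := {x : Ed d | R ≤ ‖x‖}) h _
      rw [e3]
      nlinarith
    · rcases le_or_gt (a * r) ‖x‖ with h' | h'
      · have e2 : (Metric.ball (0 : Ed d) R).indicator (fun _ => sk d α 1 y) x = sk d α 1 y :=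
          indicator_of_mem (by simpa using h) _
        rw [e2]
        have := (sk_mono d hα hα2 one_pos (x := y) (y := x) (by rw [hy]; exact h')).2
        nlinarith
      · have key : 1 - Real.exp (-((1/r) ^ 2 / 4) * ‖x‖ ^ 2) ≤
            2 * a ^ 2 * (1 - Real.exp (-((1/(a*r)) ^ 2 / 4) * ‖x‖ ^ 2)) := by
          set u := (1/(a*r)) ^ 2 / 4 * ‖x‖ ^ 2 with hu
          have e : (1/r) ^ 2 / 4 * ‖x‖ ^ 2 = a ^ 2 * u := by rw [hu]; field_simp
          rw [neg_mul, neg_mul, e, ← hu]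
          have hu0 : 0 ≤ u := by positivity
          have hu1 : u ≤ 1 := by
            have : u = (‖x‖/(a*r))^2/4 := by rw [hu]; field_simp
            rw [this]
            have h4 : ‖x‖/(a*r) ≤ 1 := by rw [div_le_one (by positivity)]; exact h'.le
            have h5 : 0 ≤ ‖x‖/(a*r) := by positivity
            have := pow_le_one₀ (n := 2) h5 h4
            linarith
          exact elem_ineq (by positivity) hu0 hu1
        have : sk d α 1 x * (1 - Real.exp (-((1/r) ^ 2 / 4) * ‖x‖ ^ 2)) ≤ 2 * a ^ 2 * (sk d α 1 x * (1 - Real.exp (-((1/(a*r)) ^ 2 / 4) * ‖x‖ ^ 2))) := by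
          nlinarith
        linarith
  have hIntg := integral_mono hA1.1 (((hA2.1.const_mul (2 * a ^ 2)).add i2).add i3) hpt
  rw [hA1.2, integral_add' ((hA2.1.const_mul (2 * a ^ 2)).add i2) i3, integral_add' (hA2.1.const_mul (2 * a ^ 2)) i2,
      integral_const_mul, hA2.2, integral_indicator measurableSet_ball, setIntegral_const,
      integral_indicator hSm, vol_ball d hR0, smul_eq_mul, ← hωd] at hIntg
  have b1 := hL (1/r) (by positivity) (by rw [div_le_one hr0]; exact hr) hα
  have b2 := hA (1/(a*r)) (by positivity)
  have b3 := hT R hR0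
  have p1 : (1/r) ^ α = r ^ (-α) := by rw [one_div, Real.inv_rpow hr0.le, Real.rpow_neg hr0.le]
  have p2 : a ^ 2 * (1/(a*r)) ^ α = a ^ (2 - α) * r ^ (-α) := by
    rw [one_div, Real.inv_rpow (by positivity), Real.mul_rpow ha0.le hr0.le, Real.rpow_sub ha0,
      Real.rpow_neg hr0.le, Real.rpow_ofNat]
    field_simp
  have p3 : R ^ (-α) = b' ^ α * r ^ (-α) := by
    rw [hR, Real.div_rpow hr0.le hb0.le, Real.rpow_neg hb0.le]; field_simp
  have hrα : 0 < r ^ (-α) := by positivity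
  have q2 : 2 * a ^ 2 * defA d α (1/(a*r)) ≤ c / 4 * r ^ (-α) := by
    calc 2 * a ^ 2 * defA d α (1/(a*r)) ≤ 2 * a ^ 2 * (C1 * (1/(a*r)) ^ α) := by gcongr
      _ = 2 * C1 * (a ^ 2 * (1/(a*r)) ^ α) := by ring
      _ = 2 * C1 * a ^ (2 - α) * r ^ (-α) := by rw [p2]; ring
      _ ≤ 2 * C1 * (c / (8 * C1)) * r ^ (-α) := by gcongr
      _ = _ := by field_simp; norm_num
  have q3 : (∫ x in {x : Ed d | R ≤ ‖x‖}, sk d α 1 x) ≤ c / 4 * r ^ (-α) := by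
    calc _ ≤ C2 * (b' ^ α * r ^ (-α)) := by rw [← p3]; exact b3
      _ ≤ C2 * (c / (4 * C2) * r ^ (-α)) := by gcongr
      _ = _ := by field_simp
  rw [p1] at b1
  have fin : c / 2 * r ^ (-α) ≤ R ^ d * ω * sk d α 1 y := by linarith
  have e2 : r ^ (-((d:ℝ) + α)) = r ^ (-α) / r ^ d := by
    rw [neg_add, add_comm, Real.rpow_add hr0, Real.rpow_neg hr0.le (d:ℝ), Real.rpow_natCast]; rfl
  rw [e2]
  have : c / 2 * b' ^ d / ω * (r ^ (-α) / r ^ d) = (c / 2 * r ^ (-α)) / (R ^ d * ω) := by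
    rw [hR, div_pow]; field_simp
  rw [this, div_le_iff₀ (by positivity)]
  linarith

lemma sk_bounds (d : ℕ) [NeZero d] {α : ℝ} (hα : 0 < α) (hα2 : α < 2) :
    ∃ c C : ℝ, 0 < c ∧ 0 < C ∧ ∀ x : Ed d, c * (1 + ‖x‖) ^ (-((d:ℝ) + α)) ≤ sk d α 1 x ∧
      sk d α 1 x ≤ C * (1 + ‖x‖) ^ (-((d:ℝ) + α)) := by
  obtain ⟨C, hC, hU⟩ := sk_upper d hα hα2
  obtain ⟨a, c, ha0, ha1, hc, hL⟩ := sk_lower_aux d hα hα2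
  have hs0 := sk_nonneg d hα hα2 one_pos (0 : Ed d)
  have hdα : 0 < (d:ℝ) + α := by positivity
  refine ⟨c * a ^ ((d:ℝ) + α), (C + sk d α 1 0) * 2 ^ ((d:ℝ) + α), by positivity, by positivity, fun x => ⟨?_, ?_⟩⟩
  · set r := max 1 (‖x‖ / a) with hr
    have hr1 : 1 ≤ r := le_max_left _ _
    have hr0 : 0 < r := by linarith
    let y : Ed d := EuclideanSpace.single ⟨0, Nat.pos_of_ne_zero (NeZero.ne d)⟩ (a * r)
    have hy : ‖y‖ = a * r := by
      simp only [y, PiLp.norm_single]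
      exact Real.norm_of_nonneg (by positivity)
    have h1 := hL r hr1 y hy
    have h2 := (sk_mono d hα hα2 one_pos (x := x) (y := y) (by
      rw [hy]
      have := le_max_right 1 (‖x‖/a)
      rw [← hr, div_le_iff₀ ha0] at this; linarith)).2
    refine le_trans ?_ (h1.trans h2)
    rw [mul_assoc]
    gcongr
    have h3 : a * r ≤ 1 + ‖x‖ := by
      rw [hr, mul_max_of_nonneg _ _ ha0.le]
      refine max_le (by linarith [norm_nonneg x]) ?_
      rw [mul_div_cancel₀ _ ha0.ne']; linarith
    calc a ^ ((d:ℝ) + α) * (1 + ‖x‖) ^ (-((d:ℝ) + α)) ≤ a ^ ((d:ℝ) + α) * (a * r) ^ (-((d:ℝ) + α)) := by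
          gcongr ?_ * ?_
          exact Real.rpow_le_rpow_of_nonpos (by positivity) h3 (by linarith)
      _ = r ^ (-((d:ℝ) + α)) := by
          rw [Real.mul_rpow ha0.le hr0.le, ← mul_assoc, ← Real.rpow_add ha0]; simp
  · have e : ∀ s : ℝ, 0 < s → (2:ℝ) ^ ((d:ℝ) + α) * (2 * s) ^ (-((d:ℝ) + α)) = s ^ (-((d:ℝ) + α)) := by
      intro s hs
      rw [Real.mul_rpow (by norm_num) hs.le, ← mul_assoc, ← Real.rpow_add (by norm_num)]; simp
    rcases le_or_gt ‖x‖ 1 with h | h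
    · have h1 := (sk_mono d hα hα2 one_pos (x := 0) (y := x) (by simp)).2
      have h2 : (2 * 1 : ℝ) ^ (-((d:ℝ) + α)) ≤ (1 + ‖x‖) ^ (-((d:ℝ) + α)) :=
        Real.rpow_le_rpow_of_nonpos (by positivity) (by linarith) (by linarith)
      have h3 := e 1 one_pos
      rw [Real.one_rpow] at h3
      calc sk d α 1 x ≤ (C + sk d α 1 0) * (2 ^ ((d:ℝ) + α) * (2 * 1) ^ (-((d:ℝ) + α))) := by
            rw [h3]; linarith
        _ ≤ (C + sk d α 1 0) * (2 ^ ((d:ℝ) + α) * (1 + ‖x‖) ^ (-((d:ℝ) + α))) := by gcongr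
        _ = _ := by ring
    · have h1 := hU x (norm_pos_iff.1 (by linarith))
      have h2 : (2 * ‖x‖ : ℝ) ^ (-((d:ℝ) + α)) ≤ (1 + ‖x‖) ^ (-((d:ℝ) + α)) :=
        Real.rpow_le_rpow_of_nonpos (by positivity) (by linarith) (by linarith)
      have h3 := e ‖x‖ (by linarith)
      calc sk d α 1 x ≤ (C + sk d α 1 0) * (2 ^ ((d:ℝ) + α) * (2 * ‖x‖) ^ (-((d:ℝ) + α))) := by
            rw [h3]
            refine h1.trans ?_
            gcongr; linarith
        _ ≤ (C + sk d α 1 0) * (2 ^ ((d:ℝ) + α) * (1 + ‖x‖) ^ (-((d:ℝ) + α))) := by gcongr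
        _ = _ := by ring

lemma lint_smul (d : ℕ) {r : ℝ} (hr : 0 < r) (f : Ed d → ENNReal) :
    ∫⁻ z, f (r • z) = ENNReal.ofReal (r ^ (-(d:ℝ))) * ∫⁻ z, f z := by
  have h := Measure.map_addHaar_smul (volume : Measure (Ed d)) hr.ne'
  have h2 := lintegral_map_equiv (μ := (volume : Measure (Ed d))) f
    (Homeomorph.smulOfNeZero r hr.ne').toMeasurableEquiv
  simp only [Homeomorph.toMeasurableEquiv_coe, Homeomorph.smulOfNeZero_apply] at h2
  rw [← h2, h, lintegral_smul_measure, finrank_euclideanSpace, Fintype.card_fin, abs_of_nonneg (by positivity),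
    Real.rpow_neg hr.le, Real.rpow_natCast]
  rfl

lemma sk_mass_t (d : ℕ) [NeZero d] {α t : ℝ} (hα : 0 < α) (hα2 : α < 2) (ht : 0 < t) :
    ∫⁻ x : Ed d, ENNReal.ofReal (sk d α t x) = 1 := by
  simp_rw [sk_scale d hα ht]
  have hpos : 0 < t ^ (-1/α) := by positivity
  simp_rw [ENNReal.ofReal_mul (Real.rpow_nonneg ht.le (-(d:ℝ)/α))]
  rw [lintegral_const_mul' _ _ ENNReal.ofReal_ne_top,
    lint_smul d hpos (fun x => ENNReal.ofReal (sk d α 1 x)), sk_mass d hα hα2, mul_one,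
    ← ENNReal.ofReal_mul (by positivity), ← Real.rpow_mul ht.le, ← Real.rpow_add ht]
  have : -(d:ℝ)/α + -1/α * -d = 0 := by ring
  rw [this]; simp

lemma sk_integrable (d : ℕ) [NeZero d] {α t : ℝ} (hα : 0 < α) (hα2 : α < 2) (ht : 0 < t) :
    Integrable (fun x : Ed d => sk d α t x) := by
  have h := sk_mass_t d hα hα2 ht
  have hm : Measurable (fun x : Ed d => sk d α t x) := (sk_continuous d hα ht).measurable
  have hnn : 0 ≤ᵐ[volume] fun x : Ed d => sk d α t x :=
    Eventually.of_forall fun x => sk_nonneg d hα hα2 ht x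
  exact (lintegral_ofReal_ne_top_iff_integrable hm.aestronglyMeasurable hnn).1 (by rw [h]; simp)

open FourierTransform in
lemma sk_cos (d : ℕ) [NeZero d] {α t : ℝ} (hα : 0 < α) (hα2 : α < 2) (ht : 0 < t) (ξ : Ed d) :
    ∫ x : Ed d, Real.cos ⟪x, ξ⟫ * sk d α t x = Real.exp (-t * ‖ξ‖ ^ α) := by
  set F : Ed d → ℂ := fun v => ((Real.exp (-t * ‖(2 * π) • v‖ ^ α) : ℝ) : ℂ) with hF
  have h2π : (0:ℝ) < 2 * π := by positivity
  have hFi' : Integrable (fun v : Ed d => Real.exp (-t * ‖(2 * π) • v‖ ^ α)) :=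
    (integrable_expo d hα ht).comp_smul h2π.ne'
  have hFi : Integrable F := hFi'.ofReal
  have hFc : Continuous F := by
    have : Continuous fun v : Ed d => ‖(2 * π) • v‖ ^ α :=
      (continuous_norm.comp (continuous_const_smul _)).rpow_const (fun _ => Or.inr hα.le)
    exact Complex.continuous_ofReal.comp (Real.continuous_exp.comp (continuous_const.mul this))
  have hcexp : ∀ a : ℝ, Complex.exp (a * Complex.I) = Real.cos a + Real.sin a * Complex.I := by
    intro a; rw [Complex.exp_mul_I]; simp
  have hft : ∀ w : Ed d, 𝓕 F w = (sk d α t w : ℂ) := by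
    intro w
    rw [Real.fourier_eq']
    have e : ∀ v : Ed d, Complex.exp (↑(-2 * π * ⟪v, w⟫) * Complex.I) • F v =
        ((Real.cos (2 * π * ⟪v, w⟫) * Real.exp (-t * ‖(2 * π) • v‖ ^ α) : ℝ) : ℂ) -
        ((Real.sin (2 * π * ⟪v, w⟫) * Real.exp (-t * ‖(2 * π) • v‖ ^ α) : ℝ) : ℂ) * Complex.I := by
      intro v
      have e1 : -2 * π * ⟪v, w⟫ = -(2 * π * ⟪v, w⟫) := by ring
      rw [hcexp, e1, Real.cos_neg, Real.sin_neg, smul_eq_mul, hF]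
      push_cast; ring
    simp_rw [e]
    have i1 : Integrable fun v : Ed d => Real.cos (2 * π * ⟪v, w⟫) * Real.exp (-t * ‖(2 * π) • v‖ ^ α) := by
      refine hFi'.mono (by apply Measurable.aestronglyMeasurable; fun_prop) (Eventually.of_forall fun z => ?_)
      rw [norm_mul, Real.norm_eq_abs]
      nlinarith [Real.abs_cos_le_one (2 * π * ⟪z, w⟫), norm_nonneg (Real.exp (-t * ‖(2 * π) • z‖ ^ α))]
    have i2 : Integrable fun v : Ed d => Real.sin (2 * π * ⟪v, w⟫) * Real.exp (-t * ‖(2 * π) • v‖ ^ α) := by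
      refine hFi'.mono (by apply Measurable.aestronglyMeasurable; fun_prop) (Eventually.of_forall fun z => ?_)
      rw [norm_mul, Real.norm_eq_abs]
      nlinarith [Real.abs_sin_le_one (2 * π * ⟪z, w⟫), norm_nonneg (Real.exp (-t * ‖(2 * π) • z‖ ^ α))]
    rw [integral_sub i1.ofReal (i2.ofReal.mul_const _), integral_mul_const, integral_complex_ofReal, integral_complex_ofReal]
    have odd : ∫ v : Ed d, Real.sin (2 * π * ⟪v, w⟫) * Real.exp (-t * ‖(2 * π) • v‖ ^ α) = 0 := by
      have := integral_neg_eq_self (fun v : Ed d => Real.sin (2 * π * ⟪v, w⟫) * Real.exp (-t * ‖(2 * π) • v‖ ^ α)) volume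
      simp only [inner_neg_left, mul_neg, Real.sin_neg, smul_neg, norm_neg, neg_mul, integral_neg] at this
      simp only [neg_mul]
      linarith
    rw [odd, sk_def]
    have hs := Measure.integral_comp_smul (volume : Measure (Ed d))
      (fun z : Ed d => Real.cos ⟪w, z⟫ * Real.exp (-t * ‖z‖ ^ α)) (2 * π)
    simp only [inner_smul_right] at hs
    rw [finrank_euclideanSpace, Fintype.card_fin, abs_of_nonneg (by positivity), smul_eq_mul] at hs
    rw [Real.rpow_neg h2π.le, Real.rpow_natCast, ← hs]
    simp_rw [real_inner_comm w]
    simp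
  have hinv := hFc.fourierInv_fourier_eq hFi (by
    rw [show 𝓕 F = fun w => (sk d α t w : ℂ) from funext hft]
    exact (sk_integrable d hα hα2 ht).ofReal)
  have h1 := congrFun hinv ((2 * π)⁻¹ • ξ)
  rw [show 𝓕 F = fun w => (sk d α t w : ℂ) from funext hft, Real.fourierInv_eq'] at h1
  have h3 := congrArg Complex.re h1
  have e2 : ∀ x : Ed d, Complex.exp (↑(2 * π * ⟪x, (2 * π)⁻¹ • ξ⟫) * Complex.I) • (sk d α t x : ℂ) =
      Complex.exp (↑⟪x, ξ⟫ * Complex.I) * (sk d α t x : ℂ) := by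
    intro x
    rw [inner_smul_right, ← mul_assoc, mul_inv_cancel₀ h2π.ne', one_mul, smul_eq_mul]
  simp_rw [e2] at h3
  have hre := integral_re (𝕜 := ℂ) (μ := (volume : Measure (Ed d))) (f := fun x : Ed d => Complex.exp (↑⟪x, ξ⟫ * Complex.I) * (sk d α t x : ℂ)) (by
    refine (Integrable.ofReal (𝕜 := ℂ) (sk_integrable d hα hα2 ht)).mono (by
      have := (sk_continuous d hα ht).measurable
      apply Measurable.aestronglyMeasurable; fun_prop) (Eventually.of_forall fun z => ?_)
    rw [norm_mul, Complex.norm_exp_ofReal_mul_I, one_mul]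
    exact le_refl _)
  simp only [RCLike.re_eq_complex_re] at hre
  rw [← hre] at h3
  rw [hF] at h3
  simp only [Complex.ofReal_re] at h3
  rw [smul_smul, mul_inv_cancel₀ h2π.ne', one_smul] at h3
  rw [← h3]
  congr 1; ext x
  rw [hcexp]
  simp only [Complex.add_re, Complex.add_im, Complex.mul_im, Complex.ofReal_re, Complex.mul_re, Complex.I_re, Complex.I_im, Complex.ofReal_im]
  ring

lemma sk_sin (d : ℕ) [NeZero d] {α t : ℝ} (ξ : Ed d) :
    ∫ x : Ed d, Real.sin ⟪x, ξ⟫ * sk d α t x = 0 := by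
  have := integral_neg_eq_self (fun v : Ed d => Real.sin ⟪v, ξ⟫ * sk d α t v) volume
  simp only [inner_neg_left, Real.sin_neg, sk_neg, neg_mul, integral_neg] at this
  linarith

lemma sk_conv (d : ℕ) [NeZero d] {α s t : ℝ} (hα : 0 < α) (hα2 : α < 2) (hs : 0 < s) (ht : 0 < t) (x : Ed d) :
    Integrable (fun z : Ed d => sk d α s z * sk d α t (x - z)) ∧
    ∫ z : Ed d, sk d α s z * sk d α t (x - z) = sk d α (s + t) x := by
  have his := sk_integrable d hα hα2 hs
  have hms := (sk_continuous d hα hs).measurable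
  have hIntg : Integrable (fun p : Ed d × Ed d => sk d α s p.1 * (Real.cos ⟪x - p.1, p.2⟫ * Real.exp (-t * ‖p.2‖ ^ α))) := by
    refine (his.mul_prod (integrable_expo d hα ht)).mono
      (by apply Measurable.aestronglyMeasurable; fun_prop) (Eventually.of_forall fun p => ?_)
    simp only [norm_mul, Real.norm_eq_abs, Real.abs_exp]
    have h1 := Real.abs_cos_le_one ⟪x - p.1, p.2⟫
    calc _ ≤ |sk d α s p.1| * (1 * Real.exp (-t * ‖p.2‖ ^ α)) := by gcongr
      _ = _ := by ring
  have e0 : ∀ z : Ed d, sk d α s z * sk d α t (x - z) = (2 * π) ^ (-(d:ℝ)) *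
      ∫ ξ : Ed d, sk d α s z * (Real.cos ⟪x - z, ξ⟫ * Real.exp (-t * ‖ξ‖ ^ α)) := by
    intro z
    rw [sk_def d α t, integral_const_mul]; ring
  simp_rw [e0]
  refine ⟨hIntg.integral_prod_left.const_mul _, ?_⟩
  rw [integral_const_mul, integral_integral_swap hIntg, sk_def]
  congr 2; ext ξ
  have e1 : ∀ z : Ed d, sk d α s z * (Real.cos ⟪x - z, ξ⟫ * Real.exp (-t * ‖ξ‖ ^ α)) =
    (Real.cos ⟪x, ξ⟫ * Real.exp (-t * ‖ξ‖ ^ α)) * (Real.cos ⟪z, ξ⟫ * sk d α s z) +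
    (Real.sin ⟪x, ξ⟫ * Real.exp (-t * ‖ξ‖ ^ α)) * (Real.sin ⟪z, ξ⟫ * sk d α s z) := by
    intro z
    rw [inner_sub_left, Real.cos_sub]; ring
  simp_rw [e1]
  have i1 : Integrable (fun z : Ed d => Real.cos ⟪z, ξ⟫ * sk d α s z) := by
    refine his.mono (by apply Measurable.aestronglyMeasurable; fun_prop) (Eventually.of_forall fun z => ?_)
    rw [norm_mul, Real.norm_eq_abs]
    nlinarith [Real.abs_cos_le_one ⟪z, ξ⟫, norm_nonneg (sk d α s z)]
  have i2 : Integrable (fun z : Ed d => Real.sin ⟪z, ξ⟫ * sk d α s z) := by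
    refine his.mono (by apply Measurable.aestronglyMeasurable; fun_prop) (Eventually.of_forall fun z => ?_)
    rw [norm_mul, Real.norm_eq_abs]
    nlinarith [Real.abs_sin_le_one ⟪z, ξ⟫, norm_nonneg (sk d α s z)]
  rw [integral_add (i1.const_mul _) (i2.const_mul _), integral_const_mul, integral_const_mul,
    sk_cos d hα hα2 hs, sk_sin, mul_zero, add_zero, mul_assoc, ← Real.exp_add]
  congr 2; ring

/-- The stable kernel, `ENNReal` valued, extended by zero to nonpositive times. -/
def kE (d : ℕ) (α t : ℝ) (x y : Ed d) : ENNReal := if 0 < t then ENNReal.ofReal (sk d α t (y - x)) else 0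

lemma kE_pos {d : ℕ} {α t : ℝ} (ht : 0 < t) (x y : Ed d) : kE d α t x y = ENNReal.ofReal (sk d α t (y - x)) := by
  simp [kE, ht]

lemma kE_nonpos {d : ℕ} {α t : ℝ} (ht : t ≤ 0) (x y : Ed d) : kE d α t x y = 0 := by
  simp [kE, not_lt.2 ht]

lemma kE_symm {d : ℕ} {α t : ℝ} (x y : Ed d) : kE d α t x y = kE d α t y x := by
  unfold kE; rw [← sk_neg, neg_sub]

lemma kE_meas_a1 (d : ℕ) : Measurable (fun p : ℝ × Ed d × Ed d => p.2.2 - p.2.1) := by fun_prop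
lemma kE_meas_a2 (d : ℕ) : Measurable (fun p : ℝ × Ed d × Ed d => (p.1, p.2.2 - p.2.1)) :=
  measurable_fst.prodMk (kE_meas_a1 d)
lemma kE_meas_a3 (d : ℕ) (α : ℝ): Measurable (fun p : ℝ × Ed d × Ed d => sk d α p.1 (p.2.2 - p.2.1)) := by
  have := (sk_measurable d α).comp (kE_meas_a2 d)
  simp only [Function.comp_def] at this
  exact this
lemma kE_meas_a4 (d : ℕ) : MeasurableSet {p : ℝ × Ed d × Ed d | 0 < p.1} :=
  measurableSet_lt measurable_const measurable_fst

lemma kE_meas_a5 (d : ℕ) (α : ℝ) : Measurable (fun p : ℝ × Ed d × Ed d => ENNReal.ofReal (sk d α p.1 (p.2.2 - p.2.1))) :=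
  (kE_meas_a3 d α).ennreal_ofReal

lemma kE_meas (d : ℕ) (α : ℝ) : Measurable (fun p : ℝ × Ed d × Ed d => kE d α p.1 p.2.1 p.2.2) := by
  have h5 := (kE_meas_a5 d α).indicator (kE_meas_a4 d)
  refine (congrArg Measurable ?_).mp h5
  funext p
  by_cases h : 0 < p.1
  · rw [kE_pos h, Set.indicator_of_mem (by exact h)]
  · rw [kE_nonpos (not_lt.1 h), Set.indicator_of_notMem (by exact h)]

lemma kE_mass (d : ℕ) [NeZero d] {α t : ℝ} (hα : 0 < α) (hα2 : α < 2) (ht : 0 < t) (x : Ed d) :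
    ∫⁻ y, kE d α t x y = 1 := by
  simp_rw [kE_pos ht]
  rw [lintegral_sub_right_eq_self (fun y => ENNReal.ofReal (sk d α t y))]
  exact sk_mass_t d hα hα2 ht

lemma kE_ck (d : ℕ) [NeZero d] {α s t : ℝ} (hα : 0 < α) (hα2 : α < 2) (hs : 0 < s) (ht : 0 < t) (x y : Ed d) :
    ∫⁻ z, kE d α s x z * kE d α t z y = kE d α (s + t) x y := by
  simp_rw [kE_pos hs, kE_pos ht, kE_pos (add_pos hs ht)]
  have h := sk_conv d hα hα2 hs ht (y - x)
  have e : ∀ z : Ed d, ENNReal.ofReal (sk d α s (z - x)) * ENNReal.ofReal (sk d α t (y - z)) =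
    (fun w => ENNReal.ofReal (sk d α s w * sk d α t (y - x - w))) (z - x) := by
    intro z
    simp only
    rw [← ENNReal.ofReal_mul (sk_nonneg d hα hα2 hs _)]
    congr 3; abel_nf
  simp_rw [e]
  rw [lintegral_sub_right_eq_self (fun w => ENNReal.ofReal (sk d α s w * sk d α t (y - x - w))), ← h.2]
  rw [ofReal_integral_eq_lintegral_ofReal h.1]
  exact Eventually.of_forall fun w => mul_nonneg (sk_nonneg d hα hα2 hs _) (sk_nonneg d hα hα2 ht _)

/-! ## Abstract Schrödinger perturbations, `ENNReal` valued -/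

section Abstract
variable {X : Type*} [MeasurableSpace X] (μ : Measure X) [SFinite μ]

/-- joint measurability of a kernel -/
def MK (f : ℝ → X → X → ENNReal) : Prop := Measurable (fun p : ℝ × X × X => f p.1 p.2.1 p.2.2)

lemma MK.comp {f : ℝ → X → X → ENNReal} (hf : MK f) {Y : Type*} [MeasurableSpace Y] {a : Y → ℝ} {b c : Y → X}
    (ha : Measurable a) (hb : Measurable b) (hc : Measurable c) : Measurable (fun y => f (a y) (b y) (c y)) :=
  (show Measurable (fun p : ℝ × X × X => f p.1 p.2.1 p.2.2) from hf).comp (ha.prodMk (hb.prodMk hc))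

/-- convolution -/
def kstar (q : X → ENNReal) (f g : ℝ → X → X → ENNReal) (t : ℝ) (x y : X) : ENNReal :=
  ∫⁻ p : ℝ × X, f p.1 x p.2 * q p.2 * g (t - p.1) p.2 y ∂(volume.prod μ)

lemma star_meas {q : X → ENNReal} (hq : Measurable q) {f g : ℝ → X → X → ENNReal} (hf : MK f) (hg : MK g) :
    MK (kstar μ q f g) := by
  have h : Measurable (Function.uncurry fun (a : ℝ × X × X) (p : ℝ × X) =>
      f p.1 a.2.1 p.2 * q p.2 * g (a.1 - p.1) p.2 a.2.2) := by
    simp only [Function.uncurry_def]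
    exact ((hf.comp (by fun_prop) (by fun_prop) (by fun_prop)).mul (hq.comp (by fun_prop))).mul
      (hg.comp (by fun_prop) (by fun_prop) (by fun_prop))
  exact h.lintegral_prod_right

lemma lint_shift {F : ℝ × X → ENNReal} (hF : Measurable F) (c : ℝ) :
    ∫⁻ p, F (p.1 - c, p.2) ∂(volume.prod μ) = ∫⁻ p, F p ∂(volume.prod μ) := by
  rw [lintegral_prod_symm _ (by fun_prop), lintegral_prod_symm _ (by fun_prop)]
  refine lintegral_congr fun z => ?_
  exact lintegral_sub_right_eq_self (fun s => F (s, z)) c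

lemma lint_refl {F : ℝ × X → ENNReal} (hF : Measurable F) (c : ℝ) :
    ∫⁻ p, F (c - p.1, p.2) ∂(volume.prod μ) = ∫⁻ p, F p ∂(volume.prod μ) := by
  rw [lintegral_prod_symm _ (by fun_prop), lintegral_prod_symm _ (by fun_prop)]
  refine lintegral_congr fun z => ?_
  exact lintegral_sub_left_eq_self (fun s => F (s, z)) c

lemma star_assoc {q : X → ENNReal} (hq : Measurable q) {f g h : ℝ → X → X → ENNReal} (hf : MK f) (hg : MK g) (hh : MK h)
    (t : ℝ) (x y : X) : kstar μ q (kstar μ q f g) h t x y = kstar μ q f (kstar μ q g h) t x y := by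
  have h1 : ∀ p : ℝ × X, kstar μ q f g p.1 x p.2 * q p.2 * h (t - p.1) p.2 y =
      ∫⁻ r : ℝ × X, f r.1 x r.2 * q r.2 * g (p.1 - r.1) r.2 p.2 * (q p.2 * h (t - p.1) p.2 y) ∂(volume.prod μ) := by
    intro p
    rw [lintegral_mul_const]
    · rw [mul_assoc]; rfl
    · exact ((hf.comp (by fun_prop) (by fun_prop) (by fun_prop)).mul (hq.comp (by fun_prop))).mul
        (hg.comp (by fun_prop) (by fun_prop) (by fun_prop))
  have h2 : ∀ r : ℝ × X, f r.1 x r.2 * q r.2 * kstar μ q g h (t - r.1) r.2 y =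
      ∫⁻ p : ℝ × X, f r.1 x r.2 * q r.2 * g (p.1 - r.1) r.2 p.2 * (q p.2 * h (t - p.1) p.2 y) ∂(volume.prod μ) := by
    intro r
    have hm : Measurable (fun p : ℝ × X => g p.1 r.2 p.2 * q p.2 * h (t - r.1 - p.1) p.2 y) :=
      ((hg.comp (by fun_prop) (by fun_prop) (by fun_prop)).mul (hq.comp (by fun_prop))).mul
        (hh.comp (by fun_prop) (by fun_prop) (by fun_prop))
    have := lint_shift μ hm r.1
    unfold kstar
    rw [← this, ← lintegral_const_mul]
    · refine lintegral_congr fun p => ?_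
      have e : t - r.1 - (p.1 - r.1) = t - p.1 := by ring
      simp only [e]
      ring
    · exact hm.comp (by fun_prop : Measurable fun p : ℝ × X => (p.1 - r.1, p.2))
  have e1 : kstar μ q (kstar μ q f g) h t x y = ∫⁻ p : ℝ × X, ∫⁻ r : ℝ × X, f r.1 x r.2 * q r.2 * g (p.1 - r.1) r.2 p.2 * (q p.2 * h (t - p.1) p.2 y) ∂(volume.prod μ) ∂(volume.prod μ) :=
    lintegral_congr h1
  have e2 : kstar μ q f (kstar μ q g h) t x y = ∫⁻ r : ℝ × X, ∫⁻ p : ℝ × X, f r.1 x r.2 * q r.2 * g (p.1 - r.1) r.2 p.2 * (q p.2 * h (t - p.1) p.2 y) ∂(volume.prod μ) ∂(volume.prod μ) :=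
    lintegral_congr h2
  rw [e1, e2, lintegral_lintegral_swap]
  apply Measurable.aemeasurable
  simp only [Function.uncurry_def]
  exact (((hf.comp (by fun_prop) (by fun_prop) (by fun_prop)).mul (hq.comp (by fun_prop))).mul
        (hg.comp (by fun_prop) (by fun_prop) (by fun_prop))).mul ((hq.comp (by fun_prop)).mul
        (hh.comp (by fun_prop) (by fun_prop) (by fun_prop)))

/-- perturbation series terms -/
def pn (k : ℝ → X → X → ENNReal) (q : X → ENNReal) : ℕ → ℝ → X → X → ENNReal
  | 0 => k
  | n + 1 => kstar μ q (pn k q n) k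

/-- perturbed kernel -/
def pt (k : ℝ → X → X → ENNReal) (q : X → ENNReal) (t : ℝ) (x y : X) : ENNReal := ∑' n, pn μ k q n t x y

variable {k : ℝ → X → X → ENNReal} {q : X → ENNReal}

lemma pn_meas (hk : MK k) (hq : Measurable q) (n : ℕ) : MK (pn μ k q n) := by
  induction n with
  | zero => exact hk
  | succ n ih => exact star_meas μ hq ih hk

lemma pt_meas (hk : MK k) (hq : Measurable q) : MK (pt μ k q) := by
  unfold MK pt
  exact Measurable.tsum fun n => pn_meas μ hk hq n

lemma star_nonpos {f g : ℝ → X → X → ENNReal} (hf : ∀ t ≤ 0, ∀ x y, f t x y = 0) (hg : ∀ t ≤ 0, ∀ x y, g t x y = 0)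
    {t : ℝ} (ht : t ≤ 0) (x y : X) : kstar μ q f g t x y = 0 := by
  unfold kstar
  rw [← lintegral_zero (μ := (volume : Measure ℝ).prod μ)]
  refine lintegral_congr fun p => ?_
  rcases le_or_gt p.1 0 with h | h
  · rw [hf _ h]; simp
  · rw [hg (t - p.1) (by linarith)]; simp

lemma pn_nonpos (h0 : ∀ t ≤ 0, ∀ x y, k t x y = 0) (n : ℕ) : ∀ t ≤ 0, ∀ x y, pn μ k q n t x y = 0 := by
  induction n with
  | zero => exact h0
  | succ n ih => exact fun t ht x y => star_nonpos μ ih h0 ht x y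

lemma pt_nonpos (h0 : ∀ t ≤ 0, ∀ x y, k t x y = 0) : ∀ t ≤ 0, ∀ x y, pt μ k q t x y = 0 := by
  intro t ht x y
  simp [pt, pn_nonpos μ h0 _ t ht x y]

lemma pn_succ' (hk : MK k) (hq : Measurable q) (n : ℕ) (t : ℝ) (x y : X) :
    pn μ k q (n + 1) t x y = kstar μ q k (pn μ k q n) t x y := by
  induction n generalizing t x y with
  | zero => rfl
  | succ n ih =>
    have e : pn μ k q (n + 1) = kstar μ q k (pn μ k q n) := by
      funext t x y; exact ih t x y
    change kstar μ q (pn μ k q (n + 1)) k t x y = _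
    rw [e, star_assoc μ hq hk (pn_meas μ hk hq n) hk]
    rw [show kstar μ q (pn μ k q n) k = pn μ k q (n + 1) from rfl, e]

lemma star_symm {f g : ℝ → X → X → ENNReal} (hq : Measurable q) (hf : MK f) (hg : MK g)
    (sf : ∀ t x y, f t x y = f t y x) (sg : ∀ t x y, g t x y = g t y x) (t : ℝ) (x y : X) :
    kstar μ q f g t x y = kstar μ q g f t y x := by
  unfold kstar
  have hm : Measurable (fun p : ℝ × X => g p.1 y p.2 * q p.2 * f (t - p.1) p.2 x) :=
      ((hg.comp (by fun_prop) (by fun_prop) (by fun_prop)).mul (hq.comp (by fun_prop))).mul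
        (hf.comp (by fun_prop) (by fun_prop) (by fun_prop))
  rw [← lint_refl μ hm t]
  refine lintegral_congr fun p => ?_
  simp only [sub_sub_cancel]
  rw [sf p.1 x, sg (t - p.1) p.2]; ring

lemma pn_symm (hk : MK k) (hq : Measurable q) (sk : ∀ t x y, k t x y = k t y x) (n : ℕ) :
    ∀ t x y, pn μ k q n t x y = pn μ k q n t y x := by
  induction n with
  | zero => exact sk
  | succ n ih =>
    intro t x y
    rw [pn_succ' μ hk hq n t y x]
    exact star_symm μ hq (pn_meas μ hk hq n) hk ih sk t x y

lemma pt_symm (hk : MK k) (hq : Measurable q) (sk : ∀ t x y, k t x y = k t y x) (t : ℝ) (x y : X) :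
    pt μ k q t x y = pt μ k q t y x := by
  unfold pt
  simp_rw [fun n => pn_symm μ hk hq sk n t x y]

lemma duhamel_l (hk : MK k) (hq : Measurable q) (t : ℝ) (x y : X) :
    pt μ k q t x y = k t x y + kstar μ q (pt μ k q) k t x y := by
  conv_lhs => unfold pt
  rw [tsum_eq_zero_add' ENNReal.summable]
  congr 1
  unfold kstar pt
  simp_rw [← ENNReal.tsum_mul_right]
  rw [lintegral_tsum]
  · rfl
  · intro n
    exact ((((pn_meas μ hk hq n).comp (by fun_prop) (by fun_prop) (by fun_prop)).mul (hq.comp (by fun_prop))).mul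
        (hk.comp (by fun_prop) (by fun_prop) (by fun_prop))).aemeasurable

lemma duhamel_r (hk : MK k) (hq : Measurable q) (t : ℝ) (x y : X) :
    pt μ k q t x y = k t x y + kstar μ q k (pt μ k q) t x y := by
  conv_lhs => unfold pt
  rw [tsum_eq_zero_add' ENNReal.summable]
  congr 1
  simp_rw [pn_succ' μ hk hq]
  unfold kstar pt
  simp_rw [← ENNReal.tsum_mul_left]
  rw [lintegral_tsum]
  · intro n
    exact (((hk.comp (by fun_prop) (by fun_prop) (by fun_prop)).mul (hq.comp (by fun_prop))).mul
        ((pn_meas μ hk hq n).comp (by fun_prop) (by fun_prop) (by fun_prop))).aemeasurable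

lemma k_le_pt (t : ℝ) (x y : X) : k t x y ≤ pt μ k q t x y := ENNReal.le_tsum (f := fun n => pn μ k q n t x y) 0

/-- Chapman–Kolmogorov -/
def CK (k : ℝ → X → X → ENNReal) : Prop :=
  ∀ s t : ℝ, 0 < s → 0 < t → ∀ x y, ∫⁻ z, k s x z * k t z y ∂μ = k (s + t) x y


lemma ae_ne_time (s : ℝ) : ∀ᵐ p ∂((volume : Measure ℝ).prod μ), p.1 ≠ s := by
  have : (volume : Measure ℝ).prod μ ({s} ×ˢ univ) = 0 := by rw [Measure.prod_prod]; simp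
  rw [ae_iff]
  refine measure_mono_null (fun p hp => ?_) this
  simpa using hp

lemma pn_ck (hk : MK k) (hq : Measurable q) (h0 : ∀ t ≤ 0, ∀ x y, k t x y = 0) (hck : CK μ k) (n : ℕ) :
    ∀ s t : ℝ, 0 < s → 0 < t → ∀ x y, pn μ k q n (s + t) x y =
      ∑ ij ∈ Finset.HasAntidiagonal.antidiagonal n, ∫⁻ z, pn μ k q ij.1 s x z * pn μ k q ij.2 t z y ∂μ := by
  induction n with
  | zero => intro s t hs ht x y; simp only [Finset.Nat.antidiagonal_zero, Finset.sum_singleton]; exact (hck s t hs ht x y).symm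
  | succ n ih =>
    intro s t hs ht x y
    have hpm := fun i => pn_meas μ hk hq i
    rw [pn_succ' μ hk hq]
    have hpt : ∀ᵐ p ∂((volume : Measure ℝ).prod μ), k p.1 x p.2 * q p.2 * pn μ k q n (s + t - p.1) p.2 y =
        (∫⁻ z, k s x z * (k (p.1 - s) z p.2 * q p.2 * pn μ k q n (t - (p.1 - s)) p.2 y) ∂μ) +
        ∑ ij ∈ Finset.HasAntidiagonal.antidiagonal n, ∫⁻ z, (k p.1 x p.2 * q p.2 * pn μ k q ij.1 (s - p.1) p.2 z) * pn μ k q ij.2 t z y ∂μ := by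
      filter_upwards [ae_ne_time μ s] with p hp
      rcases lt_or_gt_of_ne hp with h | h
      · have e1 : ∀ z, k s x z * (k (p.1 - s) z p.2 * q p.2 * pn μ k q n (t - (p.1 - s)) p.2 y) = 0 := by
          intro z; rw [h0 (p.1 - s) (by linarith)]; simp
        simp_rw [e1]
        have e2 : s + t - p.1 = (s - p.1) + t := by ring
        rw [lintegral_zero, zero_add, e2, ih (s - p.1) t (by linarith) ht, Finset.mul_sum]
        refine Finset.sum_congr rfl fun ij _ => ?_
        rw [← lintegral_const_mul]
        · refine lintegral_congr fun z => ?_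
          ring
        · exact ((hpm _).comp (by fun_prop) (by fun_prop) (by fun_prop)).mul
            ((hpm _).comp (by fun_prop) (by fun_prop) (by fun_prop))
      · have e1 : ∀ (ij : ℕ × ℕ) z, (k p.1 x p.2 * q p.2 * pn μ k q ij.1 (s - p.1) p.2 z) * pn μ k q ij.2 t z y = 0 := by
          intro ij z; rw [pn_nonpos μ h0 ij.1 (s - p.1) (by linarith)]; simp
        simp_rw [e1]
        have e2 : t - (p.1 - s) = s + t - p.1 := by ring
        have e3 : ∀ z, k s x z * (k (p.1 - s) z p.2 * q p.2 * pn μ k q n (s + t - p.1) p.2 y) =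
          (k s x z * k (p.1 - s) z p.2) * (q p.2 * pn μ k q n (s + t - p.1) p.2 y) := by intro z; ring
        simp_rw [e2, e3]
        rw [lintegral_mul_const, hck s (p.1 - s) hs (by linarith)]
        · simp [mul_assoc]
        · exact (hk.comp (by fun_prop) (by fun_prop) (by fun_prop)).mul
            (hk.comp (by fun_prop) (by fun_prop) (by fun_prop))
    unfold kstar
    rw [lintegral_congr_ae hpt]
    have hm1 : Measurable (Function.uncurry fun (p : ℝ × X) (z : X) => k s x z * (k (p.1 - s) z p.2 * q p.2 * pn μ k q n (t - (p.1 - s)) p.2 y)) := by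
      simp only [Function.uncurry_def]
      exact (hk.comp (by fun_prop) (by fun_prop) (by fun_prop)).mul
        (((hk.comp (by fun_prop) (by fun_prop) (by fun_prop)).mul (hq.comp (by fun_prop))).mul
        ((hpm n).comp (by fun_prop) (by fun_prop) (by fun_prop)))
    have hm2 : ∀ ij : ℕ × ℕ, Measurable (Function.uncurry fun (p : ℝ × X) (z : X) =>
        (k p.1 x p.2 * q p.2 * pn μ k q ij.1 (s - p.1) p.2 z) * pn μ k q ij.2 t z y) := by
      intro ij
      simp only [Function.uncurry_def]
      exact (((hk.comp (by fun_prop) (by fun_prop) (by fun_prop)).mul (hq.comp (by fun_prop))).mul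
        ((hpm _).comp (by fun_prop) (by fun_prop) (by fun_prop))).mul
        ((hpm _).comp (by fun_prop) (by fun_prop) (by fun_prop))
    rw [lintegral_add_left hm1.lintegral_prod_right, lintegral_finsetSum]
    · rw [Finset.Nat.antidiagonal_succ, Finset.sum_cons]
      congr 1
      · rw [lintegral_lintegral_swap hm1.aemeasurable]
        refine lintegral_congr fun z => ?_
        have hm3 : Measurable (fun p : ℝ × X => k p.1 z p.2 * q p.2 * pn μ k q n (t - p.1) p.2 y) :=
          ((hk.comp (by fun_prop) (by fun_prop) (by fun_prop)).mul (hq.comp (by fun_prop))).mul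
          ((hpm n).comp (by fun_prop) (by fun_prop) (by fun_prop))
        rw [lintegral_const_mul, lint_shift μ hm3 s, pn_succ' μ hk hq]
        · rfl
        · exact hm3.comp (by fun_prop : Measurable fun p : ℝ × X => (p.1 - s, p.2))
      · rw [Finset.sum_map]
        refine Finset.sum_congr rfl fun ij _ => ?_
        rw [lintegral_lintegral_swap (hm2 ij).aemeasurable]
        refine lintegral_congr fun z => ?_
        rw [lintegral_mul_const]
        · simp only [Function.Embedding.prodMap, Function.Embedding.coeFn_mk, Prod.map]
          simp only [Function.Embedding.refl_apply, Nat.succ_eq_add_one]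
          rw [pn_succ' μ hk hq]; rfl
        · exact ((hk.comp (by fun_prop) (by fun_prop) (by fun_prop)).mul (hq.comp (by fun_prop))).mul
            ((hpm _).comp (by fun_prop) (by fun_prop) (by fun_prop))
    · intro ij _
      exact (hm2 ij).lintegral_prod_right

lemma pt_ck (hk : MK k) (hq : Measurable q) (h0 : ∀ t ≤ 0, ∀ x y, k t x y = 0) (hck : CK μ k) :
    CK μ (pt μ k q) := by
  intro s t hs ht x y
  have hpm := fun i => pn_meas μ hk hq i
  have e : ∀ z, pt μ k q s x z * pt μ k q t z y = ∑' i, ∑' j, pn μ k q i s x z * pn μ k q j t z y := by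
    intro z
    unfold pt
    simp_rw [ENNReal.tsum_mul_left, ENNReal.tsum_mul_right]
  simp_rw [e]
  have hm : ∀ i j, Measurable (fun z => pn μ k q i s x z * pn μ k q j t z y) := fun i j =>
    ((hpm _).comp (by fun_prop) (by fun_prop) (by fun_prop)).mul
            ((hpm _).comp (by fun_prop) (by fun_prop) (by fun_prop))
  rw [lintegral_tsum (fun i => (Measurable.tsum fun j => hm i j).aemeasurable)]
  have e2 : ∀ i, ∫⁻ z, ∑' j, pn μ k q i s x z * pn μ k q j t z y ∂μ = ∑' j, ∫⁻ z, pn μ k q i s x z * pn μ k q j t z y ∂μ :=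
    fun i => lintegral_tsum (fun j => (hm i j).aemeasurable)
  simp_rw [e2]
  unfold pt
  simp_rw [pn_ck μ hk hq h0 hck _ s t hs ht x y]
  rw [← ENNReal.tsum_prod (f := fun i j => ∫⁻ z, pn μ k q i s x z * pn μ k q j t z y ∂μ)]
  rw [← Finset.HasAntidiagonal.sigmaAntidiagonalEquivProd.tsum_eq (fun ij : ℕ × ℕ => ∫⁻ z, pn μ k q ij.1 s x z * pn μ k q ij.2 t z y ∂μ)]
  rw [ENNReal.tsum_sigma']
  refine tsum_congr fun n => ?_
  rw [tsum_fintype]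
  simp only [Finset.HasAntidiagonal.sigmaAntidiagonalEquivProd_apply, Finset.univ_eq_attach]
  exact Finset.sum_attach (Finset.HasAntidiagonal.antidiagonal n) (fun ij => ∫⁻ z, pn μ k q ij.1 s x z * pn μ k q ij.2 t z y ∂μ)
end Abstract

section Abstract2
variable {X : Type*} [MeasurableSpace X] (μ : Measure X) [SFinite μ]

/-- action of a kernel on a function -/
def act (k : ℝ → X → X → ENNReal) (f : X → ENNReal) (t : ℝ) (x : X) : ENNReal := ∫⁻ z, k t x z * f z ∂μ

lemma act_meas {k : ℝ → X → X → ENNReal} (hk : MK k) {f : X → ENNReal} (hf : Measurable f) :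
    Measurable (fun p : ℝ × X => act μ k f p.1 p.2) := by
  have : Measurable (Function.uncurry fun (p : ℝ × X) (z : X) => k p.1 p.2 z * f z) := by
    simp only [Function.uncurry_def]
    exact (hk.comp (by fun_prop) (by fun_prop) (by fun_prop)).mul (hf.comp (by fun_prop))
  exact this.lintegral_prod_right

lemma act_mono {k : ℝ → X → X → ENNReal} {f g : X → ENNReal} (h : ∀ᵐ z ∂μ, f z ≤ g z) (t : ℝ) (x : X) :
    act μ k f t x ≤ act μ k g t x :=
  lintegral_mono_ae (by filter_upwards [h] with z hz; gcongr)

lemma kstar_eq {q : X → ENNReal} (hq : Measurable q) {f g : ℝ → X → X → ENNReal} (hf : MK f) (hg : MK g)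
    (f0 : ∀ t ≤ 0, ∀ x y, f t x y = 0) (g0 : ∀ t ≤ 0, ∀ x y, g t x y = 0) (t : ℝ) (x y : X) :
    kstar μ q f g t x y = ∫⁻ s in Ioo 0 t, ∫⁻ z, f s x z * q z * g (t - s) z y ∂μ := by
  unfold kstar
  rw [lintegral_prod]
  · rw [← lintegral_indicator measurableSet_Ioo]
    refine lintegral_congr fun s => ?_
    by_cases h : s ∈ Ioo 0 t
    · rw [indicator_of_mem h]
    · rw [indicator_of_notMem h]
      rw [mem_Ioo, not_and_or, not_lt, not_lt] at h
      rcases h with h | h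
      · simp [f0 s h]
      · simp [g0 (t - s) (by linarith)]
  · exact (((hf.comp (by fun_prop) (by fun_prop) (by fun_prop)).mul (hq.comp (by fun_prop))).mul
      (hg.comp (by fun_prop) (by fun_prop) (by fun_prop))).aemeasurable

lemma act_star {q : X → ENNReal} (hq : Measurable q) {f g : ℝ → X → X → ENNReal} (hf : MK f) (hg : MK g)
    (f0 : ∀ t ≤ 0, ∀ x y, f t x y = 0) (g0 : ∀ t ≤ 0, ∀ x y, g t x y = 0) {φ : X → ENNReal} (hφ : Measurable φ)
    (t : ℝ) (x : X) :
    act μ (kstar μ q f g) φ t x = ∫⁻ s in Ioo 0 t, act μ f (fun z => q z * act μ g φ (t - s) z) s x := by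
  unfold act
  simp_rw [kstar_eq μ hq hf hg f0 g0]
  have hm0 : Measurable (fun p : (X × ℝ) × X => f p.1.2 x p.2 * q p.2 * g (t - p.1.2) p.2 p.1.1) :=
    ((hf.comp (by fun_prop) (by fun_prop) (by fun_prop)).mul (hq.comp (by fun_prop))).mul
      (hg.comp (by fun_prop) (by fun_prop) (by fun_prop))
  have hm1 : Measurable (fun p : X × ℝ => ∫⁻ z, f p.2 x z * q z * g (t - p.2) z p.1 ∂μ) :=
    hm0.lintegral_prod_right'
  calc _ = ∫⁻ y, (∫⁻ s in Ioo 0 t, (∫⁻ z, f s x z * q z * g (t - s) z y ∂μ) * φ y) ∂μ := by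
        refine lintegral_congr fun y => ?_
        rw [lintegral_mul_const]
        exact hm1.comp (by fun_prop : Measurable fun s : ℝ => (y, s))
    _ = ∫⁻ s in Ioo 0 t, ∫⁻ y, (∫⁻ z, f s x z * q z * g (t - s) z y ∂μ) * φ y ∂μ := by
        rw [lintegral_lintegral_swap]
        apply Measurable.aemeasurable
        simp only [Function.uncurry_def]
        exact hm1.mul (by fun_prop)
    _ = _ := by
        refine lintegral_congr fun s => ?_
        calc _ = ∫⁻ y, ∫⁻ z, f s x z * q z * g (t - s) z y * φ y ∂μ ∂μ := by
              refine lintegral_congr fun y => ?_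
              rw [lintegral_mul_const]
              exact hm0.comp (by fun_prop : Measurable fun z : X => ((y, s), z))
          _ = ∫⁻ z, ∫⁻ y, f s x z * q z * g (t - s) z y * φ y ∂μ ∂μ := by
              rw [lintegral_lintegral_swap]
              apply Measurable.aemeasurable
              simp only [Function.uncurry_def]
              exact (hm0.comp (by fun_prop : Measurable fun p : X × X => ((p.1, s), p.2))).mul (by fun_prop)
          _ = _ := by
              refine lintegral_congr fun z => ?_
              rw [← mul_assoc, ← lintegral_const_mul]
              · simp_rw [mul_assoc]
              · exact (hg.comp (by fun_prop) (by fun_prop) (by fun_prop)).mul hφ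

variable {k : ℝ → X → X → ENNReal} {q : X → ENNReal}

lemma act_pt (hk : MK k) (hq : Measurable q) {f : X → ENNReal} (hf : Measurable f) (t : ℝ) (x : X) :
    act μ (pt μ k q) f t x = ∑' n, act μ (pn μ k q n) f t x := by
  unfold act pt
  simp_rw [← ENNReal.tsum_mul_right]
  rw [lintegral_tsum]
  intro n
  exact (((pn_meas μ hk hq n).comp (by fun_prop) (by fun_prop) (by fun_prop)).mul hf).aemeasurable

lemma super_sol (hk : MK k) (hq : Measurable q) (h0 : ∀ t ≤ 0, ∀ x y, k t x y = 0) {f : X → ENNReal} (hf : Measurable f)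
    {P : X → Prop} (hP : ∀ᵐ z ∂μ, P z)
    (H : ∀ t, 0 < t → ∀ x, P x → act μ k f t x + ∫⁻ s in Ioo 0 t, act μ k (fun z => q z * f z) s x ≤ f x)
    {t : ℝ} (ht : 0 < t) {x : X} (hx : P x) : act μ (pt μ k q) f t x ≤ f x := by
  rw [act_pt μ hk hq hf, ENNReal.tsum_eq_iSup_nat]
  refine iSup_le fun n => ?_
  induction n generalizing t x with
  | zero => simp
  | succ n ih =>
    rw [Finset.sum_range_succ']
    refine le_trans ?_ (H t ht x hx)
    rw [add_comm]
    refine add_le_add le_rfl ?_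
    have e : ∀ i, pn μ k q (i + 1) = kstar μ q k (pn μ k q i) := by
      intro i; funext t x y; exact pn_succ' μ hk hq i t x y
    simp_rw [e]
    simp_rw [act_star μ hq hk (pn_meas μ hk hq _) h0 (pn_nonpos μ h0 _) hf]
    have hmm : ∀ i, Measurable fun p : ℝ × X => k p.1 x p.2 * (q p.2 * act μ (pn μ k q i) f (t - p.1) p.2) := fun i =>
      (hk.comp (by fun_prop) (by fun_prop) (by fun_prop)).mul ((hq.comp (by fun_prop)).mul
        ((act_meas μ (pn_meas μ hk hq i) hf).comp (by fun_prop : Measurable fun p : ℝ × X => (t - p.1, p.2))))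
    rw [← lintegral_finsetSum]
    · refine setLIntegral_mono' measurableSet_Ioo fun s hs => ?_
      unfold act
      rw [← lintegral_finsetSum]
      · refine lintegral_mono_ae ?_
        filter_upwards [hP] with z hz
        rw [← Finset.mul_sum, ← Finset.mul_sum]
        gcongr
        exact ih (t := t - s) (by linarith [hs.2]) hz
      · intro i _
        exact (hmm i).comp (by fun_prop : Measurable fun z : X => (s, z))
    · intro i _
      exact (hmm i).lintegral_prod_right'

lemma sub_sol_step (hk : MK k) (hq : Measurable q) (h0 : ∀ t ≤ 0, ∀ x y, k t x y = 0) {f : X → ENNReal} (hf : Measurable f)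
    {P : X → Prop} (hP : ∀ᵐ z ∂μ, P z)
    (H : ∀ t, 0 < t → ∀ x, P x → f x ≤ act μ k f t x + ∫⁻ s in Ioo 0 t, act μ k (fun z => q z * f z) s x)
    {t : ℝ} {x : X} (n : ℕ) :
    ∫⁻ s in Ioo 0 t, act μ (pn μ k q n) (fun z => q z * f z) s x ≤ act μ (pn μ k q (n + 1)) f t x +
      ∫⁻ s in Ioo 0 t, act μ (pn μ k q (n + 1)) (fun z => q z * f z) s x := by
  have hpn := pn_meas μ hk hq n
  have hqf : Measurable (fun z => q z * f z) := hq.mul hf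
  have hA : Measurable (fun p : ℝ × X => act μ k (fun z => q z * f z) p.1 p.2) := act_meas μ hk hqf
  have hAf : Measurable (fun p : ℝ × X => act μ k f p.1 p.2) := act_meas μ hk hf
  change _ ≤ act μ (kstar μ q (pn μ k q n) k) f t x + ∫⁻ s in Ioo 0 t, act μ (kstar μ q (pn μ k q n) k) (fun z => q z * f z) s x
  simp_rw [act_star μ hq hpn hk (pn_nonpos μ h0 _) h0 hf, act_star μ hq hpn hk (pn_nonpos μ h0 _) h0 hqf]
  set G : ℝ → ℝ → ENNReal := fun s u => act μ (pn μ k q n) (fun z => q z * act μ k (fun z => q z * f z) u z) s x with hG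
  have hGm0 : Measurable (fun p : (ℝ × ℝ) × X => pn μ k q n p.1.1 x p.2 * (q p.2 * act μ k (fun z => q z * f z) p.1.2 p.2)) :=
    (hpn.comp (by fun_prop) (by fun_prop) (by fun_prop)).mul ((hq.comp (by fun_prop)).mul
      (hA.comp (by fun_prop : Measurable fun p : (ℝ × ℝ) × X => (p.1.2, p.2))))
  have hGm : Measurable (fun p : ℝ × ℝ => G p.1 p.2) := hGm0.lintegral_prod_right'
  have hG0 : ∀ s u, u ≤ 0 → G s u = 0 := by
    intro s u hu
    simp [hG, act, h0 u hu]
  -- change of variables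
  have e1 : ∫⁻ r in Ioo 0 t, ∫⁻ s in Ioo 0 r, G s (r - s) = ∫⁻ s in Ioo 0 t, ∫⁻ u in Ioo 0 (t - s), G s u := by
    have a1 : ∀ r, ∫⁻ s in Ioo 0 r, G s (r - s) = ∫⁻ s, (Ioi (0:ℝ)).indicator (fun s => G s (r - s)) s := by
      intro r
      rw [← lintegral_indicator measurableSet_Ioo]
      refine lintegral_congr fun s => ?_
      by_cases hs : 0 < s
      · by_cases hr : s < r
        · rw [indicator_of_mem (show s ∈ Ioo 0 r from ⟨hs, hr⟩), indicator_of_mem (show s ∈ Ioi (0:ℝ) from hs)]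
        · rw [indicator_of_notMem (fun h => hr h.2), indicator_of_mem (show s ∈ Ioi (0:ℝ) from hs), hG0 _ _ (by linarith)]
      · rw [indicator_of_notMem (fun h => hs h.1), indicator_of_notMem (show s ∉ Ioi (0:ℝ) from hs)]
    have hGm2 : Measurable (fun p : ℝ × ℝ => (Ioi (0:ℝ)).indicator (fun s => G s (p.1 - s)) p.2) := by
      have : (fun p : ℝ × ℝ => (Ioi (0:ℝ)).indicator (fun s => G s (p.1 - s)) p.2) =
        (Prod.snd ⁻¹' (Ioi (0:ℝ))).indicator (fun p : ℝ × ℝ => G p.2 (p.1 - p.2)) := by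
        funext p; simp [indicator]
      rw [this]
      refine Measurable.indicator (hGm.comp (by fun_prop : Measurable fun p : ℝ × ℝ => (p.2, p.1 - p.2))) (measurable_snd measurableSet_Ioi)
    simp_rw [a1]
    rw [lintegral_lintegral_swap hGm2.aemeasurable]
    have a2 : ∀ s, ∫⁻ r in Ioo 0 t, (Ioi (0:ℝ)).indicator (fun s => G s (r - s)) s =
        (Ioo 0 t).indicator (fun s => ∫⁻ u in Ioo 0 (t - s), G s u) s := by
      intro s
      by_cases hs : 0 < s
      · have : ∀ r, (Ioi (0:ℝ)).indicator (fun s => G s (r - s)) s = G s (r - s) := fun r =>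
          indicator_of_mem (show s ∈ Ioi (0:ℝ) from hs) _
        simp_rw [this]
        by_cases hst : s < t
        · rw [indicator_of_mem (show s ∈ Ioo 0 t from ⟨hs, hst⟩)]
          rw [← lintegral_indicator measurableSet_Ioo, ← lintegral_indicator measurableSet_Ioo]
          rw [← lintegral_sub_right_eq_self ((Ioo 0 (t - s)).indicator fun u => G s u) s]
          refine lintegral_congr fun r => ?_
          simp only [indicator, mem_Ioo]
          by_cases h1 : 0 < r - s
          · by_cases h2 : r < t
            · rw [if_pos ⟨by linarith, h2⟩, if_pos ⟨h1, by linarith⟩]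
            · rw [if_neg (fun h => h2 h.2), if_neg (fun h => h2 (by linarith [h.2]))]
          · rw [hG0 _ _ (not_lt.1 h1)]; simp
        · rw [indicator_of_notMem (fun h => hst h.2)]
          rw [← nonpos_iff_eq_zero]
          calc _ ≤ ∫⁻ r in Ioo 0 t, 0 := setLIntegral_mono' measurableSet_Ioo fun r hr => by
                rw [hG0 _ _ (by linarith [hr.2])]
            _ = 0 := by simp
      · have : ∀ r, (Ioi (0:ℝ)).indicator (fun s => G s (r - s)) s = 0 := fun r => indicator_of_notMem (show s ∉ Ioi (0:ℝ) from hs) _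
        simp_rw [this]
        rw [indicator_of_notMem (fun h => hs h.1)]; simp
    simp_rw [a2]
    rw [lintegral_indicator measurableSet_Ioo]
  change _ ≤ _ + ∫⁻ r in Ioo 0 t, ∫⁻ s in Ioo 0 r, G s (r - s)
  rw [e1, ← lintegral_add_left]
  · refine setLIntegral_mono' measurableSet_Ioo fun s hs => ?_
    have e2 : ∫⁻ u in Ioo 0 (t - s), G s u = act μ (pn μ k q n) (fun z => q z * ∫⁻ u in Ioo 0 (t - s), act μ k (fun z => q z * f z) u z) s x := by
      simp only [hG]
      unfold act
      rw [lintegral_lintegral_swap]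
      · refine lintegral_congr fun z => ?_
        rw [lintegral_const_mul, lintegral_const_mul]
        · exact hA.comp (by fun_prop : Measurable fun u : ℝ => (u, z))
        · exact Measurable.const_mul (hA.comp (by fun_prop : Measurable fun u : ℝ => (u, z))) _
      · apply Measurable.aemeasurable
        exact hGm0.comp (by fun_prop : Measurable fun p : ℝ × X => ((s, p.1), p.2))
    rw [e2]
    have e3 : ∀ g h : X → ENNReal, Measurable g → act μ (pn μ k q n) g s x + act μ (pn μ k q n) h s x = act μ (pn μ k q n) (fun z => g z + h z) s x := by
      intro g h hg
      unfold act
      rw [← lintegral_add_left]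
      · simp_rw [mul_add]
      · exact (hpn.comp (by fun_prop) (by fun_prop) (by fun_prop)).mul hg
    rw [e3]
    · refine act_mono μ ?_ s x
      filter_upwards [hP] with z hz
      rw [← mul_add]
      gcongr
      exact H (t - s) (by linarith [hs.2]) z hz
    · exact hq.mul (hAf.comp (by fun_prop : Measurable fun z : X => (t - s, z)))
  · have : Measurable (fun p : ℝ × X => pn μ k q n p.1 x p.2 * (q p.2 * act μ k f (t - p.1) p.2)) :=
      (hpn.comp (by fun_prop) (by fun_prop) (by fun_prop)).mul ((hq.comp (by fun_prop)).mul
      (hAf.comp (by fun_prop : Measurable fun p : ℝ × X => (t - p.1, p.2))))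
    exact this.lintegral_prod_right'

lemma sub_sol (hk : MK k) (hq : Measurable q) (h0 : ∀ t ≤ 0, ∀ x y, k t x y = 0) {f : X → ENNReal} (hf : Measurable f)
    {P : X → Prop} (hP : ∀ᵐ z ∂μ, P z)
    (H : ∀ t, 0 < t → ∀ x, P x → f x ≤ act μ k f t x + ∫⁻ s in Ioo 0 t, act μ k (fun z => q z * f z) s x)
    {t : ℝ} (ht : 0 < t) {x : X} (hx : P x)
    (hfin : ∫⁻ s in Ioo 0 t, act μ (pt μ k q) (fun z => q z * f z) s x ≠ ⊤) : f x ≤ act μ (pt μ k q) f t x := by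
  have hqf : Measurable (fun z => q z * f z) := hq.mul hf
  have hR : ∑' n, ∫⁻ s in Ioo 0 t, act μ (pn μ k q n) (fun z => q z * f z) s x ≠ ⊤ := by
    rw [← lintegral_tsum]
    · simp_rw [act_pt μ hk hq hqf] at hfin; exact hfin
    · intro n
      exact ((act_meas μ (pn_meas μ hk hq n) hqf).comp (by fun_prop : Measurable fun s : ℝ => (s, x))).aemeasurable
  have hlim := ENNReal.tendsto_atTop_zero_of_tsum_ne_top hR
  have hn : ∀ n, f x ≤ act μ (pt μ k q) f t x + ∫⁻ s in Ioo 0 t, act μ (pn μ k q n) (fun z => q z * f z) s x := by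
    have : ∀ n, f x ≤ ∑ i ∈ Finset.range (n + 1), act μ (pn μ k q i) f t x + ∫⁻ s in Ioo 0 t, act μ (pn μ k q n) (fun z => q z * f z) s x := by
      intro n
      induction n with
      | zero => simpa [pn] using H t ht x hx
      | succ n ih =>
        rw [Finset.sum_range_succ, add_assoc]
        exact ih.trans (by gcongr; exact sub_sol_step μ hk hq h0 hf hP H n)
    intro n
    refine (this n).trans ?_
    gcongr
    rw [act_pt μ hk hq hf]
    exact ENNReal.sum_le_tsum _
  have := ge_of_tendsto' (hlim.const_add (act μ (pt μ k q) f t x)) hn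
  simpa using this
end Abstract2

section Abstract3
variable {X : Type*} [MeasurableSpace X] (μ : Measure X) [SFinite μ]
variable {k : ℝ → X → X → ENNReal} {q : X → ENNReal}

lemma pn_mono {q₁ q₂ : X → ENNReal} (h : ∀ z, q₁ z ≤ q₂ z) (n : ℕ) (t : ℝ) (x y : X) :
    pn μ k q₁ n t x y ≤ pn μ k q₂ n t x y := by
  induction n generalizing t x y with
  | zero => exact le_rfl
  | succ n ih => exact lintegral_mono fun p => by dsimp only; gcongr; exacts [ih _ _ _, h _]

lemma pt_mono {q₁ q₂ : X → ENNReal} (h : ∀ z, q₁ z ≤ q₂ z) (t : ℝ) (x y : X) :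
    pt μ k q₁ t x y ≤ pt μ k q₂ t x y := ENNReal.tsum_le_tsum fun n => pn_mono μ h n t x y

lemma ennreal_iSup_mul_iSup {f g : ℕ → ENNReal} (hf : Monotone f) (hg : Monotone g) :
    (⨆ i, f i) * (⨆ i, g i) = ⨆ i, f i * g i := by
  apply le_antisymm
  · rw [ENNReal.iSup_mul]
    refine iSup_le fun i => ?_
    rw [ENNReal.mul_iSup]
    exact iSup_le fun j => (mul_le_mul' (hf (le_max_left i j)) (hg (le_max_right i j))).trans (le_iSup (fun i => f i * g i) (max i j))
  · exact iSup_le fun i => mul_le_mul' (le_iSup f i) (le_iSup g i)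

lemma pn_iSup (hk : MK k) {qs : ℕ → X → ENNReal} (hqs : ∀ K, Measurable (qs K)) (hm : Monotone qs)
    (hq : ∀ z, q z = ⨆ K, qs K z) (n : ℕ) (t : ℝ) (x y : X) :
    pn μ k q n t x y = ⨆ K, pn μ k (qs K) n t x y := by
  induction n generalizing t x y with
  | zero => simp [pn]
  | succ n ih =>
    change kstar μ q (pn μ k q n) k t x y = ⨆ K, kstar μ (qs K) (pn μ k (qs K) n) k t x y
    unfold kstar
    rw [← lintegral_iSup]
    · refine lintegral_congr fun p => ?_
      rw [ih, hq, ennreal_iSup_mul_iSup, ENNReal.iSup_mul]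
      · exact fun i j hij => pn_mono μ (fun z => hm hij z) _ _ _ _
      · exact fun i j hij => hm hij _
    · intro K
      exact (((pn_meas μ hk (hqs K) n).comp (by fun_prop) (by fun_prop) (by fun_prop)).mul ((hqs K).comp (by fun_prop))).mul
        (hk.comp (by fun_prop) (by fun_prop) (by fun_prop))
    · intro i j hij p
      dsimp only
      gcongr
      · exact pn_mono μ (fun z => hm hij z) _ _ _ _
      · exact hm hij _

lemma pt_le_of_iSup (hk : MK k) {qs : ℕ → X → ENNReal} (hqs : ∀ K, Measurable (qs K)) (hm : Monotone qs)
    (hq : ∀ z, q z = ⨆ K, qs K z) {t : ℝ} {x y : X} {B : ENNReal} (hB : ∀ K, pt μ k (qs K) t x y ≤ B) :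
    pt μ k q t x y ≤ B := by
  unfold pt
  rw [ENNReal.tsum_eq_iSup_nat]
  refine iSup_le fun n => ?_
  simp_rw [pn_iSup μ hk hqs hm hq]
  rw [ENNReal.finsetSum_iSup_of_monotone]
  · refine iSup_le fun K => (ENNReal.sum_le_tsum _).trans (hB K)
  · intro i a b hab
    exact pn_mono μ (fun z => hm hab z) _ _ _ _

lemma pn_bdd (hk : MK k) (hq : Measurable q) (h0 : ∀ t ≤ 0, ∀ x y, k t x y = 0) (hck : CK μ k) {K : ℝ} (hK : 0 ≤ K)
    (hqK : ∀ z, q z ≤ ENNReal.ofReal K) (n : ℕ) {t : ℝ} (ht : 0 < t) (x y : X) :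
    pn μ k q n t x y ≤ ENNReal.ofReal ((K * t) ^ n / n.factorial) * k t x y := by
  induction n generalizing t x y with
  | zero => simp [pn]
  | succ n ih =>
    change kstar μ q (pn μ k q n) k t x y ≤ _
    rw [kstar_eq μ hq (pn_meas μ hk hq n) hk (pn_nonpos μ h0 n) h0]
    calc _ ≤ ∫⁻ s in Ioo 0 t, ENNReal.ofReal ((K * s) ^ n / n.factorial * K) * k t x y := by
          refine setLIntegral_mono' measurableSet_Ioo fun s hs => ?_
          calc _ ≤ ∫⁻ z, ENNReal.ofReal ((K * s) ^ n / n.factorial * K) * (k s x z * k (t - s) z y) ∂μ := by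
                refine lintegral_mono fun z => ?_
                dsimp only
                rw [ENNReal.ofReal_mul (by have := hs.1; positivity)]
                calc _ ≤ ENNReal.ofReal ((K * s) ^ n / n.factorial) * k s x z * ENNReal.ofReal K * k (t - s) z y := by
                      gcongr
                      · exact ih hs.1 x z
                      · exact hqK z
                  _ = _ := by ring
            _ = _ := by
                rw [lintegral_const_mul]
                · rw [hck s (t - s) hs.1 (by linarith [hs.2])]; simp
                · exact (hk.comp (by fun_prop) (by fun_prop) (by fun_prop)).mul (hk.comp (by fun_prop) (by fun_prop) (by fun_prop))
      _ = _ := by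
          rw [lintegral_mul_const _ (by fun_prop)]
          congr 1
          rw [← ofReal_integral_eq_lintegral_ofReal]
          · congr 1
            rw [← integral_Ioc_eq_integral_Ioo, ← intervalIntegral.integral_of_le ht.le]
            simp only [mul_pow, mul_div_assoc, mul_assoc]
            rw [intervalIntegral.integral_const_mul, intervalIntegral.integral_mul_const, intervalIntegral.integral_div, integral_pow]
            have : (n.factorial : ℝ) ≠ 0 := by positivity
            rw [Nat.factorial_succ]; push_cast
            field_simp
            simp
            ring
          · exact (Continuous.integrableOn_Icc (by fun_prop)).mono_set Ioo_subset_Icc_self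
          · refine (ae_restrict_iff' measurableSet_Ioo).2 (ae_of_all _ fun s hs => ?_)
            have := hs.1
            show 0 ≤ (K * s) ^ n / n.factorial * K
            positivity

lemma pt_bdd (hk : MK k) (hq : Measurable q) (h0 : ∀ t ≤ 0, ∀ x y, k t x y = 0) (hck : CK μ k) {K : ℝ} (hK : 0 ≤ K)
    (hqK : ∀ z, q z ≤ ENNReal.ofReal K) {t : ℝ} (ht : 0 < t) (x y : X) :
    pt μ k q t x y ≤ ENNReal.ofReal (Real.exp (K * t)) * k t x y := by
  unfold pt
  refine (ENNReal.tsum_le_tsum fun n => pn_bdd μ hk hq h0 hck hK hqK n ht x y).trans ?_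
  rw [ENNReal.tsum_mul_right]
  gcongr
  rw [← ENNReal.ofReal_tsum_of_nonneg]
  · rw [Real.exp_eq_exp_ℝ, NormedSpace.exp_eq_tsum_div]
  · intro n; positivity
  · exact Real.summable_pow_div_factorial _

lemma pt_mass (hk : MK k) (hq : Measurable q) (h0 : ∀ t ≤ 0, ∀ x y, k t x y = 0)
    (hmass : ∀ t, 0 < t → ∀ x, ∫⁻ y, k t x y ∂μ = 1) {t : ℝ} (ht : 0 < t) (x : X) :
    ∫⁻ y, pt μ k q t x y ∂μ = 1 + ∫⁻ s in Ioo 0 t, ∫⁻ z, pt μ k q s x z * q z ∂μ := by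
  simp_rw [duhamel_l μ hk hq t x]
  rw [lintegral_add_left (hk.comp (by fun_prop) (by fun_prop) (by fun_prop)), hmass t ht]
  congr 1
  have := act_star μ hq (pt_meas μ hk hq) hk (pt_nonpos μ h0) h0 (φ := fun _ => 1) measurable_const t x
  unfold act at this
  simp only [mul_one] at this
  rw [this]
  refine setLIntegral_congr_fun measurableSet_Ioo fun s hs => ?_
  refine lintegral_congr fun z => ?_
  rw [hmass (t - s) (by linarith [hs.2])]; simp

/-- damped kernel -/
def damp (lam : ℝ) (k : ℝ → X → X → ENNReal) (t : ℝ) (x y : X) : ENNReal := ENNReal.ofReal (Real.exp (-lam * t)) * k t x y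

lemma damp_meas (lam : ℝ) (hk : MK k) : MK (damp lam k) := by
  unfold MK damp
  exact (by fun_prop : Measurable fun p : ℝ × X × X => ENNReal.ofReal (Real.exp (-lam * p.1))).mul hk

lemma pn_damp (lam : ℝ) (hk : MK k) (hq : Measurable q) (n : ℕ) (t : ℝ) (x y : X) :
    pn μ (damp lam k) q n t x y = ENNReal.ofReal (Real.exp (-lam * t)) * pn μ k q n t x y := by
  induction n generalizing t x y with
  | zero => rfl
  | succ n ih =>
    change kstar μ q (pn μ (damp lam k) q n) (damp lam k) t x y = _ * kstar μ q (pn μ k q n) k t x y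
    unfold kstar
    rw [← lintegral_const_mul]
    · refine lintegral_congr fun p => ?_
      rw [ih]; unfold damp
      have : Real.exp (-lam * t) = Real.exp (-lam * p.1) * Real.exp (-lam * (t - p.1)) := by
        rw [← Real.exp_add]; congr 1; ring
      rw [this, ENNReal.ofReal_mul (by positivity)]
      ring
    · exact (((pn_meas μ hk hq n).comp (by fun_prop) (by fun_prop) (by fun_prop)).mul (hq.comp (by fun_prop))).mul
        (hk.comp (by fun_prop) (by fun_prop) (by fun_prop))

lemma pt_damp (lam : ℝ) (hk : MK k) (hq : Measurable q) (t : ℝ) (x y : X) :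
    pt μ (damp lam k) q t x y = ENNReal.ofReal (Real.exp (-lam * t)) * pt μ k q t x y := by
  unfold pt
  simp_rw [pn_damp μ lam hk hq, ENNReal.tsum_mul_left]

end Abstract3

section Conc
variable (d : ℕ) [NeZero d] {α : ℝ}

lemma kE_MK (d : ℕ) (α : ℝ) : MK (kE d α) := kE_meas d α

lemma kE_zero (d : ℕ) (α : ℝ) : ∀ t ≤ 0, ∀ x y, kE d α t x y = 0 := fun _ ht x y => kE_nonpos ht x y

lemma kE_CK (hα : 0 < α) (hα2 : α < 2) : CK volume (kE d α) := fun _ _ hs ht x y => kE_ck d hα hα2 hs ht x y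

lemma sk_scale' (d : ℕ) {α t r : ℝ} (hα : 0 < α) (ht : 0 < t) (hr : 0 < r) (x : Ed d) :
    sk d α (r ^ α * t) (r • x) = r ^ (-(d : ℝ)) * sk d α t x := by
  have h1 : 0 < r ^ α := rpow_pos_of_pos hr _
  rw [sk_scale d hα (by positivity : 0 < r ^ α * t), sk_scale d hα ht x, mul_rpow h1.le ht.le, mul_rpow h1.le ht.le,
    ← rpow_mul hr.le, ← rpow_mul hr.le, smul_smul]
  have e1 : α * (-(d : ℝ) / α) = -(d : ℝ) := by field_simp
  have e2 : α * (-1 / α) = -1 := by field_simp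
  rw [e1, e2, rpow_neg_one]
  have e3 : r⁻¹ * t ^ (-1 / α) * r = t ^ (-1 / α) := by field_simp
  rw [e3]; ring

lemma kE_scale (d : ℕ) {α r : ℝ} (hα : 0 < α) (hr : 0 < r) (t : ℝ) (x y : Ed d) :
    kE d α (r ^ α * t) (r • x) (r • y) = ENNReal.ofReal (r ^ (-(d : ℝ))) * kE d α t x y := by
  have h1 : 0 < r ^ α := rpow_pos_of_pos hr _
  rcases le_or_gt t 0 with ht | ht
  · rw [kE_nonpos ht, kE_nonpos (mul_nonpos_of_nonneg_of_nonpos h1.le ht)]; simp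
  · rw [kE_pos ht, kE_pos (by positivity), ← smul_sub, sk_scale' d hα ht hr, ENNReal.ofReal_mul (by positivity)]

lemma lint_mul (r : ℝ) (hr : 0 < r) (f : ℝ → ENNReal) : ∫⁻ s, f s = ENNReal.ofReal r * ∫⁻ s, f (r * s) := by
  have e : MeasurableEmbedding (fun s : ℝ => r * s) := (Homeomorph.mulLeft₀ r hr.ne').measurableEmbedding
  have := e.lintegral_map (μ := volume) f
  rw [Real.map_volume_mul_left hr.ne', lintegral_smul_measure] at this
  rw [← this, smul_eq_mul, ← mul_assoc, ← ENNReal.ofReal_mul hr.le, abs_of_pos (by positivity), mul_inv_cancel₀ hr.ne']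
  simp

lemma lint_scale2 (d : ℕ) {a r : ℝ} (ha : 0 < a) (hr : 0 < r) {F : ℝ × Ed d → ENNReal} (hF : Measurable F) :
    ∫⁻ p, F p ∂((volume : Measure ℝ).prod volume) =
    ENNReal.ofReal a * ENNReal.ofReal (r ^ (d : ℝ)) * ∫⁻ p : ℝ × Ed d, F (a * p.1, r • p.2) ∂((volume : Measure ℝ).prod volume) := by
  rw [lintegral_prod _ hF.aemeasurable, lintegral_prod (fun p : ℝ × Ed d => F (a * p.1, r • p.2)) (hF.comp (by fun_prop : Measurable fun p : ℝ × Ed d => (a * p.1, r • p.2))).aemeasurable, lint_mul a ha, mul_assoc]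
  congr 1
  rw [← lintegral_const_mul']
  · refine lintegral_congr fun s => ?_
    rw [lint_smul d hr (fun z => F (a * s, z)), ← mul_assoc, ← ENNReal.ofReal_mul (by positivity), ← rpow_add hr]
    simp
  · simp

lemma pn_scale (d : ℕ) {α r : ℝ} (hα : 0 < α) (hr : 0 < r) {q : Ed d → ENNReal} (hq : Measurable q) (n : ℕ) (t : ℝ) (x y : Ed d) :
    pn volume (kE d α) q n (r ^ α * t) (r • x) (r • y) =
      ENNReal.ofReal (r ^ (-(d : ℝ))) * pn volume (kE d α) (fun z => ENNReal.ofReal (r ^ α) * q (r • z)) n t x y := by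
  induction n generalizing t x y with
  | zero => exact kE_scale d hα hr t x y
  | succ n ih =>
    have hq' : Measurable (fun z : Ed d => ENNReal.ofReal (r ^ α) * q (r • z)) := (hq.comp (by fun_prop)).const_mul _
    have h1 : 0 < r ^ α := rpow_pos_of_pos hr _
    change kstar _ _ _ _ _ _ _ = _ * kstar _ _ _ _ _ _ _
    unfold kstar
    rw [lint_scale2 d h1 hr, ← lintegral_const_mul, ← lintegral_const_mul]
    · refine lintegral_congr fun p => ?_
      dsimp only
      rw [ih, ← mul_sub, kE_scale d hα hr]
      have e : ENNReal.ofReal (r ^ (d : ℝ)) * ENNReal.ofReal (r ^ (-(d : ℝ))) = 1 := by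
        rw [← ENNReal.ofReal_mul (by positivity), ← rpow_add hr]; simp
      calc _ = (ENNReal.ofReal (r ^ (d : ℝ)) * ENNReal.ofReal (r ^ (-(d : ℝ)))) * (ENNReal.ofReal (r ^ (-(d : ℝ))) * (pn volume (kE d α) (fun z => ENNReal.ofReal (r ^ α) * q (r • z)) n p.1 x p.2 * (ENNReal.ofReal (r ^ α) * q (r • p.2)) * kE d α (t - p.1) p.2 y)) := by ring
        _ = _ := by rw [e, one_mul]
    · exact (((pn_meas volume (kE_MK d α) hq' n).comp (by fun_prop) (by fun_prop) (by fun_prop)).mul (hq'.comp (by fun_prop))).mul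
        ((kE_MK d α).comp (by fun_prop) (by fun_prop) (by fun_prop))
    · exact (((pn_meas volume (kE_MK d α) hq n).comp (by fun_prop) (by fun_prop) (by fun_prop)).mul (hq.comp (by fun_prop))).mul
        ((kE_MK d α).comp (by fun_prop) (by fun_prop) (by fun_prop))
    · exact (((pn_meas volume (kE_MK d α) hq n).comp (by fun_prop) (by fun_prop) (by fun_prop)).mul (hq.comp (by fun_prop))).mul
        ((kE_MK d α).comp (by fun_prop) (by fun_prop) (by fun_prop))

lemma pt_scale (d : ℕ) {α r : ℝ} (hα : 0 < α) (hr : 0 < r) {q : Ed d → ENNReal} (hq : Measurable q) (t : ℝ) (x y : Ed d) :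
    pt volume (kE d α) q (r ^ α * t) (r • x) (r • y) =
      ENNReal.ofReal (r ^ (-(d : ℝ))) * pt volume (kE d α) (fun z => ENNReal.ofReal (r ^ α) * q (r • z)) t x y := by
  unfold pt
  simp_rw [pn_scale d hα hr hq, ENNReal.tsum_mul_left]

end Conc

section Pot
variable (d : ℕ) [NeZero d] {α : ℝ}

/-- time-power potential of the stable kernel -/
def kp (d : ℕ) (α a t : ℝ) (x : Ed d) : ENNReal :=
  ∫⁻ v in Ioi t, ENNReal.ofReal ((v - t) ^ a) * kE d α v 0 x

lemma kE_meas1 (d : ℕ) (α : ℝ) (x y : Ed d) : Measurable (fun v => kE d α v x y) :=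
  (kE_MK d α).comp measurable_id measurable_const measurable_const

lemma kE_meas2 (d : ℕ) (α : ℝ) (y : Ed d) : Measurable (fun p : ℝ × Ed d => kE d α p.1 y p.2) :=
  (kE_MK d α).comp measurable_fst measurable_const measurable_snd

lemma kE_meas3 (d : ℕ) (α s : ℝ) (y : Ed d) : Measurable (fun z => kE d α s y z) :=
  (kE_MK d α).comp measurable_const measurable_const measurable_id

lemma kp_meas (d : ℕ) (α a t : ℝ) : Measurable (kp d α a t) := by
  have : Measurable (fun p : Ed d × ℝ => ENNReal.ofReal ((p.2 - t) ^ a) * kE d α p.2 0 p.1) := by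
    have h1 : Measurable (fun p : Ed d × ℝ => ENNReal.ofReal ((p.2 - t) ^ a)) := by fun_prop
    exact h1.mul ((kE_meas2 d α 0).comp measurable_swap)
  exact this.lintegral_prod_right'

lemma kp_act (hα : 0 < α) (hα2 : α < 2) (a : ℝ) {s : ℝ} (hs : 0 < s) (x : Ed d) :
    act volume (kE d α) (kp d α a 0) s x = kp d α a s x := by
  unfold act kp
  have hm : Measurable (fun p : Ed d × ℝ => kE d α s x p.1 * (ENNReal.ofReal ((p.2 - 0) ^ a) * kE d α p.2 0 p.1)) := by
    have h1 : Measurable (fun p : Ed d × ℝ => ENNReal.ofReal ((p.2 - 0) ^ a)) := by fun_prop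
    exact ((kE_meas3 d α s x).comp measurable_fst).mul (h1.mul ((kE_meas2 d α 0).comp measurable_swap))
  calc _ = ∫⁻ z, ∫⁻ v in Ioi 0, kE d α s x z * (ENNReal.ofReal ((v - 0) ^ a) * kE d α v 0 z) := by
        refine lintegral_congr fun z => ?_
        rw [lintegral_const_mul]
        have h1 : Measurable (fun v : ℝ => ENNReal.ofReal ((v - 0) ^ a)) := by fun_prop
        exact h1.mul (kE_meas1 d α 0 z)
    _ = ∫⁻ v in Ioi 0, ∫⁻ z, kE d α s x z * (ENNReal.ofReal ((v - 0) ^ a) * kE d α v 0 z) :=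
        lintegral_lintegral_swap hm.aemeasurable
    _ = ∫⁻ v in Ioi 0, ENNReal.ofReal ((v - 0) ^ a) * kE d α (s + v) 0 x := by
        refine setLIntegral_congr_fun measurableSet_Ioi fun v hv => ?_
        rw [kE_symm 0 x, ← kE_ck d hα hα2 hs hv x 0, ← lintegral_const_mul]
        · refine lintegral_congr fun z => ?_
          rw [kE_symm 0 z]; ring
        · exact (kE_meas3 d α s x).mul ((kE_MK d α).comp measurable_const measurable_id measurable_const)
    _ = _ := by
        rw [← lintegral_indicator measurableSet_Ioi, ← lintegral_indicator measurableSet_Ioi,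
          ← lintegral_sub_right_eq_self ((Ioi (0:ℝ)).indicator fun v => ENNReal.ofReal ((v - 0) ^ a) * kE d α (s + v) 0 x) s]
        refine lintegral_congr fun v => ?_
        simp only [indicator, mem_Ioi, sub_pos, sub_zero]
        split_ifs <;> simp

lemma lint_pow {a : ℝ} (ha : 0 < a) {t v : ℝ} (hv : t < v) :
    ∫⁻ s in Ioo t v, ENNReal.ofReal (a * (v - s) ^ (a - 1)) = ENNReal.ofReal ((v - t) ^ a) := by
  have hI : IntervalIntegrable (fun s => (v - s) ^ (a - 1)) volume t v := by
    have := (intervalIntegral.intervalIntegrable_rpow' (a := 0) (b := v - t) (r := a - 1) (by linarith)).comp_sub_left v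
    simpa using this.symm
  rw [← ofReal_integral_eq_lintegral_ofReal]
  · congr 1
    rw [← integral_Ioc_eq_integral_Ioo, ← intervalIntegral.integral_of_le hv.le, intervalIntegral.integral_const_mul,
      intervalIntegral.integral_comp_sub_left (fun u => u ^ (a - 1)) v, integral_rpow (Or.inl (by linarith))]
    simp only [sub_self, sub_add_cancel]
    rw [zero_rpow ha.ne']
    field_simp; ring
  · exact ((intervalIntegrable_iff_integrableOn_Ioo_of_le hv.le).1 hI).const_mul a
  · refine (ae_restrict_iff' measurableSet_Ioo).2 (ae_of_all _ fun s hs => ?_)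
    have : 0 < v - s := by linarith [hs.2]
    show 0 ≤ a * (v - s) ^ (a - 1)
    positivity

lemma kp_int (hα : 0 < α) (hα2 : α < 2) {a : ℝ} (ha : 0 < a) {t : ℝ} (ht : 0 ≤ t) (x : Ed d) :
    ∫⁻ s in Ioi t, act volume (kE d α) (fun z => ENNReal.ofReal a * kp d α (a - 1) 0 z) s x = kp d α a t x := by
  have e1 : ∀ s ∈ Ioi t, act volume (kE d α) (fun z => ENNReal.ofReal a * kp d α (a - 1) 0 z) s x =
      ∫⁻ v, (Ioi s).indicator (fun v => ENNReal.ofReal (a * (v - s) ^ (a - 1)) * kE d α v 0 x) v := by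
    intro s hs
    have hs0 : 0 < s := lt_of_le_of_lt ht hs
    calc _ = ENNReal.ofReal a * act volume (kE d α) (kp d α (a-1) 0) s x := by
          unfold act
          rw [← lintegral_const_mul]
          · refine lintegral_congr fun z => by ring
          · exact (kE_meas3 d α s x).mul (kp_meas d α _ _)
      _ = _ := by
          rw [kp_act d hα hα2 (a-1) hs0, kp, ← lintegral_const_mul, lintegral_indicator measurableSet_Ioi]
          · refine lintegral_congr fun v => ?_
            rw [ENNReal.ofReal_mul ha.le, mul_assoc]
          · have h1 : Measurable (fun v : ℝ => ENNReal.ofReal ((v - s) ^ (a - 1))) := by fun_prop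
            exact h1.mul (kE_meas1 d α 0 x)
  rw [setLIntegral_congr_fun measurableSet_Ioi e1, lintegral_lintegral_swap]
  · unfold kp
    rw [← lintegral_indicator measurableSet_Ioi]
    refine lintegral_congr fun v => ?_
    by_cases hv : t < v
    · rw [indicator_of_mem (show v ∈ Ioi t from hv), ← lint_pow ha hv, ← lintegral_mul_const _ (by fun_prop),
        ← lintegral_indicator measurableSet_Ioi, ← lintegral_indicator measurableSet_Ioo]
      refine lintegral_congr fun s => ?_
      simp only [indicator, mem_Ioi, mem_Ioo]
      by_cases h1 : t < s <;> by_cases h2 : s < v <;> simp [h1, h2]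
    · rw [indicator_of_notMem (show v ∉ Ioi t from hv), ← nonpos_iff_eq_zero]
      calc _ ≤ ∫⁻ s in Ioi t, 0 := setLIntegral_mono' measurableSet_Ioi fun s hs => by
            rw [indicator_of_notMem]
            simp only [mem_Ioi, not_lt] at *
            linarith
        _ = 0 := by simp
  · apply Measurable.aemeasurable
    have : (Function.uncurry fun (s : ℝ) (v : ℝ) => (Ioi s).indicator (fun v => ENNReal.ofReal (a * (v - s) ^ (a - 1)) * kE d α v 0 x) v)
      = {p : ℝ × ℝ | p.1 < p.2}.indicator (fun p => ENNReal.ofReal (a * (p.2 - p.1) ^ (a - 1)) * kE d α p.2 0 x) := by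
      funext p; simp [Function.uncurry_def, indicator]
    rw [this]
    refine Measurable.indicator ?_ (measurableSet_lt measurable_fst measurable_snd)
    have h1 : Measurable (fun p : ℝ × ℝ => ENNReal.ofReal (a * (p.2 - p.1) ^ (a - 1))) := by fun_prop
    exact h1.mul ((kE_meas1 d α 0 x).comp measurable_snd)

lemma kp_hom (hα : 0 < α) (hα2 : α < 2) (a : ℝ) {e x : Ed d} (he : ‖e‖ = 1) (hx : x ≠ 0) :
    kp d α a 0 x = ENNReal.ofReal (‖x‖ ^ (α * (a + 1) - d)) * kp d α a 0 e := by
  have hr : 0 < ‖x‖ := norm_pos_iff.2 hx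
  have h1 : 0 < ‖x‖ ^ α := rpow_pos_of_pos hr _
  have hk : ∀ v, kE d α (‖x‖ ^ α * v) 0 x = ENNReal.ofReal (‖x‖ ^ (-(d : ℝ))) * kE d α v 0 e := by
    intro v
    rw [← kE_scale d hα hr v 0 e, smul_zero]
    rcases le_or_gt v 0 with hv | hv
    · rw [kE_nonpos (mul_nonpos_of_nonneg_of_nonpos h1.le hv), kE_nonpos (mul_nonpos_of_nonneg_of_nonpos h1.le hv)]
    · have : 0 < ‖x‖ ^ α * v := by positivity
      rw [kE_pos this, kE_pos this, sub_zero, sub_zero]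
      congr 1
      have hn : ‖‖x‖ • e‖ = ‖x‖ := by rw [norm_smul, he]; simp
      exact le_antisymm (sk_mono d hα hα2 this hn.le).2 (sk_mono d hα hα2 this hn.ge).2
  unfold kp
  rw [← lintegral_indicator measurableSet_Ioi, lint_mul _ h1, ← lintegral_indicator measurableSet_Ioi,
    ← lintegral_const_mul' _ _ (by simp), ← lintegral_const_mul' _ _ (by simp)]
  refine lintegral_congr fun v => ?_
  simp only [indicator, mem_Ioi, sub_zero]
  by_cases hv : 0 < v
  · rw [if_pos (by positivity), if_pos hv, hk, mul_rpow h1.le hv.le, ENNReal.ofReal_mul (by positivity), ← rpow_mul hr.le]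
    have : ‖x‖ ^ (α * (a + 1) - d) = ‖x‖ ^ α * ‖x‖ ^ (α * a) * ‖x‖ ^ (-(d : ℝ)) := by
      rw [← rpow_add hr, ← rpow_add hr]; congr 1; ring
    rw [this, ENNReal.ofReal_mul (by positivity), ENNReal.ofReal_mul (by positivity)]
    ring
  · rw [if_neg (by rw [mul_pos_iff_of_pos_left h1]; exact hv), if_neg hv]; simp

end Pot

section Pot2
variable (d : ℕ) [NeZero d] {α : ℝ}

lemma ed_nontrivial : Nontrivial (Ed d) := by
  refine ⟨EuclideanSpace.single (0 : Fin d) (1:ℝ), 0, ?_⟩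
  simp

lemma exists_unit : ∃ e : Ed d, ‖e‖ = 1 := ⟨EuclideanSpace.single (0 : Fin d) (1:ℝ), by simp⟩

lemma ae_ne0 : ∀ᵐ z : Ed d, z ≠ 0 := by
  haveI := ed_nontrivial d
  rw [ae_iff]
  simp

/-- value of potential constants -/
def cp (d : ℕ) (α a : ℝ) : ℝ :=
  (2 * π) ^ (-(d:ℝ)) * (2 * π) ^ ((d:ℝ) / 2) * Real.Gamma (a + 1) *
    ((1/2:ℝ) ^ (-((d:ℝ) - α * (a + 1)) / 2) * Real.Gamma (((d:ℝ) - α * (a + 1)) / 2)) /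
    ((1/2:ℝ) ^ (-(α * (a + 1)) / 2) * Real.Gamma (α * (a + 1) / 2))

lemma cp_pos (hα : 0 < α) {a : ℝ} (ha : -1 < a) (ha2 : α * (a + 1) < d) : 0 < cp d α a := by
  have h1 : 0 < α * (a + 1) := by apply mul_pos hα; linarith
  unfold cp
  have := Real.Gamma_pos_of_pos (by linarith : 0 < a + 1)
  have := Real.Gamma_pos_of_pos (by linarith : 0 < ((d:ℝ) - α * (a + 1)) / 2)
  have := Real.Gamma_pos_of_pos (by linarith : 0 < α * (a + 1) / 2)
  positivity

lemma gauss_swap (hα : 0 < α) {a : ℝ} (ha : -1 < a) (z : Ed d) (hz : z ≠ 0) :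
    ∫⁻ v in Ioi (0:ℝ), ENNReal.ofReal (v ^ a) * ENNReal.ofReal (Real.exp (-v * ‖z‖ ^ α) * Real.exp (-(1/2) * ‖z‖ ^ (2:ℝ))) =
      ENNReal.ofReal (Real.Gamma (a + 1)) * ENNReal.ofReal (‖z‖ ^ (-(α * (a + 1))) * Real.exp (-(1/2) * ‖z‖ ^ (2:ℝ))) := by
  have hr : 0 < ‖z‖ := norm_pos_iff.2 hz
  have hrα : 0 < ‖z‖ ^ α := rpow_pos_of_pos hr _
  have hI := Real.integral_rpow_mul_exp_neg_mul_Ioi (a := a + 1) (r := ‖z‖ ^ α) (by linarith) hrα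
  have hG := Real.Gamma_pos_of_pos (by linarith : 0 < a + 1)
  have h1 : ∀ v ∈ Ioi (0:ℝ), ENNReal.ofReal (v ^ a) * ENNReal.ofReal (Real.exp (-v * ‖z‖ ^ α) * Real.exp (-(1/2) * ‖z‖ ^ (2:ℝ))) =
      ENNReal.ofReal (v ^ (a + 1 - 1) * Real.exp (-(‖z‖ ^ α * v))) * ENNReal.ofReal (Real.exp (-(1/2) * ‖z‖ ^ (2:ℝ))) := by
    intro v hv
    have hv' : (0:ℝ) < v := hv
    rw [← ENNReal.ofReal_mul (by positivity), ← ENNReal.ofReal_mul (by positivity)]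
    congr 1
    rw [add_sub_cancel_right, show -(‖z‖ ^ α * v) = -v * ‖z‖ ^ α by ring]; ring
  rw [setLIntegral_congr_fun measurableSet_Ioi h1, lintegral_mul_const _ (by fun_prop), ← ofReal_integral_eq_lintegral_ofReal, hI]
  · rw [← ENNReal.ofReal_mul (by positivity), ← ENNReal.ofReal_mul (by positivity)]
    congr 1
    rw [one_div, inv_rpow hrα.le, ← rpow_mul hr.le, rpow_neg hr.le]; ring
  · by_contra hc
    rw [integral_undef hc] at hI
    have : 0 < (1 / ‖z‖ ^ α) ^ (a + 1) * Real.Gamma (a + 1) := by positivity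
    linarith
  · refine (ae_restrict_iff' measurableSet_Ioi).2 (ae_of_all _ fun s hs => ?_)
    have : 0 < s := hs
    show 0 ≤ s ^ (a + 1 - 1) * _
    positivity

lemma lint_radial {γ : ℝ} (hγ : γ < d) : ∫⁻ z : Ed d, ENNReal.ofReal (‖z‖ ^ (-γ) * Real.exp (-(1/2) * ‖z‖ ^ (2:ℝ))) =
    ENNReal.ofReal (d * volume.real (Metric.ball (0 : Ed d) 1) * ((1/2:ℝ) ^ (-(d - γ) / 2) * (1 / 2) * Gamma ((d - γ) / 2))) := by
  rw [← integral_radial_exp d hγ (by norm_num) (by norm_num), ofReal_integral_eq_lintegral_ofReal]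
  · exact integrable_radial_exp d hγ (by norm_num) (by norm_num)
  · exact ae_of_all _ fun z => by positivity

lemma kp_unit (hα : 0 < α) (hα2 : α < 2) {a : ℝ} (ha : -1 < a) (ha2 : α * (a + 1) < d) {e : Ed d} (he : ‖e‖ = 1) :
    kp d α a 0 e = ENNReal.ofReal (cp d α a) := by
  have hg : 0 < α * (a + 1) := by apply mul_pos hα; linarith
  have hG1 := Real.Gamma_pos_of_pos (by linarith : 0 < a + 1)
  have hG2 := Real.Gamma_pos_of_pos (by linarith : 0 < ((d:ℝ) - α * (a + 1)) / 2)
  have hG3 := Real.Gamma_pos_of_pos (by linarith : 0 < α * (a + 1) / 2)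
  have hd : 0 < (d:ℝ) := by have := NeZero.pos d; positivity
  have hω : 0 < volume.real (Metric.ball (0 : Ed d) 1) := vol_ball_pos d
  have w1 : ∫⁻ x, kp d α a 0 x * ENNReal.ofReal (Real.exp (-(1/2) * ‖x‖ ^ (2:ℝ))) = kp d α a 0 e *
      ENNReal.ofReal (d * volume.real (Metric.ball (0 : Ed d) 1) * ((1/2:ℝ) ^ (-(α * (a + 1)) / 2) * (1 / 2) * Gamma (α * (a + 1) / 2))) := by
    have := lint_radial d (γ := d - α * (a + 1)) (by linarith)
    rw [sub_sub_cancel] at this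
    rw [← this, ← lintegral_const_mul _ (by fun_prop)]
    refine lintegral_congr_ae ?_
    filter_upwards [ae_ne0 d] with x hx
    rw [kp_hom d hα hα2 a he hx, ENNReal.ofReal_mul (by positivity), show -((d:ℝ) - α * (a + 1)) = α * (a+1) - d by ring]
    ring
  have w2 : ∫⁻ x, kp d α a 0 x * ENNReal.ofReal (Real.exp (-(1/2) * ‖x‖ ^ (2:ℝ))) =
      ENNReal.ofReal ((2 * π) ^ (-(d:ℝ)) * (2 * π) ^ ((d:ℝ) / 2)) * (ENNReal.ofReal (Real.Gamma (a + 1)) *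
        ENNReal.ofReal (d * volume.real (Metric.ball (0 : Ed d) 1) * ((1/2:ℝ) ^ (-(d - α * (a + 1)) / 2) * (1 / 2) * Gamma ((d - α * (a + 1)) / 2)))) := by
    have hm : Measurable (fun p : Ed d × ℝ => (ENNReal.ofReal ((p.2 - 0) ^ a) * kE d α p.2 0 p.1) * ENNReal.ofReal (Real.exp (-(1/2) * ‖p.1‖ ^ (2:ℝ)))) := by
      have h1 : Measurable (fun p : Ed d × ℝ => ENNReal.ofReal ((p.2 - 0) ^ a)) := by fun_prop
      have h2 : Measurable (fun p : Ed d × ℝ => ENNReal.ofReal (Real.exp (-(1/2) * ‖p.1‖ ^ (2:ℝ)))) := by fun_prop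
      exact (h1.mul ((kE_meas2 d α 0).comp measurable_swap)).mul h2
    calc _ = ∫⁻ x, ∫⁻ v in Ioi 0, (ENNReal.ofReal ((v - 0) ^ a) * kE d α v 0 x) * ENNReal.ofReal (Real.exp (-(1/2) * ‖x‖ ^ (2:ℝ))) := by
          refine lintegral_congr fun x => ?_
          rw [lintegral_mul_const]
          · rfl
          · have h1 : Measurable (fun v : ℝ => ENNReal.ofReal ((v - 0) ^ a)) := by fun_prop
            exact h1.mul (kE_meas1 d α 0 x)
      _ = ∫⁻ v in Ioi 0, ∫⁻ x, (ENNReal.ofReal ((v - 0) ^ a) * kE d α v 0 x) * ENNReal.ofReal (Real.exp (-(1/2) * ‖x‖ ^ (2:ℝ))) :=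
          lintegral_lintegral_swap hm.aemeasurable
      _ = ∫⁻ v in Ioi 0, ENNReal.ofReal ((2 * π) ^ (-(d:ℝ)) * (2 * π) ^ ((d:ℝ) / 2)) * ∫⁻ z : Ed d, ENNReal.ofReal (v ^ a) *
            ENNReal.ofReal (Real.exp (-v * ‖z‖ ^ α) * Real.exp (-(1/2) * ‖z‖ ^ (2:ℝ))) := by
          refine setLIntegral_congr_fun measurableSet_Ioi fun v hv => ?_
          have hv' : (0:ℝ) < v := hv
          obtain ⟨gi, ge⟩ := sk_gauss d hα hv' (v := 1/2) (by norm_num)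
          have e1 : ∀ x : Ed d, (ENNReal.ofReal ((v - 0) ^ a) * kE d α v 0 x) * ENNReal.ofReal (Real.exp (-(1/2) * ‖x‖ ^ (2:ℝ))) =
              ENNReal.ofReal (v ^ a) * ENNReal.ofReal (sk d α v x * Real.exp (-(1/2) * ‖x‖ ^ 2)) := by
            intro x
            rw [kE_pos hv', sub_zero, sub_zero, ENNReal.ofReal_mul (sk_nonneg d hα hα2 hv' x), mul_assoc, rpow_two]
          simp_rw [e1]
          rw [lintegral_const_mul' _ _ (by simp), lintegral_const_mul' _ _ (by simp), ← ofReal_integral_eq_lintegral_ofReal gi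
            (ae_of_all _ fun x => mul_nonneg (sk_nonneg d hα hα2 hv' x) (by positivity)), ge,
            show π / (1/2) = 2 * π by ring, ENNReal.ofReal_mul (by positivity), ofReal_integral_eq_lintegral_ofReal]
          · rw [mul_left_comm]
            congr 2
            refine lintegral_congr fun z => ?_
            rw [rpow_two]; congr 3; ring
          · refine (integrable_expo d hα hv').mono (Measurable.aestronglyMeasurable (by fun_prop)) (ae_of_all _ fun z => ?_)
            rw [norm_mul, Real.norm_eq_abs, Real.norm_eq_abs, abs_of_pos (exp_pos _), abs_of_pos (exp_pos _)]
            refine mul_le_of_le_one_right (exp_pos _).le (Real.exp_le_one_iff.2 ?_)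
            have := sq_nonneg ‖z‖
            linarith
          · exact ae_of_all _ fun z => by positivity
      _ = ENNReal.ofReal ((2 * π) ^ (-(d:ℝ)) * (2 * π) ^ ((d:ℝ) / 2)) * ∫⁻ v in Ioi 0, ∫⁻ z : Ed d, ENNReal.ofReal (v ^ a) *
            ENNReal.ofReal (Real.exp (-v * ‖z‖ ^ α) * Real.exp (-(1/2) * ‖z‖ ^ (2:ℝ))) := lintegral_const_mul' _ _ (by simp)
      _ = ENNReal.ofReal ((2 * π) ^ (-(d:ℝ)) * (2 * π) ^ ((d:ℝ) / 2)) * ∫⁻ z : Ed d, ∫⁻ v in Ioi 0, ENNReal.ofReal (v ^ a) *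
            ENNReal.ofReal (Real.exp (-v * ‖z‖ ^ α) * Real.exp (-(1/2) * ‖z‖ ^ (2:ℝ))) := by
          rw [lintegral_lintegral_swap]
          apply Measurable.aemeasurable
          simp only [Function.uncurry_def]
          have h1 : Measurable (fun p : ℝ × Ed d => ENNReal.ofReal (p.1 ^ a)) := by fun_prop
          have h2 : Measurable (fun p : ℝ × Ed d => ENNReal.ofReal (Real.exp (-p.1 * ‖p.2‖ ^ α) * Real.exp (-(1/2) * ‖p.2‖ ^ (2:ℝ)))) := by fun_prop
          exact h1.mul h2
      _ = _ := by
          congr 1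
          rw [← lint_radial d ha2, ← lintegral_const_mul' _ _ (by simp)]
          refine lintegral_congr_ae ?_
          filter_upwards [ae_ne0 d] with z hz
          exact gauss_swap d hα ha z hz
  rw [w1] at w2
  have hD : 0 < d * volume.real (Metric.ball (0 : Ed d) 1) * ((1/2:ℝ) ^ (-(α * (a + 1)) / 2) * (1 / 2) * Gamma (α * (a + 1) / 2)) := by positivity
  rw [← ENNReal.ofReal_mul (by positivity), ← ENNReal.ofReal_mul (by positivity)] at w2
  have : kp d α a 0 e = ENNReal.ofReal (((2 * π) ^ (-(d:ℝ)) * (2 * π) ^ ((d:ℝ) / 2)) * ((Real.Gamma (a + 1)) *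
        (d * volume.real (Metric.ball (0 : Ed d) 1) * ((1/2:ℝ) ^ (-(d - α * (a + 1)) / 2) * (1 / 2) * Gamma ((d - α * (a + 1)) / 2))))) /
      ENNReal.ofReal (d * volume.real (Metric.ball (0 : Ed d) 1) * ((1/2:ℝ) ^ (-(α * (a + 1)) / 2) * (1 / 2) * Gamma (α * (a + 1) / 2))) := by
    rw [ENNReal.eq_div_iff (by simpa using hD) (by simp), mul_comm]; exact w2
  rw [this, ← ENNReal.ofReal_div_of_pos hD]
  congr 1
  unfold cp
  field_simp

end Pot2

section Pot3
variable (d : ℕ) [NeZero d] {α : ℝ}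

/-- power function -/
def hb (d : ℕ) (β : ℝ) (z : Ed d) : ENNReal := ENNReal.ofReal (‖z‖ ^ (-β))
/-- potential -/
def qq (d : ℕ) (α β : ℝ) (z : Ed d) : ENNReal := ENNReal.ofReal (kappa d α β * ‖z‖ ^ (-α))

lemma hb_meas (β : ℝ) : Measurable (hb d β) := by unfold hb; fun_prop
lemma qq_meas (α β : ℝ) : Measurable (qq d α β) := by unfold qq; fun_prop

lemma kappa_pos (hα : 0 < α) {β : ℝ} (hβ : 0 < β) (hβ2 : β < d - α) : 0 < kappa d α β := by
  unfold kappa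
  have := Real.Gamma_pos_of_pos (by linarith : 0 < (β + α) / 2)
  have := Real.Gamma_pos_of_pos (by linarith : 0 < ((d:ℝ) - β) / 2)
  have := Real.Gamma_pos_of_pos (by linarith : 0 < β / 2)
  have := Real.Gamma_pos_of_pos (by linarith : 0 < ((d:ℝ) - β - α) / 2)
  positivity

lemma kappa_cp (hα : 0 < α) {β : ℝ} (hβ : 0 < β) (hβ2 : β < d - α) :
    ((d - α - β) / α) * cp d α ((d - α - β) / α - 1) = kappa d α β * cp d α ((d - α - β) / α) := by
  have ha : 0 < (d - α - β) / α := div_pos (by linarith) hα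
  have e1 : α * ((d - α - β) / α + 1) = d - β := by field_simp; ring
  have e2 : α * ((d - α - β) / α - 1 + 1) = d - α - β := by field_simp; ring
  have e3 := Real.Gamma_add_one ha.ne'
  unfold cp kappa
  rw [e1, e2, e3]
  have g1 := Real.Gamma_pos_of_pos (by linarith : 0 < (β + α) / 2)
  have g2 := Real.Gamma_pos_of_pos (by linarith : 0 < ((d:ℝ) - β) / 2)
  have g3 := Real.Gamma_pos_of_pos (by linarith : 0 < β / 2)
  have g4 := Real.Gamma_pos_of_pos (by linarith : 0 < ((d:ℝ) - β - α) / 2)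
  have e4 : (d:ℝ) - (d - α - β) = β + α := by ring
  have e5 : (d:ℝ) - (d - β) = β := by ring
  have e6 : (d:ℝ) - α - β = d - β - α := by ring
  rw [e4, e5, e6, sub_add_cancel]
  have p1 : (1/2:ℝ) ^ (-(β + α) / 2) = (2:ℝ) ^ (α / 2) * (1/2:ℝ) ^ (-β/2) := by
    rw [one_div, inv_rpow (by norm_num), inv_rpow (by norm_num), ← rpow_neg (by norm_num), ← rpow_neg (by norm_num), ← rpow_add (by norm_num)]
    congr 1; ring
  have p2 : (1/2:ℝ) ^ (-(d - β) / 2) = (2:ℝ) ^ (α / 2) * (1/2:ℝ) ^ (-(d - β - α)/2) := by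
    rw [one_div, inv_rpow (by norm_num), inv_rpow (by norm_num), ← rpow_neg (by norm_num), ← rpow_neg (by norm_num), ← rpow_add (by norm_num)]
    congr 1; ring
  have p3 : (2:ℝ) ^ α = (2:ℝ) ^ (α/2) * (2:ℝ) ^ (α/2) := by
    rw [← rpow_add (by norm_num)]; congr 1; ring
  rw [p1, p2, p3]
  field_simp

lemma kp_hb (hα : 0 < α) (hα2 : α < 2) {β : ℝ} (hβ : 0 < β) (hβ2 : β < d) {x : Ed d} (hx : x ≠ 0) :
    kp d α ((d - α - β) / α) 0 x = ENNReal.ofReal (cp d α ((d - α - β) / α)) * hb d β x := by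
  obtain ⟨e, he⟩ := exists_unit d
  have e1 : α * ((d - α - β) / α + 1) = d - β := by field_simp; ring
  rw [kp_hom d hα hα2 _ he hx, kp_unit d hα hα2 _ _ he, e1, mul_comm]
  · unfold hb; congr 3; ring
  · have : 0 < ((d - α - β) / α + 1) := by
      by_contra hc
      nlinarith
    linarith
  · rw [e1]; linarith

lemma green_aux (hα : 0 < α) (hα2 : α < 2) {β : ℝ} (hβ : 0 < β) (hβ2 : β < d - α) {t : ℝ} (ht : 0 ≤ t) (x : Ed d) :
    ENNReal.ofReal (cp d α ((d - α - β) / α)) * (∫⁻ s in Ioi t, act volume (kE d α) (fun z => qq d α β z * hb d β z) s x) =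
      kp d α ((d - α - β) / α) t x := by
  have ha : 0 < (d - α - β) / α := div_pos (by linarith) hα
  rw [← kp_int d hα hα2 ha ht x, ← lintegral_const_mul' _ _ (by simp)]
  refine lintegral_congr fun s => ?_
  unfold act
  rw [← lintegral_const_mul' _ _ (by simp)]
  refine lintegral_congr_ae ?_
  filter_upwards [ae_ne0 d] with z hz
  have := kp_hb d hα hα2 (β := β + α) (by linarith) (by linarith) hz
  rw [show (d - α - (β + α)) / α = (d - α - β) / α - 1 by field_simp; ring] at this
  have hz' : 0 < ‖z‖ := norm_pos_iff.2 hz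
  have hk := kappa_pos d hα hβ hβ2
  have hc : 0 < cp d α ((d - α - β) / α - 1) := by
    refine cp_pos d hα (by linarith) ?_
    have e2 : α * ((d - α - β) / α - 1 + 1) = d - α - β := by field_simp; ring
    rw [e2]; linarith
  have hc' : 0 < cp d α ((d - α - β) / α) := by
    refine cp_pos d hα (by linarith) ?_
    have e2 : α * ((d - α - β) / α + 1) = d - β := by field_simp; ring
    rw [e2]; linarith
  rw [this, mul_left_comm]
  congr 1
  unfold qq hb
  rw [← ENNReal.ofReal_mul (by positivity), ← ENNReal.ofReal_mul (by positivity), ← ENNReal.ofReal_mul (by positivity), ← ENNReal.ofReal_mul (by positivity)]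
  congr 1
  rw [← mul_assoc ((d - α - β) / α), kappa_cp d hα hβ hβ2, show -(β + α) = -α + -β by ring, rpow_add hz']
  ring

lemma cp_pos' (hα : 0 < α) {β : ℝ} (hβ : 0 < β) (hβ2 : β < d - α) : 0 < cp d α ((d - α - β) / α) := by
  have ha : 0 < (d - α - β) / α := div_pos (by linarith) hα
  refine cp_pos d hα (by linarith) ?_
  have e2 : α * ((d - α - β) / α + 1) = d - β := by field_simp; ring
  rw [e2]; linarith

lemma green0 (hα : 0 < α) (hα2 : α < 2) {β : ℝ} (hβ : 0 < β) (hβ2 : β < d - α) {x : Ed d} (hx : x ≠ 0) :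
    ∫⁻ s in Ioi 0, act volume (kE d α) (fun z => qq d α β z * hb d β z) s x = hb d β x := by
  have h := green_aux d hα hα2 hβ hβ2 le_rfl x
  rw [kp_hb d hα hα2 hβ (by linarith) hx] at h
  exact (ENNReal.mul_right_inj (by simpa using cp_pos' d hα hβ hβ2) (by simp)).1 h

lemma green_t (hα : 0 < α) (hα2 : α < 2) {β : ℝ} (hβ : 0 < β) (hβ2 : β < d - α) {t : ℝ} (ht : 0 < t) (x : Ed d) :
    ∫⁻ s in Ioi t, act volume (kE d α) (fun z => qq d α β z * hb d β z) s x = act volume (kE d α) (hb d β) t x := by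
  have h := green_aux d hα hα2 hβ hβ2 ht.le x
  rw [← kp_act d hα hα2 _ ht x] at h
  refine (ENNReal.mul_right_inj (by simpa using cp_pos' d hα hβ hβ2) (by simp)).1 (h.trans ?_)
  unfold act
  rw [← lintegral_const_mul' _ _ (by simp)]
  refine lintegral_congr_ae ?_
  filter_upwards [ae_ne0 d] with z hz
  rw [kp_hb d hα hα2 hβ (by linarith) hz, mul_left_comm]

lemma hb_eq (hα : 0 < α) (hα2 : α < 2) {β : ℝ} (hβ : 0 < β) (hβ2 : β < d - α) {t : ℝ} (ht : 0 < t) {x : Ed d} (hx : x ≠ 0) :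
    act volume (kE d α) (hb d β) t x + ∫⁻ s in Ioo 0 t, act volume (kE d α) (fun z => qq d α β z * hb d β z) s x = hb d β x := by
  rw [← green_t d hα hα2 hβ hβ2 ht, ← green0 d hα hα2 hβ hβ2 hx, setLIntegral_congr (Ioo_ae_eq_Ioc (α := ℝ)), add_comm,
    ← lintegral_union measurableSet_Ioi (by simp [disjoint_left]), Ioc_union_Ioi_eq_Ioi ht.le]

end Pot3

section KapMono
variable (d : ℕ) [NeZero d] {α : ℝ}

lemma gamma_cmp {h a b a' b' : ℝ} (hh : 0 < h) (ha : 0 < a) (hb : 0 < b) (ha' : 0 < a') (hb' : 0 < b') (hs : a + b = a' + b')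
    (hp : a * b ≤ a' * b') :
    Real.Gamma (a + h) * Real.Gamma (b + h) * (Real.Gamma a' * Real.Gamma b') ≤
      Real.Gamma (a' + h) * Real.Gamma (b' + h) * (Real.Gamma a * Real.Gamma b) := by
  refine le_of_tendsto_of_tendsto (((Real.GammaSeq_tendsto_Gamma _).mul (Real.GammaSeq_tendsto_Gamma _)).mul
    ((Real.GammaSeq_tendsto_Gamma _).mul (Real.GammaSeq_tendsto_Gamma _)))
    (((Real.GammaSeq_tendsto_Gamma _).mul (Real.GammaSeq_tendsto_Gamma _)).mul
    ((Real.GammaSeq_tendsto_Gamma _).mul (Real.GammaSeq_tendsto_Gamma _))) ?_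
  filter_upwards [eventually_gt_atTop 0] with n hn
  have hn' : (0:ℝ) < n := by exact_mod_cast hn
  unfold Real.GammaSeq
  have pp : ∀ c : ℝ, 0 < c → 0 < ∏ j ∈ Finset.range (n + 1), (c + (j:ℝ)) := fun c hc => Finset.prod_pos fun j _ => by positivity
  have q1 := pp _ ha; have q2 := pp _ hb; have q3 := pp _ ha'; have q4 := pp _ hb'
  have q5 := pp (a + h) (by positivity); have q6 := pp (b + h) (by positivity)
  have q7 := pp (a' + h) (by positivity); have q8 := pp (b' + h) (by positivity)
  have e1 : (n:ℝ) ^ (a + h) * (n:ℝ) ^ (b + h) * ((n:ℝ) ^ a' * (n:ℝ) ^ b') = (n:ℝ) ^ (a' + h) * (n:ℝ) ^ (b' + h) * ((n:ℝ) ^ a * (n:ℝ) ^ b) := by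
    simp only [← rpow_add hn']
    congr 1; linarith
  set N : ℝ := (n.factorial : ℝ)
  have hN : 0 < N := by positivity
  have e2 : (∏ j ∈ Finset.range (n + 1), ((a' + h) + (j:ℝ))) * (∏ j ∈ Finset.range (n + 1), ((b' + h) + (j:ℝ))) *
     ((∏ j ∈ Finset.range (n + 1), (a + (j:ℝ))) * (∏ j ∈ Finset.range (n + 1), (b + (j:ℝ)))) ≤
     (∏ j ∈ Finset.range (n + 1), ((a + h) + (j:ℝ))) * (∏ j ∈ Finset.range (n + 1), ((b + h) + (j:ℝ))) *
     ((∏ j ∈ Finset.range (n + 1), (a' + (j:ℝ))) * (∏ j ∈ Finset.range (n + 1), (b' + (j:ℝ)))) := by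
    simp only [← Finset.prod_mul_distrib]
    refine Finset.prod_le_prod (fun j _ => by positivity) fun j _ => ?_
    have hj : (0:ℝ) ≤ j := by positivity
    generalize (j:ℝ) = j at hj
    have k1 : (a + j) * (b + j) ≤ (a' + j) * (b' + j) := by nlinarith
    have k2 : (a + h + j) * (b + h + j) = (a + j) * (b + j) + (h * (a' + b' + 2 * j) + h^2) := by
      rw [← hs]; ring
    have k3 : (a' + h + j) * (b' + h + j) = (a' + j) * (b' + j) + (h * (a' + b' + 2 * j) + h^2) := by
      ring
    rw [k2, k3]
    have k4 : 0 < h * (a' + b' + 2 * j) + h^2 := by positivity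
    nlinarith
  have L : ∀ A B C D P Q R S : ℝ, 0 < P → 0 < Q → 0 < R → 0 < S → A * N / P * (B * N / Q) * (C * N / R * (D * N / S)) = (A * B * (C * D)) * N ^ 4 / (P * Q * (R * S)) := by
    intros; field_simp
  rw [L _ _ _ _ _ _ _ _ q5 q6 q3 q4, L _ _ _ _ _ _ _ _ q7 q8 q1 q2, e1]
  exact div_le_div_of_nonneg_left (by positivity) (by positivity) e2

lemma kappa_mono (hα : 0 < α) {β δ : ℝ} (hβ : 0 < β) (hβδ : β ≤ δ) (hδ : δ ≤ (d - α) / 2) :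
    kappa d α β ≤ kappa d α δ := by
  have G := gamma_cmp (h := α / 2) (a := β / 2) (b := (d - β - α) / 2) (a' := δ / 2) (b' := (d - δ - α) / 2)
    (by positivity) (by positivity) (by linarith) (by linarith) (by linarith) (by ring) (by nlinarith)
  unfold kappa
  have g3 := Real.Gamma_pos_of_pos (by linarith : 0 < β / 2)
  have g4 := Real.Gamma_pos_of_pos (by linarith : 0 < ((d:ℝ) - β - α) / 2)
  have g5 := Real.Gamma_pos_of_pos (by linarith : 0 < δ / 2)
  have g6 := Real.Gamma_pos_of_pos (by linarith : 0 < ((d:ℝ) - δ - α) / 2)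
  rw [div_le_div_iff₀ (by positivity) (by positivity)]
  rw [show β / 2 + α / 2 = (β + α) / 2 by ring, show ((d:ℝ) - β - α) / 2 + α / 2 = (d - β) / 2 by ring,
    show δ / 2 + α / 2 = (δ + α) / 2 by ring, show ((d:ℝ) - δ - α) / 2 + α / 2 = (d - δ) / 2 by ring] at G
  have := mul_le_mul_of_nonneg_left G (by positivity : (0:ℝ) ≤ 2 ^ α)
  nlinarith [this]

/-- integral over the unit ball -/
def rb (d : ℕ) (γ : ℝ) : ENNReal := ∫⁻ z in Metric.ball (0 : Ed d) 1, hb d γ z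

lemma rb_lt_top {γ : ℝ} (hγ : γ < d) : rb d γ < ⊤ := by
  unfold rb
  have hi := (integrable_radial_exp d hγ (p := 1) (b := 1) one_pos one_pos).const_mul (Real.exp 1)
  refine lt_of_le_of_lt ?_ hi.lintegral_lt_top
  refine (setLIntegral_mono' measurableSet_ball fun z hz => ?_).trans (setLIntegral_le_lintegral (Metric.ball (0 : Ed d) 1) _)
  refine ENNReal.ofReal_le_ofReal ?_
  rw [mem_ball_zero_iff] at hz
  have h1 : 1 ≤ Real.exp 1 * Real.exp (-1 * ‖z‖ ^ (1:ℝ)) := by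
    rw [← Real.exp_add, rpow_one]; apply Real.one_le_exp; linarith
  have h2 : 0 ≤ ‖z‖ ^ (-γ) := by positivity
  nlinarith

lemma rb_scale {γ : ℝ} {R : ℝ} (hR : 0 < R) : ∫⁻ z in Metric.ball (0 : Ed d) R, hb d γ z = ENNReal.ofReal (R ^ (d - γ)) * rb d γ := by
  rw [rb, ← lintegral_indicator measurableSet_ball, ← lintegral_indicator measurableSet_ball]
  have h := lint_smul d hR (fun z => (Metric.ball (0 : Ed d) R).indicator (hb d γ) z)
  have e : ∀ z, (Metric.ball (0 : Ed d) R).indicator (hb d γ) (R • z) = ENNReal.ofReal (R ^ (-γ)) * (Metric.ball (0 : Ed d) 1).indicator (hb d γ) z := by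
    intro z
    simp only [indicator, mem_ball_zero_iff, norm_smul, Real.norm_eq_abs, abs_of_pos hR]
    have : R * ‖z‖ < R ↔ ‖z‖ < 1 := by constructor <;> intro <;> nlinarith
    simp only [this]
    split_ifs
    · unfold hb
      rw [norm_smul, Real.norm_eq_abs, abs_of_pos hR, mul_rpow hR.le (norm_nonneg _), ENNReal.ofReal_mul (by positivity)]
    · simp
  simp_rw [e] at h
  rw [lintegral_const_mul' _ _ (by simp)] at h
  have h2 : ENNReal.ofReal (R ^ (d:ℝ)) * ENNReal.ofReal (R ^ (-(d:ℝ))) = 1 := by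
    rw [← ENNReal.ofReal_mul (by positivity), ← rpow_add hR]; simp
  rw [← one_mul (lintegral _ _), ← h2, mul_assoc, ← h, ← mul_assoc, ← ENNReal.ofReal_mul (by positivity), ← rpow_add hR, sub_eq_add_neg]

end KapMono

section Green
variable {X : Type*} [MeasurableSpace X] (μ : Measure X) [SFinite μ] {k : ℝ → X → X → ENNReal}

lemma act_act (hk : MK k) (hck : CK μ k) {F : X → ENNReal} (hF : Measurable F) {s t : ℝ} (hs : 0 < s) (ht : 0 < t) (x : X) :
    act μ k (fun z => act μ k F s z) t x = act μ k F (t + s) x := by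
  unfold act
  have e : ∀ z, k t x z * ∫⁻ w, k s z w * F w ∂μ = ∫⁻ w, k t x z * (k s z w * F w) ∂μ := by
    intro z
    rw [lintegral_const_mul]
    exact (hk.comp measurable_const measurable_const measurable_id).mul hF
  simp_rw [e]
  rw [lintegral_lintegral_swap]
  · refine lintegral_congr fun w => ?_
    simp_rw [← mul_assoc]
    rw [lintegral_mul_const, hck t s ht hs]
    exact (hk.comp measurable_const measurable_const measurable_id).mul
      (hk.comp measurable_const measurable_id measurable_const)
  · refine Measurable.aemeasurable ?_
    exact (hk.comp measurable_const measurable_const measurable_fst).mul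
      ((hk.comp measurable_const measurable_fst measurable_snd).mul (hF.comp measurable_snd))

lemma act_green (hk : MK k) (hck : CK μ k) {F : X → ENNReal} (hF : Measurable F) {t : ℝ} (ht : 0 < t) (x : X) :
    act μ k (fun z => ∫⁻ s in Ioi (0:ℝ), act μ k F s z) t x = ∫⁻ s in Ioi t, act μ k F s x := by
  have hA := act_meas μ hk hF
  calc act μ k (fun z => ∫⁻ s in Ioi (0:ℝ), act μ k F s z) t x
      = ∫⁻ z, (∫⁻ s in Ioi (0:ℝ), k t x z * act μ k F s z) ∂μ := by
        unfold act
        refine lintegral_congr fun z => ?_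
        rw [lintegral_const_mul]
        exact hA.comp (measurable_id.prodMk measurable_const)
    _ = ∫⁻ s in Ioi (0:ℝ), (∫⁻ z, k t x z * act μ k F s z ∂μ) := by
        rw [lintegral_lintegral_swap]
        refine Measurable.aemeasurable ?_
        exact (hk.comp measurable_const measurable_const measurable_fst).mul (hA.comp measurable_swap)
    _ = ∫⁻ s in Ioi (0:ℝ), act μ k F (t + s) x :=
        setLIntegral_congr_fun measurableSet_Ioi fun s hs => act_act μ hk hck hF hs ht x
    _ = _ := by
        rw [← lintegral_indicator measurableSet_Ioi, ← lintegral_indicator measurableSet_Ioi,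
          ← lintegral_add_left_eq_self (μ := volume) ((Ioi t).indicator _) t]
        refine lintegral_congr fun s => ?_
        simp [indicator]

lemma damp_CK {lam : ℝ} (hck : CK μ k) : CK μ (damp lam k) := by
  intro s t hs ht x y
  unfold damp
  have e : ∀ z, ENNReal.ofReal (rexp (-lam * s)) * k s x z * (ENNReal.ofReal (rexp (-lam * t)) * k t z y) =
      ENNReal.ofReal (rexp (-lam * (s + t))) * (k s x z * k t z y) := by
    intro z
    rw [mul_add, Real.exp_add, ENNReal.ofReal_mul (by positivity)]; ring
  simp_rw [e]
  rw [lintegral_const_mul' _ _ (by simp), hck s t hs ht]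

lemma act_damp {lam : ℝ} (F : X → ENNReal) (t : ℝ) (x : X) : act μ (damp lam k) F t x = ENNReal.ofReal (rexp (-lam * t)) * act μ k F t x := by
  unfold act damp
  rw [← lintegral_const_mul' _ _ (by simp)]
  simp_rw [mul_assoc]

lemma act_add (hk : MK k) {F G : X → ENNReal} (hF : Measurable F) (t : ℝ) (x : X) :
    act μ k (fun z => F z + G z) t x = act μ k F t x + act μ k G t x := by
  unfold act
  simp_rw [mul_add]
  rw [lintegral_add_left]
  exact (hk.comp measurable_const measurable_const measurable_id).mul hF

lemma lint_exp {lam t : ℝ} (hl : 0 < lam) (ht : 0 ≤ t) : ∫⁻ s in Ioo 0 t, ENNReal.ofReal (lam * rexp (-lam * s)) = ENNReal.ofReal (1 - rexp (-lam * t)) := by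
  rw [setLIntegral_congr (Ioo_ae_eq_Ioc (α := ℝ)), ← ofReal_integral_eq_lintegral_ofReal, ← intervalIntegral.integral_of_le ht]
  · congr 1
    rw [intervalIntegral.integral_eq_sub_of_hasDerivAt (f := fun s => - rexp (-lam * s))]
    · simp; ring
    · intro s _
      have := ((hasDerivAt_id s).const_mul (-lam)).exp.neg
      have e : (fun s => - rexp (-lam * s)) = (-fun x => rexp (-lam * id x)) := by ext; simp
      rw [e]
      convert this using 1
      simp; ring
    · apply Continuous.intervalIntegrable; fun_prop
  · exact (Continuous.integrableOn_Ioc (by fun_prop))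
  · exact ae_of_all _ fun s => by positivity

end Green

/-- standing hypotheses -/
structure Hyp (d : ℕ) (α δ : ℝ) : Prop where
  a0 : 0 < α
  a2 : α < 2
  ad : α < d
  d0 : 0 < δ
  d2 : δ ≤ ((d:ℝ) - α) / 2
  da : δ < α

section Mass
variable {d : ℕ} [NeZero d] {α δ : ℝ}

lemma Hyp.dd (H : Hyp d α δ) : δ < d - α := by have := H.d2; have := H.ad; linarith

lemma phh (H : Hyp d α δ) {t : ℝ} (ht : 0 < t) {x : Ed d} (hx : x ≠ 0) :
    act volume (pt volume (kE d α) (qq d α δ)) (hb d δ) t x ≤ hb d δ x :=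
  super_sol volume (kE_MK d α) (qq_meas d α δ) (kE_zero d α) (hb_meas d δ) (ae_ne0 d)
    (fun _ ht _ hx => (hb_eq d H.a0 H.a2 H.d0 H.dd ht hx).le) ht hx

lemma p1h_lower (H : Hyp d α δ) : ∃ m : ℝ, 0 < m ∧ ∀ z : Ed d, ‖z‖ < 1 → ENNReal.ofReal m ≤ act volume (kE d α) (hb d δ) 1 z := by
  obtain ⟨c, C, hc, hC, hb'⟩ := sk_bounds d H.a0 H.a2
  have hω := vol_ball_pos d
  refine ⟨c * 3 ^ (-((d:ℝ) + α)) * volume.real (Metric.ball (0 : Ed d) 1), by positivity, fun z hz => ?_⟩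
  unfold act
  rw [ENNReal.ofReal_mul (by positivity), ofReal_measureReal (by finiteness), ← setLIntegral_const]
  refine le_trans (setLIntegral_mono_ae' measurableSet_ball ?_) (setLIntegral_le_lintegral _ _)
  filter_upwards [ae_ne0 d] with w hw0 hw
  rw [mem_ball_zero_iff] at hw
  have hw0' : 0 < ‖w‖ := norm_pos_iff.2 hw0
  rw [kE_pos one_pos, hb, ← ENNReal.ofReal_mul (sk_nonneg d H.a0 H.a2 one_pos _)]
  refine ENNReal.ofReal_le_ofReal ?_
  have h1 : 1 ≤ ‖w‖ ^ (-δ) := Real.one_le_rpow_of_pos_of_le_one_of_nonpos hw0' hw.le (by linarith [H.d0])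
  have h2 : c * 3 ^ (-((d:ℝ) + α)) ≤ sk d α 1 (w - z) := by
    refine le_trans ?_ (hb' (w - z)).1
    gcongr c * ?_
    refine Real.rpow_le_rpow_of_nonpos (by positivity) ?_ (by have := H.a0; have : (0:ℝ) ≤ d := by positivity
                                                              linarith)
    have := norm_sub_le w z
    linarith
  have h3 := sk_nonneg d H.a0 H.a2 one_pos (w - z)
  nlinarith

/-- resolvent part -/
def gl (d : ℕ) (α δ lam : ℝ) (x : Ed d) : ENNReal :=
  ∫⁻ s in Ioi (0:ℝ), act volume (damp lam (kE d α)) (fun z => qq d α δ z * hb d δ z) s x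

lemma gl_meas (lam : ℝ) : Measurable (gl d α δ lam) := by
  have h := act_meas volume (damp_meas lam (kE_MK d α)) ((qq_meas d α δ).mul (hb_meas d δ))
  exact (h.comp measurable_swap).lintegral_prod_right'

lemma gl_le (H : Hyp d α δ) {lam : ℝ} (hl : 0 < lam) {x : Ed d} (hx : x ≠ 0) :
    gl d α δ lam x + ENNReal.ofReal (1 - rexp (-lam)) * act volume (kE d α) (hb d δ) 1 x ≤ hb d δ x := by
  have hA := act_meas volume (kE_MK d α) ((qq_meas d α δ).mul (hb_meas d δ))
  have hA' : Measurable fun s => act volume (kE d α) (fun z => qq d α δ z * hb d δ z) s x := hA.comp (measurable_id.prodMk measurable_const)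
  rw [← green_t d H.a0 H.a2 H.d0 H.dd one_pos, ← green0 d H.a0 H.a2 H.d0 H.dd hx, gl, ← lintegral_const_mul _ hA',
    ← lintegral_indicator measurableSet_Ioi (s := Ioi (1:ℝ)), ← lintegral_indicator measurableSet_Ioi, ← lintegral_indicator measurableSet_Ioi,
    ← lintegral_add_right]
  · refine lintegral_mono fun s => ?_
    simp only [indicator, mem_Ioi, act_damp]
    set A := act volume (kE d α) (fun z => qq d α δ z * hb d δ z) s x
    by_cases h0 : 0 < s
    · by_cases h1 : 1 < s
      · simp only [h0, h1, if_true]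
        rw [← add_mul, ← ENNReal.ofReal_add (by positivity) (by simp; positivity)]
        refine mul_le_of_le_one_left (by positivity) ?_
        rw [← ENNReal.ofReal_one]
        refine ENNReal.ofReal_le_ofReal ?_
        have : rexp (-lam * s) ≤ rexp (-lam) := Real.exp_le_exp.2 (by nlinarith)
        linarith
      · simp only [h0, h1, if_true, if_false, add_zero]
        refine mul_le_of_le_one_left (by positivity) ?_
        rw [← ENNReal.ofReal_one]
        refine ENNReal.ofReal_le_ofReal (Real.exp_le_one_iff.2 (by nlinarith))
    · have h1 : ¬ 1 < s := fun h => h0 (by linarith)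
      simp [h0, h1]
  · exact (hA'.const_mul _).indicator measurableSet_Ioi

/-- weight -/
def HH (d : ℕ) (δ : ℝ) (x : Ed d) : ENNReal := 1 + hb d δ x

lemma HH_meas : Measurable (HH d δ) := measurable_const.add (hb_meas d δ)

lemma mass_bound (H : Hyp d α δ) : ∃ C : ℝ, 0 < C ∧ ∀ t : ℝ, 0 < t → t ≤ 4 → ∀ x : Ed d, x ≠ 0 →
    ∫⁻ y, pt volume (kE d α) (qq d α δ) t x y ≤ ENNReal.ofReal C * HH d δ x := by
  obtain ⟨m, hm, hmz⟩ := p1h_lower H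
  have hκ := kappa_pos d H.a0 H.d0 H.dd
  set lam := kappa d α δ with hlam
  have he1 : rexp (-lam) < 1 := by rw [Real.exp_lt_one_iff]; linarith
  set c0 := (1 - rexp (-lam)) * m with hc0
  have hc0p : 0 < c0 := mul_pos (by linarith) hm
  set f : Ed d → ENNReal := fun x => gl d α δ lam x + ENNReal.ofReal c0 with hf
  have hfm : Measurable f := (gl_meas lam).add_const _
  have f1 : ∀ z : Ed d, z ≠ 0 → ‖z‖ < 1 → f z ≤ hb d δ z := by
    intro z hz hz1
    refine le_trans ?_ (gl_le H hκ hz)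
    rw [hf, hc0, ENNReal.ofReal_mul (by linarith)]
    show gl d α δ lam z + _ ≤ _
    gcongr
    exact hmz z hz1
  clear_value c0
  have f2 : ∀ z : Ed d, z ≠ 0 → f z ≤ hb d δ z + ENNReal.ofReal c0 := by
    intro z hz
    show gl d α δ lam z + _ ≤ _
    gcongr
    exact le_trans le_self_add (gl_le H hκ hz)
  have qf : ∀ z : Ed d, z ≠ 0 → qq d α δ z * f z ≤ qq d α δ z * hb d δ z + ENNReal.ofReal (lam * c0) := by
    intro z hz
    by_cases h1 : ‖z‖ < 1
    · exact le_trans (mul_le_mul_right (f1 z hz h1) _) le_self_add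
    · refine le_trans (mul_le_mul_right (f2 z hz) _) ?_
      rw [mul_add, ENNReal.ofReal_mul hκ.le]
      gcongr
      unfold qq
      refine ENNReal.ofReal_le_ofReal ?_
      rw [← hlam]
      refine mul_le_of_le_one_right hκ.le (Real.rpow_le_one_of_one_le_of_nonpos (not_lt.1 h1) (by linarith [H.a0]))
  set k' := damp lam (kE d α) with hk'
  have hkm : MK k' := damp_meas lam (kE_MK d α)
  have hk0 : ∀ t ≤ 0, ∀ x y : Ed d, k' t x y = 0 := fun t ht x y => by rw [hk', damp, kE_zero d α t ht, mul_zero]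
  have hqh : Measurable (fun z => qq d α δ z * hb d δ z) := (qq_meas d α δ).mul (hb_meas d δ)
  have key : ∀ t : ℝ, 0 < t → ∀ x : Ed d, x ≠ 0 → act volume k' f t x + ∫⁻ s in Ioo 0 t, act volume k' (fun z => qq d α δ z * f z) s x ≤ f x := by
    intro t ht x hx
    have a1 : act volume k' f t x = (∫⁻ s in Ioi t, act volume k' (fun z => qq d α δ z * hb d δ z) s x) + ENNReal.ofReal (rexp (-lam * t) * c0) := by
      rw [hf, act_add volume hkm (gl_meas lam)]
      congr 1
      · exact act_green volume hkm (damp_CK volume (kE_CK d H.a0 H.a2)) hqh ht x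
      · rw [hk', act_damp, act, lintegral_mul_const' _ _ (by simp), kE_mass d H.a0 H.a2 ht, one_mul, ENNReal.ofReal_mul (by positivity)]
    have a2 : ∫⁻ s in Ioo 0 t, act volume k' (fun z => qq d α δ z * f z) s x ≤
        (∫⁻ s in Ioo 0 t, act volume k' (fun z => qq d α δ z * hb d δ z) s x) + ENNReal.ofReal ((1 - rexp (-lam * t)) * c0) := by
      have : ∫⁻ s in Ioo 0 t, ENNReal.ofReal (lam * rexp (-lam * s)) * ENNReal.ofReal c0 = ENNReal.ofReal ((1 - rexp (-lam * t)) * c0) := by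
        rw [lintegral_mul_const' _ _ (by simp), lint_exp hκ ht.le, ← ENNReal.ofReal_mul]
        simp; positivity
      rw [← this, ← lintegral_add_right _ (by fun_prop)]
      refine setLIntegral_mono' measurableSet_Ioo fun s hs => ?_
      refine (act_mono volume (g := fun z => qq d α δ z * hb d δ z + ENNReal.ofReal (lam * c0)) ((ae_ne0 d).mono fun z hz => qf z hz) s x).trans ?_
      rw [act_add volume hkm hqh]
      refine add_le_add le_rfl (le_of_eq ?_)
      rw [hk', act_damp, act, lintegral_mul_const' _ _ (by simp), kE_mass d H.a0 H.a2 hs.1, one_mul, ← ENNReal.ofReal_mul (by positivity),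
        ← ENNReal.ofReal_mul (by positivity)]
      congr 1; ring
    rw [a1]
    refine (add_le_add_right a2 _).trans (le_of_eq ?_)
    rw [add_add_add_comm, ← ENNReal.ofReal_add (by positivity) (mul_nonneg (by simp; positivity) hc0p.le)]
    rw [hf]
    show _ = gl d α δ lam x + _
    congr 1
    · rw [setLIntegral_congr (Ioo_ae_eq_Ioc (α := ℝ)), add_comm,
        ← lintegral_union measurableSet_Ioi (by simp [disjoint_left]), Ioc_union_Ioi_eq_Ioi ht.le]; rfl
    · congr 1; ring
  refine ⟨rexp (lam * 4) * (1 + c0⁻¹), by positivity, fun t ht ht4 x hx => ?_⟩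
  have R := super_sol volume hkm (qq_meas d α δ) hk0 hfm (ae_ne0 d) key ht hx
  have R2 : ENNReal.ofReal (rexp (-lam * t) * c0) * ∫⁻ y, pt volume (kE d α) (qq d α δ) t x y ≤ act volume (pt volume k' (qq d α δ)) f t x := by
    unfold act
    rw [← lintegral_const_mul' _ _ (by simp)]
    refine lintegral_mono fun z => ?_
    show _ ≤ pt volume k' (qq d α δ) t x z * f z
    rw [hk', pt_damp volume lam (kE_MK d α) (qq_meas d α δ), ENNReal.ofReal_mul (by positivity), mul_right_comm]
    gcongr
    exact le_add_self
  have R3 := (R2.trans R).trans (f2 x hx)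
  have : ∫⁻ y, pt volume (kE d α) (qq d α δ) t x y = ENNReal.ofReal (rexp (lam * t) * c0⁻¹) * (ENNReal.ofReal (rexp (-lam * t) * c0) * ∫⁻ y, pt volume (kE d α) (qq d α δ) t x y) := by
    rw [← mul_assoc, ← ENNReal.ofReal_mul (by positivity)]
    rw [show rexp (lam * t) * c0⁻¹ * (rexp (-lam * t) * c0) = (rexp (lam * t) * rexp (-lam * t)) * (c0⁻¹ * c0) by ring, ← Real.exp_add,
      inv_mul_cancel₀ hc0p.ne']
    simp
  rw [this]
  refine (mul_le_mul_right R3 _).trans ?_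
  rw [ENNReal.ofReal_mul (by positivity), ENNReal.ofReal_mul (by positivity), mul_assoc, mul_assoc]
  refine mul_le_mul' (ENNReal.ofReal_le_ofReal (Real.exp_le_exp.2 (by nlinarith))) ?_
  rw [HH, mul_add, mul_add, add_comm]
  refine add_le_add ?_ (mul_le_mul_left (ENNReal.ofReal_le_ofReal ?_) _)
  · rw [← ENNReal.ofReal_mul (by positivity), inv_mul_cancel₀ hc0p.ne', mul_one]
    refine ENNReal.ofReal_le_ofReal ?_
    have : 0 < c0⁻¹ := by positivity
    linarith
  · linarith

lemma int_bound (H : Hyp d α δ) : ∃ C : ℝ, 0 < C ∧ ∀ t : ℝ, 0 < t → t ≤ 4 → ∀ x : Ed d, x ≠ 0 →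
    (∫⁻ y, pt volume (kE d α) (qq d α δ) t x y ≤ ENNReal.ofReal C * HH d δ x) ∧
    (∫⁻ s in Ioo 0 t, (∫⁻ z, pt volume (kE d α) (qq d α δ) s x z * hb d α z) ≤ ENNReal.ofReal C * HH d δ x) := by
  obtain ⟨C, hC, h⟩ := mass_bound H
  have hκ := kappa_pos d H.a0 H.d0 H.dd
  refine ⟨C * (1 + (kappa d α δ)⁻¹), by positivity, fun t ht ht4 x hx => ⟨(h t ht ht4 x hx).trans ?_, ?_⟩⟩
  · gcongr; refine le_mul_of_one_le_right hC.le ?_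
    simp [hκ.le]
  · have M := h t ht ht4 x hx
    rw [pt_mass volume (kE_MK d α) (qq_meas d α δ) (kE_zero d α) (fun t ht x => kE_mass d H.a0 H.a2 ht x) ht x] at M
    have M2 := le_trans le_add_self M
    have e : ∀ s, ∀ z, pt volume (kE d α) (qq d α δ) s x z * hb d α z = ENNReal.ofReal (kappa d α δ)⁻¹ * (pt volume (kE d α) (qq d α δ) s x z * qq d α δ z) := by
      intro s z
      rw [qq, ENNReal.ofReal_mul hκ.le, hb, mul_left_comm, ← mul_assoc (ENNReal.ofReal _) (ENNReal.ofReal _), ← ENNReal.ofReal_mul (by positivity), inv_mul_cancel₀ hκ.ne']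
      simp
    simp_rw [e]
    simp_rw [lintegral_const_mul' _ _ (ENNReal.ofReal_ne_top (r := (kappa d α δ)⁻¹))]
    refine (mul_le_mul_right M2 _).trans ?_
    rw [← mul_assoc, ← ENNReal.ofReal_mul (by positivity)]
    refine mul_le_mul_left (ENNReal.ofReal_le_ofReal ?_) _
    have : 0 < (kappa d α δ)⁻¹ := by positivity
    nlinarith

end Mass

section Upper
variable {d : ℕ} [NeZero d] {α δ : ℝ}

/-- profile -/
def pb (d : ℕ) (α : ℝ) (x : Ed d) : ENNReal := ENNReal.ofReal ((1 + ‖x‖) ^ (-((d:ℝ) + α)))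

lemma pb_meas : Measurable (pb d α) := by unfold pb; fun_prop

/-- the perturbed kernel -/
abbrev pq (d : ℕ) (α : ℝ) (q : Ed d → ENNReal) : ℝ → Ed d → Ed d → ENNReal := pt volume (kE d α) q

lemma kE_pb (H : Hyp d α δ) : ∃ c C : ℝ, 0 < c ∧ 0 < C ∧ (∀ x y : Ed d, ENNReal.ofReal c * pb d α (y - x) ≤ kE d α 1 x y ∧
    kE d α 1 x y ≤ ENNReal.ofReal C * pb d α (y - x)) ∧
    ∀ s : ℝ, 0 < s → ∀ x y : Ed d, x ≠ y → kE d α s x y ≤ ENNReal.ofReal (C * s * ‖y - x‖ ^ (-((d:ℝ) + α))) := by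
  obtain ⟨c, C, hc, hC, hb'⟩ := sk_bounds d H.a0 H.a2
  have hd : (0:ℝ) ≤ d := by positivity
  have ha := H.a0
  refine ⟨c, C, hc, hC, fun x y => ⟨?_, ?_⟩, fun s hs x y hxy => ?_⟩
  · rw [kE_pos one_pos, pb, ← ENNReal.ofReal_mul hc.le]
    exact ENNReal.ofReal_le_ofReal (hb' _).1
  · rw [kE_pos one_pos, pb, ← ENNReal.ofReal_mul hC.le]
    exact ENNReal.ofReal_le_ofReal (hb' _).2
  · rw [kE_pos hs]
    refine ENNReal.ofReal_le_ofReal ?_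
    have hn : 0 < ‖y - x‖ := norm_pos_iff.2 (sub_ne_zero.2 hxy.symm)
    set r := s ^ (1/α) with hr
    have hr0 : 0 < r := by positivity
    have hrα : r ^ α = s := by rw [hr, ← rpow_mul hs.le, one_div, inv_mul_cancel₀ ha.ne', rpow_one]
    have e := sk_scale' d ha one_pos hr0 (r⁻¹ • (y - x))
    rw [smul_smul, mul_inv_cancel₀ hr0.ne', one_smul, mul_one, hrα] at e
    rw [e]
    have b := (hb' (r⁻¹ • (y - x))).2
    rw [norm_smul, norm_inv, Real.norm_eq_abs, abs_of_pos hr0] at b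
    have b2 : (1 + r⁻¹ * ‖y - x‖) ^ (-((d:ℝ) + α)) ≤ (r⁻¹ * ‖y - x‖) ^ (-((d:ℝ) + α)) :=
      Real.rpow_le_rpow_of_nonpos (by positivity) (by linarith) (by linarith)
    rw [mul_rpow (by positivity) hn.le, inv_rpow hr0.le, rpow_neg hr0.le, inv_inv] at b2
    calc _ ≤ r ^ (-(d:ℝ)) * (C * (r ^ ((d:ℝ) + α) * ‖y - x‖ ^ (-((d:ℝ) + α)))) := by
          gcongr; exact b.trans (by gcongr)
      _ = C * (r ^ (-(d:ℝ)) * r ^ ((d:ℝ) + α)) * ‖y - x‖ ^ (-((d:ℝ) + α)) := by ring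
      _ = _ := by rw [← rpow_add hr0, neg_add_cancel_left, hrα]

/-- admissible bounded potentials -/
structure Adm (d : ℕ) (α δ K : ℝ) (q : Ed d → ENNReal) : Prop where
  m : Measurable q
  le : ∀ z, q z ≤ qq d α δ z
  b : ∀ z, q z ≤ ENNReal.ofReal K

lemma qq_scale (H : Hyp d α δ) {r : ℝ} (hr : 0 < r) (z : Ed d) : ENNReal.ofReal (r ^ α) * qq d α δ (r • z) = qq d α δ z := by
  have hκ := kappa_pos d H.a0 H.d0 H.dd
  rw [qq, qq, ← ENNReal.ofReal_mul (by positivity), norm_smul, Real.norm_eq_abs, abs_of_pos hr, mul_rpow hr.le (norm_nonneg _)]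
  congr 1
  rw [rpow_neg hr.le]; field_simp

lemma Adm.scale (H : Hyp d α δ) {K : ℝ} {q : Ed d → ENNReal} (h : Adm d α δ K q) {r : ℝ} (hr : 0 < r) :
    Adm d α δ (r ^ α * K) (fun z => ENNReal.ofReal (r ^ α) * q (r • z)) := by
  refine ⟨(h.m.comp (measurable_const_smul r)).const_mul _, fun z => ?_, fun z => ?_⟩
  · rw [← qq_scale H hr]
    gcongr; exact h.le _
  · rw [ENNReal.ofReal_mul (by positivity)]
    gcongr; exact h.b _

lemma pq_symm {q : Ed d → ENNReal} (hq : Measurable q) (t : ℝ) (x y : Ed d) : pq d α q t x y = pq d α q t y x :=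
  pt_symm volume (kE_MK d α) hq (fun _ _ _ => kE_symm _ _) t x y

lemma pq_MK {q : Ed d → ENNReal} (hq : Measurable q) : MK (pq d α q) := pt_meas volume (kE_MK d α) hq

lemma pq_CK (H : Hyp d α δ) {q : Ed d → ENNReal} (hq : Measurable q) : CK volume (pq d α q) :=
  pt_ck volume (kE_MK d α) hq (kE_zero d α) (kE_CK d H.a0 H.a2)

lemma up1 (H : Hyp d α δ) : ∃ R C : ℝ, 0 < R ∧ 0 < C ∧ ∀ K : ℝ, 0 ≤ K → ∀ q : Ed d → ENNReal, Adm d α δ K q → ∀ x y : Ed d, x ≠ 0 → R ≤ ‖y‖ →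
    pq d α q 1 x y ≤ 2 * kE d α 1 x y + ENNReal.ofReal (C * ‖y‖ ^ (-((d:ℝ) + α))) * HH d δ x := by
  obtain ⟨c, C, hc, hC, -, hk⟩ := kE_pb H
  obtain ⟨M, hM, hI⟩ := int_bound H
  have hκ := kappa_pos d H.a0 H.d0 H.dd
  have hd : (0:ℝ) ≤ d := by positivity
  have ha := H.a0
  set R := 2 * (2 * kappa d α δ) ^ (1/α) with hR
  have hRp : 0 < R := by positivity
  refine ⟨R, 2 * (C * 2 ^ ((d:ℝ) + α) * kappa d α δ * M), hRp, by positivity, fun K hK q hq x y hx hy => ?_⟩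
  have hyp : 0 < ‖y‖ := hRp.trans_le hy
  set p := pq d α q with hp
  have pw : ∀ s ∈ Ioo (0:ℝ) 1, ∀ z, p s x z * q z * kE d α (1 - s) z y ≤ 
      2⁻¹ * (p s x z * p (1 - s) z y) + ENNReal.ofReal (C * 2 ^ ((d:ℝ) + α) * kappa d α δ * ‖y‖ ^ (-((d:ℝ) + α))) * (pq d α (qq d α δ) s x z * hb d α z) := by
    intro s hs z
    by_cases hz : ‖z‖ < ‖y‖ / 2
    · refine le_trans ?_ le_add_self
      have hzy : ‖y‖ / 2 ≤ ‖y - z‖ := by have := norm_sub_norm_le y z; linarith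
      have hne : z ≠ y := by rintro rfl; linarith
      have k1 : kE d α (1 - s) z y ≤ ENNReal.ofReal (C * (2 ^ ((d:ℝ) + α) * ‖y‖ ^ (-((d:ℝ) + α)))) := by
        refine (hk (1 - s) (by linarith [hs.2]) z y hne).trans (ENNReal.ofReal_le_ofReal ?_)
        have : ‖y - z‖ ^ (-((d:ℝ) + α)) ≤ 2 ^ ((d:ℝ) + α) * ‖y‖ ^ (-((d:ℝ) + α)) := by
          calc _ ≤ (‖y‖ / 2) ^ (-((d:ℝ) + α)) := Real.rpow_le_rpow_of_nonpos (by positivity) hzy (by linarith)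
            _ = _ := by rw [div_rpow hyp.le (by norm_num), rpow_neg (by norm_num : (0:ℝ) ≤ 2)]; field_simp
        calc _ ≤ C * (1 - s) * (2 ^ ((d:ℝ) + α) * ‖y‖ ^ (-((d:ℝ) + α))) := by
              have : 0 < 1 - s := by linarith [hs.2]
              gcongr
          _ ≤ C * 1 * (2 ^ ((d:ℝ) + α) * ‖y‖ ^ (-((d:ℝ) + α))) := by gcongr; linarith [hs.1]
          _ = _ := by ring
      have k2 : q z ≤ ENNReal.ofReal (kappa d α δ) * hb d α z := by
        refine (hq.le z).trans (le_of_eq ?_)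
        rw [qq, hb, ENNReal.ofReal_mul hκ.le]
      have k3 : p s x z ≤ pq d α (qq d α δ) s x z := pt_mono volume hq.le s x z
      calc _ ≤ pq d α (qq d α δ) s x z * (ENNReal.ofReal (kappa d α δ) * hb d α z) * ENNReal.ofReal (C * (2 ^ ((d:ℝ) + α) * ‖y‖ ^ (-((d:ℝ) + α)))) := by gcongr
        _ = _ := by
          rw [show C * 2 ^ ((d:ℝ) + α) * kappa d α δ * ‖y‖ ^ (-((d:ℝ) + α)) = kappa d α δ * (C * (2 ^ ((d:ℝ) + α) * ‖y‖ ^ (-((d:ℝ) + α)))) by ring,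
            ENNReal.ofReal_mul hκ.le]
          ring
    · refine le_trans ?_ le_self_add
      rw [not_lt] at hz
      have k2 : q z ≤ 2⁻¹ := by
        refine (hq.le z).trans ?_
        rw [qq, show (2⁻¹ : ENNReal) = ENNReal.ofReal 2⁻¹ by rw [ENNReal.ofReal_inv_of_pos (by norm_num)]; simp]
        refine ENNReal.ofReal_le_ofReal ?_
        have h1 : ‖z‖ ^ (-α) ≤ ((2 * kappa d α δ) ^ (1/α)) ^ (-α) :=
          Real.rpow_le_rpow_of_nonpos (by positivity) (by linarith) (by linarith)
        rw [← rpow_mul (by positivity), show 1 / α * -α = -1 by field_simp, rpow_neg_one] at h1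
        calc _ ≤ kappa d α δ * (2 * kappa d α δ)⁻¹ := by gcongr
          _ = _ := by field_simp
      calc _ ≤ p s x z * 2⁻¹ * p (1 - s) z y := by gcongr; exact k_le_pt volume _ _ _
        _ = _ := by ring
  have D : p 1 x y ≤ kE d α 1 x y + (2⁻¹ * p 1 x y + ENNReal.ofReal (C * 2 ^ ((d:ℝ) + α) * kappa d α δ * ‖y‖ ^ (-((d:ℝ) + α))) * (ENNReal.ofReal M * HH d δ x)) := by
    rw [hp, pq]
    nth_rw 1 [duhamel_l volume (kE_MK d α) hq.m]
    rw [kstar_eq volume hq.m (pq_MK hq.m) (kE_MK d α) (pt_nonpos volume (kE_zero d α)) (kE_zero d α)]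
    gcongr
    calc _ ≤ ∫⁻ s in Ioo (0:ℝ) 1, (∫⁻ z, (2⁻¹ * (p s x z * p (1 - s) z y) + ENNReal.ofReal (C * 2 ^ ((d:ℝ) + α) * kappa d α δ * ‖y‖ ^ (-((d:ℝ) + α))) * (pq d α (qq d α δ) s x z * hb d α z))) :=
          setLIntegral_mono' measurableSet_Ioo fun s hs => lintegral_mono fun z => pw s hs z
      _ = ∫⁻ s in Ioo (0:ℝ) 1, (2⁻¹ * p 1 x y + ENNReal.ofReal (C * 2 ^ ((d:ℝ) + α) * kappa d α δ * ‖y‖ ^ (-((d:ℝ) + α))) * ∫⁻ z, pq d α (qq d α δ) s x z * hb d α z) := by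
          refine setLIntegral_congr_fun measurableSet_Ioo fun s hs => ?_
          have m1 : Measurable fun z => p s x z * p (1 - s) z y :=
            ((pq_MK hq.m).comp measurable_const measurable_const measurable_id).mul ((pq_MK hq.m).comp measurable_const measurable_id measurable_const)
          show ∫⁻ z, (_ + _) = _
          rw [lintegral_add_left (m1.const_mul _), lintegral_const_mul _ m1, lintegral_const_mul' _ _ (by simp),
            pq_CK H hq.m s (1 - s) hs.1 (by linarith [hs.2]), add_sub_cancel]
      _ = 2⁻¹ * p 1 x y + ENNReal.ofReal (C * 2 ^ ((d:ℝ) + α) * kappa d α δ * ‖y‖ ^ (-((d:ℝ) + α))) * ∫⁻ s in Ioo (0:ℝ) 1, (∫⁻ z, pq d α (qq d α δ) s x z * hb d α z) := by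
          rw [lintegral_add_left measurable_const]
          congr 1
          · simp
          · rw [lintegral_const_mul' _ _ (by simp)]
      _ ≤ _ := by gcongr; exact (hI 1 one_pos (by norm_num) x hx).2
  have fin : p 1 x y ≠ ⊤ := by
    refine ne_top_of_le_ne_top ?_ (pt_bdd volume (kE_MK d α) hq.m (kE_zero d α) (kE_CK d H.a0 H.a2) hK hq.b one_pos x y)
    rw [kE_pos one_pos, ← ENNReal.ofReal_mul (by positivity)]; simp
  have hM' : ENNReal.ofReal (2 * (C * 2 ^ ((d:ℝ) + α) * kappa d α δ * M) * ‖y‖ ^ (-((d:ℝ) + α))) = 2 * (ENNReal.ofReal (C * 2 ^ ((d:ℝ) + α) * kappa d α δ * ‖y‖ ^ (-((d:ℝ) + α))) * ENNReal.ofReal M) := by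
    rw [← ENNReal.ofReal_mul (by positivity), mul_assoc 2, ENNReal.ofReal_mul (by norm_num), ENNReal.ofReal_ofNat, mul_right_comm]
  rw [hM']
  set A := ENNReal.ofReal (C * 2 ^ ((d:ℝ) + α) * kappa d α δ * ‖y‖ ^ (-((d:ℝ) + α)))
  have D2 : 2⁻¹ * p 1 x y + 2⁻¹ * p 1 x y ≤ 2⁻¹ * p 1 x y + (kE d α 1 x y + A * (ENNReal.ofReal M * HH d δ x)) := by
    rw [← add_mul, ENNReal.inv_two_add_inv_two, one_mul]
    refine D.trans (le_of_eq ?_); ring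
  have D3 := (ENNReal.add_le_add_iff_left (ENNReal.mul_ne_top (by simp) fin)).1 D2
  calc p 1 x y = 2 * (2⁻¹ * p 1 x y) := by rw [← mul_assoc, ENNReal.mul_inv_cancel (by simp) (by simp), one_mul]
    _ ≤ 2 * (kE d α 1 x y + A * (ENNReal.ofReal M * HH d δ x)) := by gcongr
    _ = _ := by ring

end Upper

section Upper2
variable {d : ℕ} [NeZero d] {α δ : ℝ}

lemma hb_scale (β : ℝ) {r : ℝ} (hr : 0 < r) (x : Ed d) : hb d β (r • x) = ENNReal.ofReal (r ^ (-β)) * hb d β x := by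
  rw [hb, hb, ← ENNReal.ofReal_mul (by positivity), norm_smul, Real.norm_eq_abs, abs_of_pos hr, mul_rpow hr.le (norm_nonneg _)]

lemma HH_scale_le (H : Hyp d α δ) {r : ℝ} (hr : 0 < r) (hr1 : r ≤ 1) (x : Ed d) : HH d δ (r⁻¹ • x) ≤ HH d δ x := by
  unfold HH
  rw [hb_scale δ (by positivity), inv_rpow hr.le, rpow_neg hr.le, inv_inv]
  gcongr
  refine mul_le_of_le_one_left (by positivity) ?_
  rw [← ENNReal.ofReal_one]
  exact ENNReal.ofReal_le_ofReal (rpow_le_one hr.le hr1 H.d0.le)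

lemma one_le_HH (x : Ed d) : 1 ≤ HH d δ x := le_self_add

lemma pq_scale1 (H : Hyp d α δ) {q : Ed d → ENNReal} (hq : Measurable q) {r : ℝ} (hr : 0 < r) (x y : Ed d) :
    pq d α q (r ^ α) x y = ENNReal.ofReal (r ^ (-(d:ℝ))) * pq d α (fun z => ENNReal.ofReal (r ^ α) * q (r • z)) 1 (r⁻¹ • x) (r⁻¹ • y) := by
  have := pt_scale d H.a0 hr hq 1 (r⁻¹ • x) (r⁻¹ • y)
  rwa [smul_smul, smul_smul, mul_inv_cancel₀ hr.ne', one_smul, one_smul, mul_one] at this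

lemma pb_le_one (H : Hyp d α δ) (x : Ed d) : pb d α x ≤ 1 := by
  unfold pb
  rw [← ENNReal.ofReal_one]
  refine ENNReal.ofReal_le_ofReal (rpow_le_one_of_one_le_of_nonpos ?_ ?_)
  · linarith [norm_nonneg x]
  · have := H.a0
    have : (0:ℝ) ≤ d := by positivity
    linarith

lemma up1' (H : Hyp d α δ) : ∃ R C : ℝ, 0 < R ∧ 0 < C ∧ ∀ K : ℝ, 0 ≤ K → ∀ q : Ed d → ENNReal, Adm d α δ K q → ∀ x y : Ed d, x ≠ 0 → R ≤ ‖y‖ →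
    pq d α q 1 x y ≤ ENNReal.ofReal C * HH d δ x := by
  obtain ⟨R, C, hR, hC, h⟩ := up1 H
  obtain ⟨c', C', hc', hC', h', -⟩ := kE_pb H
  have := H.a0
  have : (0:ℝ) ≤ d := by positivity
  refine ⟨R, 2 * C' + C * R ^ (-((d:ℝ) + α)), hR, by positivity, fun K hK q hq x y hx hy => (h K hK q hq x y hx hy).trans ?_⟩
  rw [ENNReal.ofReal_add (by positivity) (by positivity), add_mul]
  refine add_le_add ?_ (mul_le_mul_left (ENNReal.ofReal_le_ofReal ?_) _)
  · rw [ENNReal.ofReal_mul (by norm_num), ENNReal.ofReal_ofNat]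
    calc 2 * kE d α 1 x y ≤ 2 * (ENNReal.ofReal C' * pb d α (y - x)) := by gcongr; exact (h' x y).2
      _ ≤ 2 * (ENNReal.ofReal C' * 1) := by gcongr; exact pb_le_one H _
      _ = 2 * ENNReal.ofReal C' * 1 := by ring
      _ ≤ _ := by gcongr; exact one_le_HH x
  · gcongr ?_ * ?_
    exact Real.rpow_le_rpow_of_nonpos hR hy (by linarith)

lemma act_HH (H : Hyp d α δ) : ∃ C : ℝ, 0 < C ∧ ∀ t : ℝ, 0 < t → t ≤ 4 → ∀ x : Ed d, x ≠ 0 →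
    ∫⁻ z, pq d α (qq d α δ) t x z * HH d δ z ≤ ENNReal.ofReal C * HH d δ x := by
  obtain ⟨C, hC, h⟩ := mass_bound H
  refine ⟨C + 1, by positivity, fun t ht ht4 x hx => ?_⟩
  have m1 : Measurable fun z => pq d α (qq d α δ) t x z := (pq_MK (qq_meas d α δ)).comp measurable_const measurable_const measurable_id
  have e : ∀ z, pq d α (qq d α δ) t x z * HH d δ z = pq d α (qq d α δ) t x z + pq d α (qq d α δ) t x z * hb d δ z := by
    intro z; rw [HH, mul_add, mul_one]
  simp_rw [e]
  rw [lintegral_add_left m1, ENNReal.ofReal_add hC.le zero_le_one, ENNReal.ofReal_one]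
  have h1 := h t ht ht4 x hx
  have h2 := phh H ht hx
  rw [add_mul, one_mul]
  exact add_le_add h1 (h2.trans le_add_self)

lemma up2 (H : Hyp d α δ) {ε : ℝ} (hε : 0 < ε) : ∃ C : ℝ, 0 < C ∧ ∀ K : ℝ, 0 ≤ K → ∀ q : Ed d → ENNReal, Adm d α δ K q →
    ∀ t : ℝ, 1/4 ≤ t → t ≤ 4 → ∀ x y : Ed d, x ≠ 0 → ε ≤ ‖y‖ → pq d α q t x y ≤ ENNReal.ofReal C * HH d δ x := by
  obtain ⟨R, C, hR, hC, h⟩ := up1' H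
  obtain ⟨C2, hC2, h2⟩ := act_HH H
  obtain ⟨r, hr, hr1, hrα⟩ := exists_small_rpow H.a0 (by norm_num : (0:ℝ) < 1/8)
  have ha := H.a0
  set ρ := min r (ε / R) with hρ
  have hρ0 : 0 < ρ := by positivity
  have hρ1 : ρ ≤ 1 := (min_le_left _ _).trans hr1
  have hρα : ρ ^ α ≤ 1/8 := (rpow_le_rpow hρ0.le (min_le_left _ _) ha.le).trans hrα
  have hρR : R ≤ ρ⁻¹ * ε := by
    have : ρ ≤ ε / R := min_le_right _ _
    rw [le_div_iff₀ hR] at this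
    rw [inv_mul_eq_div, le_div_iff₀ hρ0]; linarith
  have hρα0 : 0 < ρ ^ α := by positivity
  refine ⟨ρ ^ (-(d:ℝ)) * C * C2, by positivity, fun K hK q hq t ht1 ht4 x y hx hy => ?_⟩
  have small : ∀ w : Ed d, w ≠ 0 → pq d α q (ρ ^ α) w y ≤ ENNReal.ofReal (ρ ^ (-(d:ℝ)) * C) * HH d δ w := by
    intro w hw
    rw [pq_scale1 H hq.m hρ0, ENNReal.ofReal_mul (by positivity), mul_assoc]
    gcongr
    refine (h _ (by positivity) _ (hq.scale H hρ0) (ρ⁻¹ • w) (ρ⁻¹ • y) (by simp [hw, hρ0.ne']) ?_).trans ?_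
    · rw [norm_smul, norm_inv, Real.norm_eq_abs, abs_of_pos hρ0]
      refine hρR.trans (by gcongr)
    · gcongr; exact HH_scale_le H hρ0 hρ1 w
  have e := pq_CK H hq.m (t - ρ ^ α) (ρ ^ α) (by linarith) hρα0 x y
  rw [sub_add_cancel] at e
  rw [← e]
  calc _ ≤ ∫⁻ w, ENNReal.ofReal (ρ ^ (-(d:ℝ)) * C) * (pq d α (qq d α δ) (t - ρ ^ α) x w * HH d δ w) := by
        refine lintegral_mono_ae ?_
        filter_upwards [ae_ne0 d] with w hw
        calc _ ≤ pq d α (qq d α δ) (t - ρ ^ α) x w * (ENNReal.ofReal (ρ ^ (-(d:ℝ)) * C) * HH d δ w) :=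
              mul_le_mul' (pt_mono volume hq.le _ _ _) (small w hw)
          _ = _ := by ring
    _ = ENNReal.ofReal (ρ ^ (-(d:ℝ)) * C) * ∫⁻ w, pq d α (qq d α δ) (t - ρ ^ α) x w * HH d δ w := lintegral_const_mul' _ _ (by simp)
    _ ≤ ENNReal.ofReal (ρ ^ (-(d:ℝ)) * C) * (ENNReal.ofReal C2 * HH d δ x) := by
        gcongr
        exact h2 _ (by linarith) (by linarith) x hx
    _ = _ := by rw [← mul_assoc, ← ENNReal.ofReal_mul (by positivity)]

end Upper2

section Upper3
variable {d : ℕ} [NeZero d] {α δ : ℝ}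

/-- uniform bound statement -/
def UB (d : ℕ) (α δ K S : ℝ) : Prop := ∀ q : Ed d → ENNReal, Adm d α δ K q → ∀ x y : Ed d, x ≠ 0 → y ≠ 0 →
  pq d α q 1 x y ≤ ENNReal.ofReal S * (HH d δ x * HH d δ y)

lemma HH_small (H : Hyp d α δ) {ε : ℝ} (hε1 : ε ≤ 1) {z : Ed d} (hz : z ≠ 0) (hzε : ‖z‖ ≤ ε) :
    HH d δ z ≤ ENNReal.ofReal (2 * ε ^ (α - δ)) * hb d α z := by
  have hz' : 0 < ‖z‖ := norm_pos_iff.2 hz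
  have h0 := H.d0
  have h1 : 1 ≤ ‖z‖ ^ (-δ) := one_le_rpow_of_pos_of_le_one_of_nonpos hz' (by linarith) (by linarith)
  have hε : 0 < ε := by linarith
  rw [HH, hb, hb, ← ENNReal.ofReal_one, ← ENNReal.ofReal_add zero_le_one (by positivity), ← ENNReal.ofReal_mul (by positivity)]
  refine ENNReal.ofReal_le_ofReal ?_
  have h2 : ‖z‖ ^ (α - δ) ≤ ε ^ (α - δ) := rpow_le_rpow hz'.le hzε (by linarith [H.da])
  have h3 : ‖z‖ ^ (-δ) = ‖z‖ ^ (α - δ) * ‖z‖ ^ (-α) := by rw [← rpow_add hz']; congr 1; ring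
  have h4 : 0 < ‖z‖ ^ (-α) := by positivity
  nlinarith

lemma UB_step (H : Hyp d α δ) : ∃ C : ℝ, 0 < C ∧ ∀ K : ℝ, 0 ≤ K → ∀ S : ℝ, 0 < S → UB d α δ K S → UB d α δ K (S / 2 + C) := by
  obtain ⟨M, hM, hI⟩ := int_bound H
  have ha := H.a0
  set D := (4:ℝ) ^ ((d:ℝ) / α) with hD
  have hD0 : 0 < D := by positivity
  obtain ⟨ε, hε, hε1, hεs⟩ := exists_small_rpow (p := α - δ) (ε := 1 / (8 * D * M)) (by linarith [H.da]) (by positivity)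
  obtain ⟨C, hC, h2⟩ := up2 H hε
  refine ⟨2 * C * M, by positivity, fun K hK S hS hB q hq x y hx hy => ?_⟩
  set A := D * S * (2 * ε ^ (α - δ)) with hA
  have pw : ∀ s ∈ Ioo (1/4:ℝ) (3/4), ∀ z : Ed d, z ≠ 0 → pq d α q (1 - s) z y ≤ (ENNReal.ofReal A * hb d α z + ENNReal.ofReal C) * HH d δ y := by
    intro s hs z hz
    by_cases hze : ‖z‖ ≤ ε
    · rw [add_mul]
      refine le_trans ?_ le_self_add
      have hs1 : 0 < 1 - s := by linarith [hs.2]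
      set r := (1 - s) ^ (1/α) with hr
      have hr0 : 0 < r := by positivity
      have hrα : r ^ α = 1 - s := by rw [hr, ← rpow_mul hs1.le, one_div, inv_mul_cancel₀ ha.ne', rpow_one]
      have hr1 : r ≤ 1 := rpow_le_one hs1.le (by linarith [hs.1]) (by positivity)
      have hrd : r ^ (-(d:ℝ)) ≤ D := by
        rw [hr, hD, ← rpow_mul hs1.le, show (4:ℝ) = (1/4)⁻¹ by norm_num, inv_rpow (by norm_num), ← rpow_neg (by norm_num),
          show 1 / α * -(d:ℝ) = -(d / α) by ring]
        refine rpow_le_rpow_of_nonpos (by norm_num) (by linarith [hs.2]) ?_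
        have : 0 ≤ (d:ℝ) / α := by positivity
        linarith
      have hq' := hq.scale H hr0
      have hq'' : Adm d α δ K (fun z => ENNReal.ofReal (r ^ α) * q (r • z)) := ⟨hq'.m, hq'.le, fun z => (hq'.b z).trans (by
        refine ENNReal.ofReal_le_ofReal ?_
        rw [hrα]; nlinarith [hs.1])⟩
      rw [← hrα, pq_scale1 H hq.m hr0]
      have b := hB _ hq'' (r⁻¹ • z) (r⁻¹ • y) (by simp [hz, hr0.ne']) (by simp [hy, hr0.ne'])
      calc _ ≤ ENNReal.ofReal D * (ENNReal.ofReal S * (HH d δ (r⁻¹ • z) * HH d δ (r⁻¹ • y))) :=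
            mul_le_mul' (ENNReal.ofReal_le_ofReal hrd) b
        _ ≤ ENNReal.ofReal D * (ENNReal.ofReal S * (HH d δ z * HH d δ y)) := by
            gcongr <;> exact HH_scale_le H hr0 hr1 _
        _ ≤ ENNReal.ofReal D * (ENNReal.ofReal S * (ENNReal.ofReal (2 * ε ^ (α - δ)) * hb d α z * HH d δ y)) := by
            gcongr; exact HH_small H hε1 hz hze
        _ = _ := by rw [hA, ENNReal.ofReal_mul (p := D * S) (by positivity), ENNReal.ofReal_mul (p := D) (by positivity)]; ring
    · rw [add_mul]
      refine le_trans ?_ le_add_self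
      rw [pq_symm hq.m]
      exact h2 K hK q hq (1 - s) (by linarith [hs.2]) (by linarith [hs.1]) y z hy (by linarith)
  have hx4 := hI 4 (by norm_num) le_rfl x hx
  have e : 2⁻¹ * pq d α q 1 x y = ∫⁻ s in Ioo (1/4:ℝ) (3/4), (∫⁻ z, pq d α q s x z * pq d α q (1 - s) z y) := by
    rw [setLIntegral_congr_fun measurableSet_Ioo (g := fun _ => pq d α q 1 x y) (fun s hs => by
      rw [pq_CK H hq.m s (1 - s) (by linarith [hs.1]) (by linarith [hs.2]), add_sub_cancel])]
    rw [setLIntegral_const, Real.volume_Ioo, mul_comm]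
    congr 1
    rw [show (3/4 - 1/4 : ℝ) = 2⁻¹ by norm_num, ENNReal.ofReal_inv_of_pos (by norm_num)]; simp
  have m1 : ∀ s, Measurable fun z => pq d α (qq d α δ) s x z := fun s => (pq_MK (qq_meas d α δ)).comp measurable_const measurable_const measurable_id
  have m2 : Measurable fun p : ℝ × Ed d => pq d α (qq d α δ) p.1 x p.2 := (pq_MK (qq_meas d α δ)).comp measurable_fst measurable_const measurable_snd
  have L : 2⁻¹ * pq d α q 1 x y ≤ (ENNReal.ofReal A * (ENNReal.ofReal M * HH d δ x) + ENNReal.ofReal C * (ENNReal.ofReal M * HH d δ x)) * HH d δ y := by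
    rw [e]
    calc _ ≤ ∫⁻ s in Ioo (1/4:ℝ) (3/4), (∫⁻ z, (ENNReal.ofReal A * (pq d α (qq d α δ) s x z * hb d α z) + ENNReal.ofReal C * pq d α (qq d α δ) s x z) * HH d δ y) := by
          refine setLIntegral_mono' measurableSet_Ioo fun s hs => lintegral_mono_ae ?_
          filter_upwards [ae_ne0 d] with z hz
          calc _ ≤ pq d α (qq d α δ) s x z * ((ENNReal.ofReal A * hb d α z + ENNReal.ofReal C) * HH d δ y) :=
                mul_le_mul' (pt_mono volume hq.le _ _ _) (pw s hs z hz)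
            _ = _ := by ring
      _ = ∫⁻ s in Ioo (1/4:ℝ) (3/4), (ENNReal.ofReal A * (∫⁻ z, pq d α (qq d α δ) s x z * hb d α z) + ENNReal.ofReal C * ∫⁻ z, pq d α (qq d α δ) s x z) * HH d δ y := by
          refine lintegral_congr fun s => ?_
          have mm : Measurable fun z => pq d α (qq d α δ) s x z * hb d α z := (m1 s).mul (hb_meas d α)
          have m3 : Measurable fun z => ENNReal.ofReal A * (pq d α (qq d α δ) s x z * hb d α z) + ENNReal.ofReal C * pq d α (qq d α δ) s x z := (mm.const_mul _).add ((m1 s).const_mul _)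
          rw [lintegral_mul_const _ m3, lintegral_add_left (mm.const_mul _), lintegral_const_mul _ mm, lintegral_const_mul _ (m1 s)]
      _ ≤ ∫⁻ s in Ioo (1/4:ℝ) (3/4), (ENNReal.ofReal A * (∫⁻ z, pq d α (qq d α δ) s x z * hb d α z) + ENNReal.ofReal C * (ENNReal.ofReal M * HH d δ x)) * HH d δ y := by
          refine setLIntegral_mono' measurableSet_Ioo fun s hs => ?_
          gcongr
          exact (hI s (by linarith [hs.1]) (by linarith [hs.2]) x hx).1
      _ = (ENNReal.ofReal A * (∫⁻ s in Ioo (1/4:ℝ) (3/4), (∫⁻ z, pq d α (qq d α δ) s x z * hb d α z)) + 2⁻¹ * (ENNReal.ofReal C * (ENNReal.ofReal M * HH d δ x))) * HH d δ y := by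
          have mm : Measurable fun s => ∫⁻ z, pq d α (qq d α δ) s x z * hb d α z :=
            (m2.mul ((hb_meas d α).comp measurable_snd)).lintegral_prod_right'
          have m3 : Measurable fun s => ENNReal.ofReal A * (∫⁻ z, pq d α (qq d α δ) s x z * hb d α z) + ENNReal.ofReal C * (ENNReal.ofReal M * HH d δ x) := (mm.const_mul _).add_const _
          rw [lintegral_mul_const _ m3, lintegral_add_left (mm.const_mul _), lintegral_const_mul _ mm]
          congr 2
          rw [setLIntegral_const, Real.volume_Ioo, mul_comm]
          congr 1
          rw [show (3/4 - 1/4 : ℝ) = 2⁻¹ by norm_num, ENNReal.ofReal_inv_of_pos (by norm_num)]; simp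
      _ ≤ _ := by
          refine mul_le_mul_left (add_le_add (mul_le_mul_right ?_ _) ?_) _
          · refine le_trans (lintegral_mono_set ?_) hx4.2
            exact Ioo_subset_Ioo (by norm_num) (by norm_num)
          · exact mul_le_of_le_one_left (zero_le) (by simp)
  have hA0 : 0 < A := by positivity
  clear_value A
  calc pq d α q 1 x y = 2 * (2⁻¹ * pq d α q 1 x y) := by rw [← mul_assoc, ENNReal.mul_inv_cancel (by simp) (by simp), one_mul]
    _ ≤ 2 * ((ENNReal.ofReal A * (ENNReal.ofReal M * HH d δ x) + ENNReal.ofReal C * (ENNReal.ofReal M * HH d δ x)) * HH d δ y) := by gcongr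
    _ = ENNReal.ofReal (2 * (A * M + C * M)) * (HH d δ x * HH d δ y) := by
        rw [ENNReal.ofReal_mul (p := 2) (by norm_num), ENNReal.ofReal_ofNat, ENNReal.ofReal_add (by positivity) (by positivity), ENNReal.ofReal_mul (p := A) (by positivity),
          ENNReal.ofReal_mul (p := C) (by positivity)]
        ring
    _ ≤ _ := by
        gcongr
        rw [le_div_iff₀ (by positivity)] at hεs
        have : A * M = S * (D * M * ε ^ (α - δ)) * 2 := by rw [hA]; ring
        rw [this]
        nlinarith

lemma up3 (H : Hyp d α δ) : ∃ C : ℝ, 0 < C ∧ ∀ K : ℝ, 0 ≤ K → UB d α δ K C := by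
  obtain ⟨C, hC, h⟩ := UB_step H
  obtain ⟨c', C', hc', hC', h', -⟩ := kE_pb H
  refine ⟨2 * C + 1, by positivity, fun K hK => ?_⟩
  have mono : ∀ S S' : ℝ, S ≤ S' → UB d α δ K S → UB d α δ K S' := fun S S' hS hB q hq x y hx hy =>
    (hB q hq x y hx hy).trans (by gcongr)
  set S0 := rexp (K * 1) * C' with hS0
  have hS0p : 0 < S0 := by positivity
  have h0 : UB d α δ K S0 := by
    intro q hq x y hx hy
    refine (pt_bdd volume (kE_MK d α) hq.m (kE_zero d α) (kE_CK d H.a0 H.a2) hK hq.b one_pos x y).trans ?_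
    rw [hS0, ENNReal.ofReal_mul (by positivity), mul_assoc]
    gcongr
    refine (h' x y).2.trans ?_
    gcongr
    calc pb d α (y - x) ≤ 1 := pb_le_one H _
      _ = 1 * 1 := by simp
      _ ≤ _ := mul_le_mul' (one_le_HH x) (one_le_HH y)
  have hn : ∀ n : ℕ, UB d α δ K (S0 / 2 ^ n + 2 * C) := by
    intro n
    induction n with
    | zero => exact mono _ _ (by simp; positivity) h0
    | succ n ih =>
      refine mono _ _ (le_of_eq ?_) (h K hK _ (by positivity) ih)
      rw [pow_succ]; field_simp; ring
  obtain ⟨n, hn'⟩ := exists_nat_gt S0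
  refine mono _ _ ?_ (hn n)
  have : S0 / 2 ^ n ≤ 1 := by
    rw [div_le_one (by positivity)]
    refine hn'.le.trans ?_
    exact_mod_cast (Nat.lt_two_pow_self).le
  linarith

lemma up4 (H : Hyp d α δ) : ∃ C : ℝ, 0 < C ∧ ∀ K : ℝ, 0 ≤ K → ∀ q : Ed d → ENNReal, Adm d α δ K q → ∀ x y : Ed d, x ≠ 0 → y ≠ 0 →
    pq d α q 1 x y ≤ ENNReal.ofReal C * (HH d δ x * HH d δ y * pb d α (y - x)) := by
  obtain ⟨C, hC, h⟩ := up3 H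
  obtain ⟨R, C1, hR, hC1, h1⟩ := up1 H
  obtain ⟨c', C', hc', hC', h', -⟩ := kE_pb H
  have ha := H.a0
  have hd : (0:ℝ) ≤ d := by positivity
  have key : ∀ a b D : ℝ, 0 < a → 0 < b → a ≤ D * b → 0 < D → b ^ (-((d:ℝ) + α)) ≤ D ^ ((d:ℝ) + α) * a ^ (-((d:ℝ) + α)) := by
    intro a b D ha' hb' hab hD'
    calc b ^ (-((d:ℝ) + α)) ≤ (a / D) ^ (-((d:ℝ) + α)) := by
          refine rpow_le_rpow_of_nonpos (by positivity) ?_ (by linarith)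
          rw [div_le_iff₀ hD']; linarith
      _ = _ := by rw [div_rpow ha'.le hD'.le, rpow_neg hD'.le]; field_simp
  set E1 := (1/R + 2) ^ ((d:ℝ) + α) with hE1
  set E2 := (1 + 2 * R) ^ ((d:ℝ) + α) with hE2
  have hE1p : 0 < E1 := by positivity
  have hE2p : 0 < E2 := by positivity
  refine ⟨2 * C' + C1 * E1 + C * E2, by positivity, fun K hK q hq => ?_⟩
  have half : ∀ x y : Ed d, x ≠ 0 → y ≠ 0 → ‖x‖ ≤ ‖y‖ → pq d α q 1 x y ≤ ENNReal.ofReal (2 * C' + C1 * E1 + C * E2) * (HH d δ x * HH d δ y * pb d α (y - x)) := by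
    intro x y hx hy hxy
    have hn := norm_sub_le y x
    have hyp : 0 < ‖y‖ := norm_pos_iff.2 hy
    have hyx := norm_nonneg (y - x)
    by_cases hyR : R ≤ ‖y‖
    · refine (h1 K hK q hq x y hx hyR).trans ?_
      have k1 : 2 * kE d α 1 x y ≤ ENNReal.ofReal (2 * C') * (HH d δ x * HH d δ y * pb d α (y - x)) := by
        rw [ENNReal.ofReal_mul (by norm_num), ENNReal.ofReal_ofNat, mul_assoc]
        refine mul_le_mul_right ((h' x y).2.trans ?_) _
        gcongr
        refine le_mul_of_one_le_left (by positivity) ?_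
        calc (1:ENNReal) = 1 * 1 := by simp
          _ ≤ _ := mul_le_mul' (one_le_HH x) (one_le_HH y)
      have k2 : ENNReal.ofReal (C1 * ‖y‖ ^ (-((d:ℝ) + α))) * HH d δ x ≤ ENNReal.ofReal (C1 * E1) * (HH d δ x * HH d δ y * pb d α (y - x)) := by
        calc _ ≤ ENNReal.ofReal (C1 * (E1 * (1 + ‖y - x‖) ^ (-((d:ℝ) + α)))) * HH d δ x := by
              gcongr
              refine key _ _ _ (by positivity) hyp ?_ (by positivity)
              have : 1 ≤ 1 / R * ‖y‖ := by rw [one_div, inv_mul_eq_div, le_div_iff₀ hR]; linarith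
              nlinarith
          _ = ENNReal.ofReal (C1 * E1) * (HH d δ x * 1 * pb d α (y - x)) := by
              rw [← mul_assoc, ENNReal.ofReal_mul (by positivity), pb]; ring
          _ ≤ _ := by gcongr; exact one_le_HH y
      refine (add_le_add k1 k2).trans ?_
      rw [← add_mul, ← ENNReal.ofReal_add (by positivity) (by positivity)]
      refine mul_le_mul_left (ENNReal.ofReal_le_ofReal ?_) _
      have : 0 < C * E2 := by positivity
      linarith
    · refine (h K hK q hq x y hx hy).trans ?_
      rw [not_le] at hyR
      have k : (1:ENNReal) ≤ ENNReal.ofReal E2 * pb d α (y - x) := by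
        rw [pb, ← ENNReal.ofReal_mul hE2p.le, ← ENNReal.ofReal_one]
        refine ENNReal.ofReal_le_ofReal ?_
        have := key (1 + ‖y - x‖) 1 (1 + 2 * R) (by positivity) one_pos (by linarith) (by positivity)
        rwa [one_rpow] at this
      calc ENNReal.ofReal C * (HH d δ x * HH d δ y) = ENNReal.ofReal C * (HH d δ x * HH d δ y * 1) := by simp
        _ ≤ ENNReal.ofReal C * (HH d δ x * HH d δ y * (ENNReal.ofReal E2 * pb d α (y - x))) := by gcongr
        _ = ENNReal.ofReal (C * E2) * (HH d δ x * HH d δ y * pb d α (y - x)) := by rw [ENNReal.ofReal_mul hC.le]; ring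
        _ ≤ _ := by
          refine mul_le_mul_left (ENNReal.ofReal_le_ofReal ?_) _
          have : 0 < C1 * E1 := by positivity
          linarith
  intro x y hx hy
  rcases le_total ‖x‖ ‖y‖ with hxy | hxy
  · exact half x y hx hy hxy
  · rw [pq_symm hq.m]
    refine (half y x hy hx hxy).trans (le_of_eq ?_)
    rw [mul_comm (HH d δ y), pb, pb, norm_sub_rev]

lemma upper (H : Hyp d α δ) : ∃ C : ℝ, 0 < C ∧ ∀ x y : Ed d, x ≠ 0 → y ≠ 0 →
    pq d α (qq d α δ) 1 x y ≤ ENNReal.ofReal C * (HH d δ x * HH d δ y * pb d α (y - x)) := by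
  obtain ⟨C, hC, h⟩ := up4 H
  refine ⟨C, hC, fun x y hx hy => ?_⟩
  refine pt_le_of_iSup volume (kE_MK d α) (qs := fun n z => min (qq d α δ z) (n : ENNReal)) (fun n => (qq_meas d α δ).min measurable_const) ?_ ?_ ?_
  · intro n m hnm z
    exact min_le_min le_rfl (by exact_mod_cast hnm)
  · intro z
    rw [← inf_iSup_eq, ENNReal.iSup_natCast]; simp
  · intro n
    refine h n (by positivity) _ ⟨(qq_meas d α δ).min measurable_const, fun z => min_le_left _ _, fun z => ?_⟩ x y hx hy
    simp

end Upper3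

section Scaled
variable {d : ℕ} [NeZero d] {α δ : ℝ}

abbrev pT (d : ℕ) (α δ : ℝ) : ℝ → Ed d → Ed d → ENNReal := pq d α (qq d α δ)

lemma HH_scale_le' (H : Hyp d α δ) {r ρ : ℝ} (hr : 0 < r) (hρ : 1 ≤ ρ) (hr1 : r ≤ ρ) (x : Ed d) : HH d δ (r⁻¹ • x) ≤ ENNReal.ofReal (ρ ^ δ) * HH d δ x := by
  unfold HH
  rw [hb_scale δ (by positivity), inv_rpow hr.le, rpow_neg hr.le, inv_inv, mul_add]
  refine add_le_add ?_ (mul_le_mul_left (ENNReal.ofReal_le_ofReal (rpow_le_rpow hr.le hr1 H.d0.le)) _)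
  rw [mul_one, ← ENNReal.ofReal_one]
  exact ENNReal.ofReal_le_ofReal (one_le_rpow hρ H.d0.le)

lemma rpow_cmp (H : Hyp d α δ) {a b D : ℝ} (ha' : 0 < a) (hb' : 0 < b) (hab : a ≤ D * b) (hD' : 0 < D) :
    b ^ (-((d:ℝ) + α)) ≤ D ^ ((d:ℝ) + α) * a ^ (-((d:ℝ) + α)) := by
  have hd : (0:ℝ) ≤ d := by positivity
  have ha := H.a0
  calc b ^ (-((d:ℝ) + α)) ≤ (a / D) ^ (-((d:ℝ) + α)) := by
        refine rpow_le_rpow_of_nonpos (by positivity) ?_ (by linarith)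
        rw [div_le_iff₀ hD']; linarith
    _ = _ := by rw [div_rpow ha'.le hD'.le, rpow_neg hD'.le]; field_simp

lemma pb_cmp (H : Hyp d α δ) {z w : Ed d} {D : ℝ} (hD : 0 < D) (h : 1 + ‖w‖ ≤ D * (1 + ‖z‖)) :
    pb d α z ≤ ENNReal.ofReal (D ^ ((d:ℝ) + α)) * pb d α w := by
  rw [pb, pb, ← ENNReal.ofReal_mul (by positivity)]
  exact ENNReal.ofReal_le_ofReal (rpow_cmp H (by positivity) (by positivity) h hD)

lemma pT_scale (H : Hyp d α δ) {r : ℝ} (hr : 0 < r) (t : ℝ) (x y : Ed d) :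
    pT d α δ (r ^ α * t) (r • x) (r • y) = ENNReal.ofReal (r ^ (-(d:ℝ))) * pT d α δ t x y := by
  have := pt_scale d H.a0 hr (qq_meas d α δ) t x y
  rw [pT, pq, this]
  congr 3
  funext z
  exact qq_scale H hr z

lemma up_r (H : Hyp d α δ) : ∃ C : ℝ, 0 < C ∧ ∀ r : ℝ, 0 < r → r ^ α ≤ 4 → ∀ x y : Ed d, x ≠ 0 → y ≠ 0 →
    pT d α δ (r ^ α) x y ≤ ENNReal.ofReal C * (HH d δ x * HH d δ y) * (ENNReal.ofReal (r ^ (-(d:ℝ))) * pb d α (r⁻¹ • (y - x))) := by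
  obtain ⟨C, hC, h⟩ := upper H
  have ha := H.a0
  set ρ := (4:ℝ) ^ (1/α) with hρ
  have hρ1 : 1 ≤ ρ := one_le_rpow (by norm_num) (by positivity)
  refine ⟨C * ρ ^ δ * ρ ^ δ, by positivity, fun r hr hr4 x y hx hy => ?_⟩
  have hrρ : r ≤ ρ := by
    have := rpow_le_rpow (by positivity) hr4 (show 0 ≤ 1/α by positivity)
    rwa [← rpow_mul hr.le, mul_one_div_cancel ha.ne', rpow_one] at this
  have e := pT_scale H hr 1 (r⁻¹ • x) (r⁻¹ • y)
  rw [smul_smul, smul_smul, mul_inv_cancel₀ hr.ne', one_smul, one_smul, mul_one] at e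
  rw [e]
  have b := h (r⁻¹ • x) (r⁻¹ • y) (by simp [hx, hr.ne']) (by simp [hy, hr.ne'])
  rw [← smul_sub] at b
  calc _ ≤ ENNReal.ofReal (r ^ (-(d:ℝ))) * (ENNReal.ofReal C * ((ENNReal.ofReal (ρ ^ δ) * HH d δ x) * (ENNReal.ofReal (ρ ^ δ) * HH d δ y) * pb d α (r⁻¹ • (y - x)))) :=
        mul_le_mul_right (b.trans (mul_le_mul_right (mul_le_mul_left (mul_le_mul' (HH_scale_le' H hr hρ1 hrρ x) (HH_scale_le' H hr hρ1 hrρ y)) _) _)) _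
    _ = _ := by
        rw [ENNReal.ofReal_mul (p := C * ρ ^ δ) (by positivity), ENNReal.ofReal_mul (p := C) (by positivity)]; ring

lemma up_far (H : Hyp d α δ) : ∃ C : ℝ, 0 < C ∧ ∀ t : ℝ, 0 < t → t ≤ 4 → ∀ x y : Ed d, x ≠ 0 → y ≠ 0 → x ≠ y →
    pT d α δ t x y ≤ ENNReal.ofReal (C * ‖y - x‖ ^ (-((d:ℝ) + α))) * (HH d δ x * HH d δ y) := by
  obtain ⟨C, hC, h⟩ := up_r H
  have ha := H.a0
  refine ⟨C * 4, by positivity, fun t ht ht4 x y hx hy hxy => ?_⟩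
  set r := t ^ (1/α) with hr
  have hr0 : 0 < r := by positivity
  have hrα : r ^ α = t := by rw [hr, ← rpow_mul ht.le, one_div, inv_mul_cancel₀ ha.ne', rpow_one]
  have hw : 0 < ‖y - x‖ := norm_pos_iff.2 (sub_ne_zero.2 (Ne.symm hxy))
  have b := h r hr0 (by rw [hrα]; exact ht4) x y hx hy
  rw [hrα] at b
  refine b.trans ?_
  rw [mul_assoc C, ENNReal.ofReal_mul hC.le, mul_right_comm]
  refine mul_le_mul_left (mul_le_mul_right ?_ _) _
  rw [pb, ← ENNReal.ofReal_mul (by positivity)]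
  refine ENNReal.ofReal_le_ofReal ?_
  rw [norm_smul, Real.norm_eq_abs, abs_of_pos (inv_pos.2 hr0)]
  have hd : (0:ℝ) ≤ d := by positivity
  calc r ^ (-(d:ℝ)) * (1 + r⁻¹ * ‖y - x‖) ^ (-((d:ℝ) + α)) ≤ r ^ (-(d:ℝ)) * (r⁻¹ * ‖y - x‖) ^ (-((d:ℝ) + α)) := by
        refine mul_le_mul_of_nonneg_left (rpow_le_rpow_of_nonpos (by positivity) (by linarith) (by linarith)) (by positivity)
    _ = r ^ α * ‖y - x‖ ^ (-((d:ℝ) + α)) := by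
        rw [mul_rpow (by positivity) hw.le, inv_rpow hr0.le, ← rpow_neg hr0.le, ← mul_assoc, ← rpow_add hr0]
        congr 2; ring
    _ ≤ _ := by rw [hrα]; gcongr

lemma up_big (H : Hyp d α δ) : ∃ C : ℝ, 0 < C ∧ ∀ t : ℝ, 1 ≤ t → t ≤ 4 → ∀ x y : Ed d, x ≠ 0 → y ≠ 0 →
    pT d α δ t x y ≤ ENNReal.ofReal C * (HH d δ x * HH d δ y * pb d α (y - x)) := by
  obtain ⟨C, hC, h⟩ := up_r H
  have ha := H.a0
  have hd : (0:ℝ) ≤ d := by positivity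
  set ρ := (4:ℝ) ^ (1/α) with hρ
  have hρ0 : 0 < ρ := by positivity
  refine ⟨C * ρ ^ ((d:ℝ) + α), by positivity, fun t ht ht4 x y hx hy => ?_⟩
  have ht0 : 0 < t := by linarith
  set r := t ^ (1/α) with hr
  have hr0 : 0 < r := by positivity
  have hrα : r ^ α = t := by rw [hr, ← rpow_mul ht0.le, one_div, inv_mul_cancel₀ ha.ne', rpow_one]
  have hr1 : 1 ≤ r := one_le_rpow ht (by positivity)
  have hrρ : r ≤ ρ := rpow_le_rpow ht0.le ht4 (by positivity)
  have b := h r hr0 (by rw [hrα]; exact ht4) x y hx hy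
  rw [hrα] at b
  refine b.trans ?_
  have e : ENNReal.ofReal (C * ρ ^ ((d:ℝ) + α)) * (HH d δ x * HH d δ y * pb d α (y - x)) =
      ENNReal.ofReal C * (HH d δ x * HH d δ y) * (ENNReal.ofReal (ρ ^ ((d:ℝ) + α)) * pb d α (y - x)) := by
    rw [ENNReal.ofReal_mul hC.le]; ring
  rw [e]
  refine mul_le_mul_right ?_ _
  calc _ ≤ 1 * pb d α (r⁻¹ • (y - x)) := by
        refine mul_le_mul_left ?_ _
        rw [← ENNReal.ofReal_one]
        exact ENNReal.ofReal_le_ofReal (rpow_le_one_of_one_le_of_nonpos hr1 (by linarith))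
    _ ≤ _ := by
        rw [one_mul]
        refine pb_cmp H hρ0 ?_
        rw [norm_smul, Real.norm_eq_abs, abs_of_pos (inv_pos.2 hr0)]
        have h1 : ‖y - x‖ ≤ ρ * (r⁻¹ * ‖y - x‖) := by
          rw [← mul_assoc]
          refine le_mul_of_one_le_left (norm_nonneg _) ?_
          rw [← div_eq_mul_inv, le_div_iff₀ hr0]; linarith
        nlinarith

end Scaled

section Lower
variable {d : ℕ} [NeZero d] {α δ : ℝ}

lemma pT_meas (t : ℝ) (x : Ed d) : Measurable fun z => pT d α δ t x z :=
  (pq_MK (qq_meas d α δ)).comp measurable_const measurable_const measurable_id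

lemma hb_mul (β γ : ℝ) {z : Ed d} (hz : z ≠ 0) : hb d β z * hb d γ z = hb d (β + γ) z := by
  have hz' : 0 < ‖z‖ := norm_pos_iff.2 hz
  rw [hb, hb, hb, ← ENNReal.ofReal_mul (by positivity), ← rpow_add hz']
  congr 2; ring

lemma hb_anti {β : ℝ} (hβ : 0 ≤ β) {z : Ed d} {R : ℝ} (hR : 0 < R) (h : R ≤ ‖z‖) : hb d β z ≤ ENNReal.ofReal (R ^ (-β)) :=
  ENNReal.ofReal_le_ofReal (rpow_le_rpow_of_nonpos hR h (by linarith))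

lemma hb_exp_mono {β γ : ℝ} (hβ : β ≤ γ) {z : Ed d} (hz : z ≠ 0) (h : ‖z‖ ≤ 1) : hb d β z ≤ hb d γ z :=
  ENNReal.ofReal_le_ofReal (rpow_le_rpow_of_exponent_ge (norm_pos_iff.2 hz) h (by linarith))

lemma hb_int_lt {γ : ℝ} (hγ : γ < d) {R : ℝ} (hR : 0 < R) : ∫⁻ z in Metric.ball (0 : Ed d) R, hb d γ z < ⊤ := by
  rw [rb_scale d hR]
  exact ENNReal.mul_lt_top ENNReal.ofReal_lt_top (rb_lt_top d hγ)

lemma fin_beta (H : Hyp d α δ) {β : ℝ} (hβ : 0 < β) (hβδ : β < δ) {x : Ed d} (hx : x ≠ 0) :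
    ∫⁻ s in Ioo (0:ℝ) 1, act volume (pT d α δ) (fun z => qq d α δ z * hb d β z) s x ≠ ⊤ := by
  obtain ⟨C, hC, h⟩ := up_far H
  obtain ⟨M, hM, hI⟩ := int_bound H
  have hx' : 0 < ‖x‖ := norm_pos_iff.2 hx
  have hκ := kappa_pos d H.a0 H.d0 H.dd
  have h2 := H.d2
  have hδ := H.d0
  have ha := H.a0
  have hd : (0:ℝ) ≤ d := by positivity
  set r := ‖x‖ / 2 with hr
  have hr0 : 0 < r := by positivity
  set κ := ENNReal.ofReal (kappa d α δ) with hκ'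
  set B := ENNReal.ofReal (C * r ^ (-((d:ℝ) + α))) * HH d δ x with hB
  have hHx : HH d δ x < ⊤ := by simp [HH, hb]
  have hBt : B < ⊤ := ENNReal.mul_lt_top ENNReal.ofReal_lt_top hHx
  set F : Ed d → ENNReal := fun z => B * ((Metric.ball (0 : Ed d) r).indicator (fun z => hb d (α + β) z + hb d (α + β + δ) z) z) with hF
  have hFm : Measurable F := (((hb_meas d _).add (hb_meas d _)).indicator measurableSet_ball).const_mul _
  have hFi : ∫⁻ z, F z < ⊤ := by
    simp only [hF]
    rw [lintegral_const_mul' _ _ hBt.ne, lintegral_indicator measurableSet_ball]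
    refine ENNReal.mul_lt_top hBt ?_
    have : ∫⁻ z in Metric.ball (0 : Ed d) r, hb d (α + β) z + hb d (α + β + δ) z = (∫⁻ z in Metric.ball (0 : Ed d) r, hb d (α + β) z) + ∫⁻ z in Metric.ball (0 : Ed d) r, hb d (α + β + δ) z :=
      lintegral_add_left (hb_meas d _) _
    rw [this]
    exact ENNReal.add_lt_top.2 ⟨hb_int_lt (by linarith) hr0, hb_int_lt (by linarith) hr0⟩
  have pw : ∀ s ∈ Ioo (0:ℝ) 1, ∀ z : Ed d, z ≠ 0 → pT d α δ s x z * (qq d α δ z * hb d β z) ≤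
      κ * (F z + ENNReal.ofReal (r ^ (-β)) * (pT d α δ s x z * hb d α z)) := by
    intro s hs z hz
    have e : qq d α δ z = κ * hb d α z := by rw [qq, ENNReal.ofReal_mul hκ.le]; rfl
    by_cases hzr : ‖z‖ < r
    · have hFz : F z = B * (hb d (α + β) z + hb d (α + β + δ) z) := by
        simp [hF, indicator, hzr]
      have hne : x ≠ z := by rintro rfl; linarith
      have hxz : r ≤ ‖z - x‖ := by
        have := norm_sub_norm_le x z
        rw [norm_sub_rev] at this; linarith
      have b : pT d α δ s x z ≤ B * HH d δ z := by
        refine (h s hs.1 (by linarith [hs.2]) x z hx hz hne).trans ?_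
        rw [hB, mul_assoc]
        refine mul_le_mul_left (ENNReal.ofReal_le_ofReal (mul_le_mul_of_nonneg_left ?_ hC.le)) _
        exact rpow_le_rpow_of_nonpos hr0 hxz (by linarith)
      calc _ ≤ (B * HH d δ z) * (κ * hb d α z * hb d β z) := by rw [e]; exact mul_le_mul_left b _
        _ = κ * (B * (hb d α z * hb d β z + hb d α z * hb d β z * hb d δ z)) := by rw [HH]; ring
        _ = κ * F z := by rw [hFz, hb_mul _ _ hz, hb_mul _ _ hz]
        _ ≤ _ := mul_le_mul_right le_self_add _
    · rw [not_lt] at hzr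
      calc _ = κ * (hb d β z * (pT d α δ s x z * hb d α z)) := by rw [e]; ring
        _ ≤ κ * (ENNReal.ofReal (r ^ (-β)) * (pT d α δ s x z * hb d α z)) :=
            mul_le_mul_right (mul_le_mul_left (hb_anti hβ.le hr0 hzr) _) _
        _ ≤ _ := mul_le_mul_right le_add_self _
  refine ne_top_of_le_ne_top (b := κ * ((∫⁻ z, F z) + ENNReal.ofReal (r ^ (-β)) * (ENNReal.ofReal M * HH d δ x))) ?_ ?_
  · refine ENNReal.mul_ne_top ENNReal.ofReal_ne_top (ENNReal.add_ne_top.2 ⟨hFi.ne, ?_⟩)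
    exact ENNReal.mul_ne_top ENNReal.ofReal_ne_top (ENNReal.mul_ne_top ENNReal.ofReal_ne_top hHx.ne)
  · calc _ ≤ ∫⁻ s in Ioo (0:ℝ) 1, (κ * ((∫⁻ z, F z) + ENNReal.ofReal (r ^ (-β)) * ∫⁻ z, pT d α δ s x z * hb d α z)) := by
          refine setLIntegral_mono' measurableSet_Ioo fun s hs => ?_
          rw [act]
          calc _ ≤ ∫⁻ z, κ * (F z + ENNReal.ofReal (r ^ (-β)) * (pT d α δ s x z * hb d α z)) := by
                refine lintegral_mono_ae ?_
                filter_upwards [ae_ne0 d] with z hz using pw s hs z hz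
            _ = _ := by
                rw [lintegral_const_mul' _ _ ENNReal.ofReal_ne_top, lintegral_add_left hFm, lintegral_const_mul' _ _ ENNReal.ofReal_ne_top]
      _ = κ * ((∫⁻ z, F z) + ENNReal.ofReal (r ^ (-β)) * ∫⁻ s in Ioo (0:ℝ) 1, (∫⁻ z, pT d α δ s x z * hb d α z)) := by
          rw [lintegral_const_mul' _ _ ENNReal.ofReal_ne_top, lintegral_add_left measurable_const, lintegral_const_mul' _ _ ENNReal.ofReal_ne_top]
          rw [setLIntegral_const, Real.volume_Ioo, sub_zero, ENNReal.ofReal_one, mul_one]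
      _ ≤ _ := mul_le_mul_right (add_le_add le_rfl (mul_le_mul_right (hI 1 one_pos (by norm_num) x hx).2 _)) _

lemma sub_beta (H : Hyp d α δ) {β : ℝ} (hβ : 0 < β) (hβδ : β < δ) {x : Ed d} (hx : x ≠ 0) :
    hb d β x ≤ ∫⁻ z, pT d α δ 1 x z * hb d β z := by
  have h2 := H.d2
  refine sub_sol volume (kE_MK d α) (qq_meas d α δ) (kE_zero d α) (hb_meas d β) (P := fun x => x ≠ 0) (ae_ne0 d) ?_ one_pos hx (fin_beta H hβ hβδ hx)
  intro t ht x hx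
  rw [← hb_eq d H.a0 H.a2 hβ (by linarith [H.dd]) ht hx]
  refine add_le_add le_rfl (lintegral_mono fun s => act_mono volume (ae_of_all _ fun z => mul_le_mul_left ?_ _) _ _)
  rw [qq, qq]
  exact ENNReal.ofReal_le_ofReal (mul_le_mul_of_nonneg_right (kappa_mono d H.a0 hβ hβδ.le h2) (by positivity))

end Lower

section Lower2
variable {d : ℕ} [NeZero d] {α δ : ℝ}

lemma HH_le_two (H : Hyp d α δ) {z : Ed d} (hz : z ≠ 0) (h : ‖z‖ ≤ 1) : HH d δ z ≤ 2 * hb d δ z := by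
  have : hb d 0 z ≤ hb d δ z := hb_exp_mono H.d0.le hz h
  have e : hb d 0 z = 1 := by simp [hb]
  rw [e] at this
  rw [HH, two_mul]
  exact add_le_add this le_rfl

lemma HH_le_two' (H : Hyp d α δ) {z : Ed d} (h : 1 ≤ ‖z‖) : HH d δ z ≤ 2 := by
  have := hb_anti (β := δ) H.d0.le one_pos h
  rw [one_rpow, ENNReal.ofReal_one] at this
  rw [HH, ← one_add_one_eq_two]
  exact add_le_add le_rfl this

lemma low1 (H : Hyp d α δ) : ∃ R c : ℝ, 0 < R ∧ 0 < c ∧ ∀ x : Ed d, x ≠ 0 → ‖x‖ ≤ 1 →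
    ENNReal.ofReal c * HH d δ x ≤ ∫⁻ z in Metric.closedBall (0 : Ed d) R, pT d α δ 1 x z := by
  obtain ⟨C, hC, hU⟩ := up_big H
  obtain ⟨M, hM, hI⟩ := int_bound H
  have h2 := H.d2
  have hδ := H.d0
  have ha := H.a0
  have hd2 : 2 * δ < d := by linarith
  set b0 := (rb d (2 * δ)).toReal with hb0
  have hb00 : 0 ≤ b0 := ENNReal.toReal_nonneg
  have hrb : rb d (2 * δ) = ENNReal.ofReal b0 := (ENNReal.ofReal_toReal (rb_lt_top d hd2).ne).symm
  clear_value b0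
  obtain ⟨ε, hε, hε1, hεs⟩ := exists_small_rpow (p := d - 2 * δ) (ε := 1 / (16 * C * (b0 + 1))) (by linarith) (by positivity)
  obtain ⟨ρ, hρ, hρ1, hρs⟩ := exists_small_rpow (p := δ / 2) (ε := 1 / (8 * M)) (by linarith) (by positivity)
  have hR1 : 1 ≤ ρ⁻¹ := (one_le_inv₀ hρ).2 hρ1
  refine ⟨ρ⁻¹, ε ^ δ / 4, by positivity, by positivity, fun x hx hx1 => ?_⟩
  set I := ∫⁻ z in Metric.closedBall (0 : Ed d) ρ⁻¹, pT d α δ 1 x z with hIdef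
  have main : ∀ β ∈ Ioo (δ/2) δ, hb d β x ≤ ENNReal.ofReal (1/4) * HH d δ x + ENNReal.ofReal (ε ^ (-δ)) * I := by
    intro β hβ
    have pw : ∀ z : Ed d, z ≠ 0 → pT d α δ 1 x z * hb d β z ≤
        ENNReal.ofReal (2 * C) * HH d δ x * (Metric.ball (0 : Ed d) ε).indicator (hb d (2 * δ)) z
        + (ENNReal.ofReal (ρ ^ (δ/2)) * pT d α δ 1 x z + ENNReal.ofReal (ε ^ (-δ)) * (Metric.closedBall (0 : Ed d) ρ⁻¹).indicator (fun z => pT d α δ 1 x z) z) := by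
      intro z hz
      by_cases c1 : ‖z‖ < ε
      · refine le_trans ?_ le_self_add
        rw [indicator_of_mem (by simpa using c1)]
        have hz1 : ‖z‖ ≤ 1 := by linarith
        calc _ ≤ (ENNReal.ofReal C * (HH d δ x * (2 * hb d δ z) * 1)) * hb d δ z := by
              refine mul_le_mul' ((hU 1 le_rfl (by norm_num) x z hx hz).trans ?_) (hb_exp_mono hβ.2.le hz hz1)
              exact mul_le_mul_right (mul_le_mul' (mul_le_mul_right (HH_le_two H hz hz1) _) (pb_le_one H _)) _
          _ = 2 * ENNReal.ofReal C * HH d δ x * (hb d δ z * hb d δ z) := by ring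
          _ = _ := by rw [hb_mul _ _ hz, ← two_mul, ENNReal.ofReal_mul (by norm_num), ENNReal.ofReal_ofNat]
      · refine le_trans ?_ le_add_self
        rw [not_lt] at c1
        by_cases c2 : ‖z‖ ≤ ρ⁻¹
        · refine le_trans ?_ le_add_self
          rw [indicator_of_mem (by simpa using c2), mul_comm]
          refine mul_le_mul_left ((hb_anti (by linarith [hβ.1]) hε c1).trans (ENNReal.ofReal_le_ofReal ?_)) _
          exact rpow_le_rpow_of_exponent_ge hε hε1 (by linarith [hβ.2])
        · refine le_trans ?_ le_self_add
          rw [not_le] at c2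
          rw [mul_comm]
          refine mul_le_mul_left ((hb_anti (by linarith [hβ.1]) (by positivity) c2.le).trans (ENNReal.ofReal_le_ofReal ?_)) _
          rw [inv_rpow hρ.le, rpow_neg hρ.le, inv_inv]
          exact rpow_le_rpow_of_exponent_ge hρ hρ1 hβ.1.le
    have hHt : ENNReal.ofReal (2 * C) * HH d δ x ≠ ⊤ := ENNReal.mul_ne_top ENNReal.ofReal_ne_top (by simp [HH, hb])
    calc hb d β x ≤ _ := sub_beta H (by linarith [hβ.1]) hβ.2 hx
      _ ≤ _ := lintegral_mono_ae (by filter_upwards [ae_ne0 d] with z hz using pw z hz)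
      _ = ENNReal.ofReal (2 * C) * HH d δ x * (ENNReal.ofReal (ε ^ (d - 2 * δ)) * ENNReal.ofReal b0) + (ENNReal.ofReal (ρ ^ (δ/2)) * (∫⁻ z, pT d α δ 1 x z) + ENNReal.ofReal (ε ^ (-δ)) * I) := by
          rw [lintegral_add_left (((hb_meas d _).indicator measurableSet_ball).const_mul _), lintegral_add_left ((pT_meas 1 x).const_mul _),
            lintegral_const_mul' _ _ hHt, lintegral_const_mul' _ _ ENNReal.ofReal_ne_top, lintegral_const_mul' _ _ ENNReal.ofReal_ne_top,
            lintegral_indicator measurableSet_ball, lintegral_indicator Metric.isClosed_closedBall.measurableSet, rb_scale d hε, hrb]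
      _ ≤ ENNReal.ofReal (1/8) * HH d δ x + (ENNReal.ofReal (1/8) * HH d δ x + ENNReal.ofReal (ε ^ (-δ)) * I) := by
          refine add_le_add ?_ (add_le_add ?_ le_rfl)
          · rw [mul_right_comm, ← ENNReal.ofReal_mul (by positivity), ← ENNReal.ofReal_mul (by positivity)]
            refine mul_le_mul_left (ENNReal.ofReal_le_ofReal ?_) _
            have : ε ^ (d - 2 * δ) * b0 ≤ 1 / (16 * C * (b0 + 1)) * (b0 + 1) := mul_le_mul hεs (by linarith) hb00 (by positivity)
            have e : 1 / (16 * C * (b0 + 1)) * (b0 + 1) = 1 / (16 * C) := by field_simp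
            rw [e] at this
            calc _ ≤ 2 * C * (1 / (16 * C)) := by gcongr
              _ = _ := by field_simp; norm_num
          · refine (mul_le_mul_right (hI 1 one_pos (by norm_num) x hx).1 _).trans ?_
            rw [← mul_assoc, ← ENNReal.ofReal_mul (by positivity)]
            refine mul_le_mul_left (ENNReal.ofReal_le_ofReal ?_) _
            calc _ ≤ 1 / (8 * M) * M := by gcongr
              _ = _ := by field_simp
      _ = _ := by
          rw [← add_assoc, ← add_mul, ← ENNReal.ofReal_add (by norm_num) (by norm_num)]; norm_num
  have lim : hb d δ x ≤ ENNReal.ofReal (1/4) * HH d δ x + ENNReal.ofReal (ε ^ (-δ)) * I := by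
    have hx' : 0 < ‖x‖ := norm_pos_iff.2 hx
    have ct : Continuous fun β : ℝ => hb d β x := by
      unfold hb
      exact ENNReal.continuous_ofReal.comp (Continuous.rpow continuous_const continuous_neg (fun _ => Or.inl hx'.ne'))
    have tt : Tendsto (fun β : ℝ => hb d β x) (nhdsWithin δ (Iio δ)) (nhds (hb d δ x)) := ct.continuousAt.tendsto.mono_left nhdsWithin_le_nhds
    refine le_of_tendsto tt ?_
    filter_upwards [Ioo_mem_nhdsLT (show δ/2 < δ by linarith)] with β hβ using main β hβ
  have key : ENNReal.ofReal (1/4) * HH d δ x ≤ ENNReal.ofReal (ε ^ (-δ)) * I := by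
    have l2 : hb d δ x ≤ ENNReal.ofReal (1/2) * hb d δ x + ENNReal.ofReal (ε ^ (-δ)) * I := by
      refine lim.trans (add_le_add ?_ le_rfl)
      refine (mul_le_mul_right (HH_le_two H hx hx1) _).trans (le_of_eq ?_)
      rw [← mul_assoc, ← ENNReal.ofReal_ofNat, ← ENNReal.ofReal_mul (by norm_num)]; norm_num
    have l3 : ENNReal.ofReal (1/2) * hb d δ x + ENNReal.ofReal (1/2) * hb d δ x = hb d δ x := by
      rw [← add_mul, ← ENNReal.ofReal_add (by norm_num) (by norm_num)]; norm_num
    have l4 := (ENNReal.add_le_add_iff_left (ENNReal.mul_ne_top ENNReal.ofReal_ne_top (by simp [hb]))).1 (l3.le.trans l2)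
    refine le_trans ?_ l4
    refine (mul_le_mul_right (HH_le_two H hx hx1) _).trans (le_of_eq ?_)
    rw [← mul_assoc, ← ENNReal.ofReal_ofNat, ← ENNReal.ofReal_mul (by norm_num)]; norm_num
  calc ENNReal.ofReal (ε ^ δ / 4) * HH d δ x = ENNReal.ofReal (ε ^ δ) * (ENNReal.ofReal (1/4) * HH d δ x) := by
        rw [← mul_assoc, ← ENNReal.ofReal_mul (by positivity)]; congr 2; ring
    _ ≤ ENNReal.ofReal (ε ^ δ) * (ENNReal.ofReal (ε ^ (-δ)) * I) := mul_le_mul_right key _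
    _ = I := by
        rw [← mul_assoc, ← ENNReal.ofReal_mul (by positivity), ← rpow_add hε]; simp

end Lower2

section Lower3
variable {d : ℕ} [NeZero d] {α δ : ℝ}

lemma pb_neg (x y : Ed d) : pb d α (x - y) = pb d α (y - x) := by rw [pb, pb, norm_sub_rev]

lemma low2 (H : Hyp d α δ) : ∃ R c : ℝ, 0 < R ∧ 0 < c ∧ ∀ y : Ed d, y ≠ 0 →
    ENNReal.ofReal c * HH d δ y ≤ ∫⁻ z in Metric.closedBall y R, pT d α δ 1 y z := by
  obtain ⟨R, c, hR, hc, h⟩ := low1 H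
  obtain ⟨c', C', hc', hC', h', -⟩ := kE_pb H
  have hv := vol_ball_pos d
  set v := volume.real (Metric.ball (0 : Ed d) 1) with hvd
  have ha := H.a0
  have hd : (0:ℝ) ≤ d := by positivity
  set E := (2:ℝ) ^ (-((d:ℝ) + α)) with hE
  have hE0 : 0 < E := by positivity
  refine ⟨R + 1, min c (c' * E * v / 2), by positivity, by positivity, fun y hy => ?_⟩
  by_cases hy1 : ‖y‖ ≤ 1
  · calc _ ≤ ENNReal.ofReal c * HH d δ y := mul_le_mul_left (ENNReal.ofReal_le_ofReal (min_le_left _ _)) _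
      _ ≤ _ := h y hy hy1
      _ ≤ _ := by
        refine lintegral_mono_set fun z hz => ?_
        rw [mem_closedBall_zero_iff] at hz
        rw [mem_closedBall_iff_norm]
        have := norm_sub_le z y
        linarith
  · rw [not_le] at hy1
    calc _ ≤ ENNReal.ofReal (c' * E * v / 2) * 2 := mul_le_mul' (ENNReal.ofReal_le_ofReal (min_le_right _ _)) (HH_le_two' H hy1.le)
      _ = ENNReal.ofReal (c' * E) * volume (Metric.ball y 1) := by
        have e2 : ENNReal.ofReal (c' * E * v / 2) * 2 = ENNReal.ofReal (c' * E) * ENNReal.ofReal v := by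
          have : (2:ENNReal) = ENNReal.ofReal 2 := by simp
          clear_value v
          rw [this, ← ENNReal.ofReal_mul (by positivity), div_mul_cancel₀ _ (by norm_num), ENNReal.ofReal_mul (by positivity)]
        rw [e2, hvd, ofReal_measureReal, Measure.addHaar_ball_center volume y 1]
      _ = ∫⁻ z in Metric.ball y 1, ENNReal.ofReal (c' * E) := by rw [setLIntegral_const]
      _ ≤ ∫⁻ z in Metric.ball y 1, pT d α δ 1 y z := by
        refine setLIntegral_mono' measurableSet_ball fun z hz => ?_
        rw [mem_ball_iff_norm] at hz
        refine le_trans ?_ (k_le_pt volume _ _ _)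
        refine le_trans ?_ (h' y z).1
        rw [ENNReal.ofReal_mul hc'.le, pb]
        refine mul_le_mul_right (ENNReal.ofReal_le_ofReal ?_) _
        exact rpow_le_rpow_of_nonpos (by positivity) (by linarith) (by linarith)
      _ ≤ _ := lintegral_mono_set (Metric.ball_subset_closedBall.trans (Metric.closedBall_subset_closedBall (by linarith)))

lemma low3 (H : Hyp d α δ) : ∃ c : ℝ, 0 < c ∧ ∀ y : Ed d, y ≠ 0 → ∀ x : Ed d,
    ENNReal.ofReal c * (HH d δ y * pb d α (y - x)) ≤ ∫⁻ z, pT d α δ 1 y z * pb d α (z - x) := by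
  obtain ⟨R, c, hR, hc, h⟩ := low2 H
  set D := (1 + R) ^ ((d:ℝ) + α) with hD
  have hD0 : 0 < D := by positivity
  refine ⟨D⁻¹ * c, by positivity, fun y hy x => ?_⟩
  calc _ = (ENNReal.ofReal D⁻¹ * pb d α (y - x)) * (ENNReal.ofReal c * HH d δ y) := by
        rw [ENNReal.ofReal_mul (by positivity)]; ring
    _ ≤ (ENNReal.ofReal D⁻¹ * pb d α (y - x)) * ∫⁻ z in Metric.closedBall y R, pT d α δ 1 y z := mul_le_mul_right (h y hy) _
    _ = ∫⁻ z in Metric.closedBall y R, (ENNReal.ofReal D⁻¹ * pb d α (y - x)) * pT d α δ 1 y z := by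
        rw [lintegral_const_mul' _ _ (ENNReal.mul_ne_top ENNReal.ofReal_ne_top (by simp [pb]))]
    _ ≤ ∫⁻ z in Metric.closedBall y R, pT d α δ 1 y z * pb d α (z - x) := by
        refine setLIntegral_mono' Metric.isClosed_closedBall.measurableSet fun z hz => ?_
        rw [mem_closedBall_iff_norm] at hz
        rw [mul_comm]
        refine mul_le_mul_right ?_ _
        have b : pb d α (y - x) ≤ ENNReal.ofReal D * pb d α (z - x) := by
          refine pb_cmp H (by positivity) ?_
          have : ‖z - x‖ ≤ ‖z - y‖ + ‖y - x‖ := norm_sub_le_norm_sub_add_norm_sub _ _ _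
          nlinarith [norm_nonneg (y - x)]
        calc _ ≤ ENNReal.ofReal D⁻¹ * (ENNReal.ofReal D * pb d α (z - x)) := mul_le_mul_right b _
          _ = _ := by rw [← mul_assoc, ← ENNReal.ofReal_mul (by positivity), inv_mul_cancel₀ hD0.ne']; simp
    _ ≤ _ := setLIntegral_le_lintegral _ _

lemma lower (H : Hyp d α δ) : ∃ c : ℝ, 0 < c ∧ ∀ x y : Ed d, x ≠ 0 → y ≠ 0 →
    ENNReal.ofReal c * (HH d δ x * HH d δ y * pb d α (y - x)) ≤ pT d α δ 3 x y := by
  obtain ⟨c, hc, h⟩ := low3 H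
  obtain ⟨c', C', hc', hC', h', -⟩ := kE_pb H
  have two : ∀ x y : Ed d, x ≠ 0 → ENNReal.ofReal (c' * c) * (HH d δ x * pb d α (x - y)) ≤ pT d α δ 2 x y := by
    intro x y hx
    have e := pq_CK H (qq_meas d α δ) 1 1 one_pos one_pos x y
    rw [one_add_one_eq_two] at e
    rw [pT, ← e, ENNReal.ofReal_mul hc'.le, mul_assoc]
    refine (mul_le_mul_right (h x hx y) _).trans ?_
    rw [← lintegral_const_mul' _ _ ENNReal.ofReal_ne_top]
    refine lintegral_mono fun z => ?_
    rw [mul_left_comm]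
    refine mul_le_mul_right (le_trans ?_ (k_le_pt volume _ _ _)) _
    rw [pb_neg]
    exact (h' z y).1
  refine ⟨c' * c * c, by positivity, fun x y hx hy => ?_⟩
  have e := pq_CK H (qq_meas d α δ) 2 1 two_pos one_pos x y
  rw [two_add_one_eq_three] at e
  rw [pT, ← e]
  calc _ = (ENNReal.ofReal (c' * c) * HH d δ x) * (ENNReal.ofReal c * (HH d δ y * pb d α (y - x))) := by
        rw [ENNReal.ofReal_mul (p := c' * c) (by positivity)]; ring
    _ ≤ (ENNReal.ofReal (c' * c) * HH d δ x) * ∫⁻ z, pT d α δ 1 y z * pb d α (z - x) := mul_le_mul_right (h y hy x) _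
    _ = ∫⁻ z, (ENNReal.ofReal (c' * c) * HH d δ x) * (pT d α δ 1 y z * pb d α (z - x)) := by
        rw [lintegral_const_mul' _ _ (ENNReal.mul_ne_top ENNReal.ofReal_ne_top (by simp [HH, hb]))]
    _ ≤ _ := by
        refine lintegral_mono fun z => ?_
        have t := two x z hx
        rw [pb_neg] at t
        calc _ = ENNReal.ofReal (c' * c) * (HH d δ x * pb d α (z - x)) * pT d α δ 1 y z := by ring
          _ ≤ pT d α δ 2 x z * pT d α δ 1 y z := mul_le_mul_left t _
          _ = _ := by rw [pT, pq_symm (qq_meas d α δ) 1 y z]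

end Lower3

section Final
variable {d : ℕ} [NeZero d] {α δ : ℝ}

/-- dominating weight -/
def WW (d : ℕ) (α : ℝ) (z : Ed d) : ENNReal := 1 + 2 * hb d α z

lemma WW_meas : Measurable (WW d α) := ((hb_meas d α).const_mul 2).const_add 1

lemma w_le (H : Hyp d α δ) {z : Ed d} (hz : z ≠ 0) : hb d (α - δ) z * HH d δ z ≤ WW d α z := by
  have hda := H.da
  rw [HH, mul_add, mul_one, hb_mul _ _ hz, sub_add_cancel, WW, two_mul, ← add_assoc]
  refine add_le_add ?_ le_rfl
  rcases le_total ‖z‖ 1 with h | h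
  · exact (hb_exp_mono (by linarith [H.d0]) hz h).trans le_add_self
  · refine le_trans ?_ le_self_add
    have := hb_anti (β := α - δ) (by linarith) one_pos h
    rwa [one_rpow, ENNReal.ofReal_one] at this

lemma pb_mass (H : Hyp d α δ) : ∃ C : ℝ, 0 < C ∧ ∀ y : Ed d, ∫⁻ z, pb d α (y - z) ≤ ENNReal.ofReal C := by
  obtain ⟨c', C', hc', hC', h', -⟩ := kE_pb H
  refine ⟨c'⁻¹, by positivity, fun y => ?_⟩
  calc _ ≤ ∫⁻ z, ENNReal.ofReal c'⁻¹ * kE d α 1 y z := by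
        refine lintegral_mono fun z => ?_
        refine le_trans (le_of_eq ?_) (mul_le_mul_right (h' y z).1 _)
        rw [← mul_assoc, ← ENNReal.ofReal_mul (by positivity), inv_mul_cancel₀ hc'.ne', pb_neg]; simp
    _ = _ := by rw [lintegral_const_mul' _ _ ENNReal.ofReal_ne_top, kE_mass d H.a0 H.a2 one_pos, mul_one]

lemma TT (H : Hyp d α δ) : ∃ C : ℝ, 0 < C ∧ ∀ y : Ed d, ∫⁻ z, HH d δ z * WW d α z * pb d α (y - z) ≤ ENNReal.ofReal C := by
  obtain ⟨C, hC, h⟩ := pb_mass H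
  have h2 := H.d2
  have hδ := H.d0
  have ha := H.a0
  have had := H.ad
  have hlt : α + δ < d := by linarith
  set b := (rb d (α + δ)).toReal with hb0
  have hb00 : 0 ≤ b := ENNReal.toReal_nonneg
  have hrb : rb d (α + δ) = ENNReal.ofReal b := (ENNReal.ofReal_toReal (rb_lt_top d hlt).ne).symm
  clear_value b
  refine ⟨6 * b + 6 * C, by positivity, fun y => ?_⟩
  have e6 : (6:ENNReal) = ENNReal.ofReal 6 := by simp
  have pw : ∀ z : Ed d, z ≠ 0 → HH d δ z * WW d α z * pb d α (y - z) ≤ 6 * (Metric.ball (0 : Ed d) 1).indicator (hb d (α + δ)) z + 6 * pb d α (y - z) := by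
    intro z hz
    by_cases hz1 : ‖z‖ < 1
    · refine le_trans ?_ le_self_add
      rw [indicator_of_mem (by simpa using hz1)]
      have w1 : WW d α z ≤ 3 * hb d α z := by
        have : hb d 0 z ≤ hb d α z := hb_exp_mono ha.le hz hz1.le
        have e : hb d 0 z = 1 := by simp [hb]
        rw [e] at this
        calc WW d α z ≤ hb d α z + 2 * hb d α z := add_le_add this le_rfl
          _ = _ := by ring
      calc _ ≤ (2 * hb d δ z) * (3 * hb d α z) * 1 := mul_le_mul' (mul_le_mul' (HH_le_two H hz hz1.le) w1) (pb_le_one H _)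
        _ = 6 * (hb d α z * hb d δ z) := by ring
        _ = _ := by rw [hb_mul _ _ hz]
    · refine le_trans ?_ le_add_self
      rw [not_lt] at hz1
      refine mul_le_mul_left ?_ _
      have w1 : WW d α z ≤ 3 := by
        have := hb_anti (β := α) ha.le one_pos hz1
        rw [one_rpow, ENNReal.ofReal_one] at this
        calc WW d α z ≤ 1 + 2 * 1 := add_le_add le_rfl (mul_le_mul_right this _)
          _ = _ := by norm_num
      calc _ ≤ (2:ENNReal) * 3 := mul_le_mul' (HH_le_two' H hz1) w1
        _ = 6 := by norm_num
  have n6 : (6:ENNReal) ≠ ⊤ := by simp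
  calc _ ≤ _ := lintegral_mono_ae (by filter_upwards [ae_ne0 d] with z hz using pw z hz)
    _ = 6 * ENNReal.ofReal b + 6 * ∫⁻ z, pb d α (y - z) := by
        rw [lintegral_add_left (((hb_meas d _).indicator measurableSet_ball).const_mul _), lintegral_const_mul' _ _ n6, lintegral_const_mul' _ _ n6,
          lintegral_indicator measurableSet_ball, ← hrb, rb]
    _ ≤ 6 * ENNReal.ofReal b + 6 * ENNReal.ofReal C := add_le_add le_rfl (mul_le_mul_right (h y) _)
    _ = _ := by rw [e6, ← ENNReal.ofReal_mul (by norm_num), ← ENNReal.ofReal_mul (by norm_num), ← ENNReal.ofReal_add (by positivity) (by positivity)]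

lemma WW_int (H : Hyp d α δ) : ∃ C : ℝ, 0 < C ∧ ∀ x : Ed d, x ≠ 0 →
    ∫⁻ s in Ioo (0:ℝ) 2, (∫⁻ z, pT d α δ s x z * WW d α z) ≤ ENNReal.ofReal C * HH d δ x := by
  obtain ⟨M, hM, hI⟩ := int_bound H
  refine ⟨4 * M, by positivity, fun x hx => ?_⟩
  have m2 : Measurable fun p : ℝ × Ed d => pT d α δ p.1 x p.2 := (pq_MK (qq_meas d α δ)).comp measurable_fst measurable_const measurable_snd
  have mm : Measurable fun s => ∫⁻ z, pT d α δ s x z * hb d α z :=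
    (m2.mul ((hb_meas d α).comp measurable_snd)).lintegral_prod_right'
  have n2 : (2:ENNReal) ≠ ⊤ := by simp
  calc _ ≤ ∫⁻ s in Ioo (0:ℝ) 2, (ENNReal.ofReal M * HH d δ x + 2 * ∫⁻ z, pT d α δ s x z * hb d α z) := by
        refine setLIntegral_mono' measurableSet_Ioo fun s hs => ?_
        have e : ∀ z, pT d α δ s x z * WW d α z = pT d α δ s x z + 2 * (pT d α δ s x z * hb d α z) := by
          intro z; rw [WW]; ring
        simp_rw [e]
        rw [lintegral_add_left (pT_meas s x), lintegral_const_mul' _ _ n2]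
        exact add_le_add (hI s hs.1 (by linarith [hs.2]) x hx).1 le_rfl
    _ = 2 * (ENNReal.ofReal M * HH d δ x) + 2 * ∫⁻ s in Ioo (0:ℝ) 2, (∫⁻ z, pT d α δ s x z * hb d α z) := by
        rw [lintegral_add_left measurable_const, lintegral_const_mul' _ _ n2, setLIntegral_const, Real.volume_Ioo, sub_zero, ENNReal.ofReal_ofNat, mul_comm (_ * _)]
    _ ≤ 2 * (ENNReal.ofReal M * HH d δ x) + 2 * (ENNReal.ofReal M * HH d δ x) :=
        add_le_add le_rfl (mul_le_mul_right (hI 2 two_pos (by norm_num) x hx).2 _)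
    _ = _ := by rw [ENNReal.ofReal_mul (by norm_num), ENNReal.ofReal_ofNat]; ring

lemma halfJ (H : Hyp d α δ) : ∃ C : ℝ, 0 < C ∧ ∀ x y : Ed d, x ≠ 0 → y ≠ 0 →
    ∫⁻ s in Ioc (0:ℝ) (3/2), (∫⁻ z, pT d α δ s x z * hb d (α - δ) z * pT d α δ (3 - s) z y) ≤
      ENNReal.ofReal C * (HH d δ x * HH d δ y * pb d α (y - x)) := by
  obtain ⟨C1, hC1, hU⟩ := up_big H
  obtain ⟨C2, hC2, hF⟩ := up_far H
  obtain ⟨C3, hC3, hT⟩ := TT H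
  obtain ⟨C4, hC4, hW⟩ := WW_int H
  set E := (2:ℝ) ^ ((d:ℝ) + α) with hE
  have hE0 : 0 < E := by positivity
  refine ⟨C1 * E * (C4 + 2 * C2 * C3), by positivity, fun x y hx hy => ?_⟩
  set P := pb d α (y - x) with hP
  have hPt : P ≠ ⊤ := by simp [hP, pb]
  have hHt : ∀ x : Ed d, HH d δ x ≠ ⊤ := fun x => by simp [HH, hb]
  have key : ∀ s ∈ Ioc (0:ℝ) (3/2), ∀ z : Ed d, z ≠ 0 → pT d α δ s x z * WW d α z * pb d α (y - z) ≤
      ENNReal.ofReal E * P * (pT d α δ s x z * WW d α z + ENNReal.ofReal C2 * HH d δ x * (HH d δ z * WW d α z * pb d α (y - z))) := by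
    intro s hs z hz
    by_cases hA : 1 + ‖y - x‖ ≤ 2 * (1 + ‖y - z‖)
    · have b := pb_cmp H two_pos hA
      calc _ ≤ pT d α δ s x z * WW d α z * (ENNReal.ofReal E * P) := mul_le_mul_right b _
        _ = ENNReal.ofReal E * P * (pT d α δ s x z * WW d α z) := by ring
        _ ≤ _ := mul_le_mul_right le_self_add _
    · rw [not_le] at hA
      have t : ‖y - x‖ ≤ ‖y - z‖ + ‖z - x‖ := norm_sub_le_norm_sub_add_norm_sub _ _ _
      have hzx : 1 + ‖y - x‖ ≤ 2 * ‖z - x‖ := by linarith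
      have hzx0 : 0 < ‖z - x‖ := by linarith [norm_nonneg (y - x)]
      have hne : x ≠ z := by rintro rfl; simp at hzx0
      have b := rpow_cmp H (by positivity) hzx0 hzx two_pos
      have b2 : pT d α δ s x z ≤ ENNReal.ofReal C2 * (ENNReal.ofReal E * P) * (HH d δ x * HH d δ z) := by
        refine (hF s hs.1 (by linarith [hs.2]) x z hx hz hne).trans (mul_le_mul_left ?_ _)
        rw [hP, pb, ← ENNReal.ofReal_mul hE0.le, ← ENNReal.ofReal_mul hC2.le]
        exact ENNReal.ofReal_le_ofReal (mul_le_mul_of_nonneg_left b hC2.le)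
      calc _ ≤ ENNReal.ofReal C2 * (ENNReal.ofReal E * P) * (HH d δ x * HH d δ z) * WW d α z * pb d α (y - z) :=
            mul_le_mul_left (mul_le_mul_left b2 _) _
        _ = ENNReal.ofReal E * P * (ENNReal.ofReal C2 * HH d δ x * (HH d δ z * WW d α z * pb d α (y - z))) := by ring
        _ ≤ _ := mul_le_mul_right le_add_self _
  have pw : ∀ s ∈ Ioc (0:ℝ) (3/2), ∀ z : Ed d, z ≠ 0 → pT d α δ s x z * hb d (α - δ) z * pT d α δ (3 - s) z y ≤
      (ENNReal.ofReal C1 * HH d δ y * (ENNReal.ofReal E * P)) * (pT d α δ s x z * WW d α z + ENNReal.ofReal C2 * HH d δ x * (HH d δ z * WW d α z * pb d α (y - z))) := by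
    intro s hs z hz
    calc _ ≤ pT d α δ s x z * hb d (α - δ) z * (ENNReal.ofReal C1 * (HH d δ z * HH d δ y * pb d α (y - z))) :=
          mul_le_mul_right (hU (3 - s) (by linarith [hs.2]) (by linarith [hs.1]) z y hz hy) _
      _ = ENNReal.ofReal C1 * HH d δ y * (pT d α δ s x z * (hb d (α - δ) z * HH d δ z) * pb d α (y - z)) := by ring
      _ ≤ ENNReal.ofReal C1 * HH d δ y * (pT d α δ s x z * WW d α z * pb d α (y - z)) :=
          mul_le_mul_right (mul_le_mul_left (mul_le_mul_right (w_le H hz) _) _) _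
      _ ≤ _ := by
          rw [mul_assoc (_ * _) (_ * _)]
          exact mul_le_mul_right (key s hs z hz) _
  set Q := ENNReal.ofReal C1 * HH d δ y * (ENNReal.ofReal E * P) with hQ
  have hQt : Q ≠ ⊤ := ENNReal.mul_ne_top (ENNReal.mul_ne_top ENNReal.ofReal_ne_top (hHt y)) (ENNReal.mul_ne_top ENNReal.ofReal_ne_top hPt)
  have hCt : ENNReal.ofReal C2 * HH d δ x ≠ ⊤ := ENNReal.mul_ne_top ENNReal.ofReal_ne_top (hHt x)
  calc _ ≤ ∫⁻ s in Ioc (0:ℝ) (3/2), Q * ((∫⁻ z, pT d α δ s x z * WW d α z) + ENNReal.ofReal C2 * HH d δ x * ENNReal.ofReal C3) := by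
        refine setLIntegral_mono' measurableSet_Ioc fun s hs => ?_
        calc _ ≤ _ := lintegral_mono_ae (by filter_upwards [ae_ne0 d] with z hz using pw s hs z hz)
          _ = Q * ((∫⁻ z, pT d α δ s x z * WW d α z) + ENNReal.ofReal C2 * HH d δ x * ∫⁻ z, HH d δ z * WW d α z * pb d α (y - z)) := by
              have mz : Measurable fun z => pT d α δ s x z * WW d α z := (pT_meas s x).mul WW_meas
              rw [lintegral_const_mul' _ _ hQt, lintegral_add_left mz, lintegral_const_mul' _ _ hCt]
          _ ≤ _ := mul_le_mul_right (add_le_add le_rfl (mul_le_mul_right (hT y) _)) _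
    _ ≤ ∫⁻ s in Ioo (0:ℝ) 2, Q * ((∫⁻ z, pT d α δ s x z * WW d α z) + ENNReal.ofReal C2 * HH d δ x * ENNReal.ofReal C3) :=
        lintegral_mono_set fun s hs => ⟨hs.1, by linarith [hs.2]⟩
    _ = Q * ((∫⁻ s in Ioo (0:ℝ) 2, (∫⁻ z, pT d α δ s x z * WW d α z)) + ENNReal.ofReal C2 * HH d δ x * ENNReal.ofReal C3 * 2) := by
        rw [lintegral_const_mul' _ _ hQt, lintegral_add_right _ measurable_const, setLIntegral_const, Real.volume_Ioo, sub_zero, ENNReal.ofReal_ofNat]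
    _ ≤ Q * (ENNReal.ofReal C4 * HH d δ x + ENNReal.ofReal C2 * HH d δ x * ENNReal.ofReal C3 * 2) :=
        mul_le_mul_right (add_le_add (hW x hx) le_rfl) _
    _ = _ := by
        rw [hQ, ENNReal.ofReal_mul (p := C1 * E) (by positivity), ENNReal.ofReal_mul (p := C1) (by positivity), ENNReal.ofReal_add (by positivity) (by positivity),
          ENNReal.ofReal_mul (p := 2 * C2) (by positivity), ENNReal.ofReal_mul (p := 2) (by positivity), ENNReal.ofReal_ofNat]
        ring

end Final

section Final2
variable {d : ℕ} [NeZero d] {α δ : ℝ}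

/-- the spatial integral -/
def GG (d : ℕ) (α δ t : ℝ) (x y : Ed d) (s : ℝ) : ENNReal := ∫⁻ z, pT d α δ s x z * hb d (α - δ) z * pT d α δ (t - s) z y

lemma GG_symm (t : ℝ) (x y : Ed d) (s : ℝ) : GG d α δ t x y (t - s) = GG d α δ t y x s := by
  unfold GG
  refine lintegral_congr fun z => ?_
  rw [sub_sub_cancel, pT, pq_symm (qq_meas d α δ) (t - s) x z, pq_symm (qq_meas d α δ) s z y]
  ring

lemma full3 (H : Hyp d α δ) : ∃ C : ℝ, 0 < C ∧ ∀ x y : Ed d, x ≠ 0 → y ≠ 0 →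
    ∫⁻ s in Ioo (0:ℝ) 3, GG d α δ 3 x y s ≤ ENNReal.ofReal C * pT d α δ 3 x y := by
  obtain ⟨C, hC, h⟩ := halfJ H
  obtain ⟨c, hc, hl⟩ := lower H
  refine ⟨2 * C * c⁻¹, by positivity, fun x y hx hy => ?_⟩
  have r : ∫⁻ s in Ico (3/2:ℝ) 3, GG d α δ 3 x y s = ∫⁻ s in Ioc (0:ℝ) (3/2), GG d α δ 3 y x s := by
    rw [← lintegral_indicator measurableSet_Ico, ← lintegral_indicator measurableSet_Ioc,
      ← lintegral_sub_left_eq_self (fun s => (Ico (3/2:ℝ) 3).indicator (fun s => GG d α δ 3 x y s) s) 3]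
    refine lintegral_congr fun s => ?_
    by_cases hs : s ∈ Ioc (0:ℝ) (3/2)
    · rw [indicator_of_mem hs, indicator_of_mem (by constructor <;> linarith [hs.1, hs.2]), GG_symm]
    · rw [indicator_of_notMem hs, indicator_of_notMem]
      intro hs'
      exact hs (by constructor <;> linarith [hs'.1, hs'.2])
  have e : HH d δ y * HH d δ x * pb d α (x - y) = HH d δ x * HH d δ y * pb d α (y - x) := by rw [pb_neg]; ring
  calc _ ≤ ∫⁻ s in Ioc (0:ℝ) (3/2) ∪ Ico (3/2:ℝ) 3, GG d α δ 3 x y s := by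
        refine lintegral_mono_set fun s hs => ?_
        rcases le_total s (3/2) with h | h
        · exact Or.inl ⟨hs.1, h⟩
        · exact Or.inr ⟨h, hs.2⟩
    _ ≤ _ := lintegral_union_le _ _ _
    _ ≤ ENNReal.ofReal C * (HH d δ x * HH d δ y * pb d α (y - x)) + ENNReal.ofReal C * (HH d δ x * HH d δ y * pb d α (y - x)) := by
        rw [r]
        refine add_le_add (h x y hx hy) ?_
        rw [← e]
        exact h y x hy hx
    _ = ENNReal.ofReal (2 * C * c⁻¹) * (ENNReal.ofReal c * (HH d δ x * HH d δ y * pb d α (y - x))) := by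
        rw [← mul_assoc (ENNReal.ofReal (2 * C * c⁻¹)), ← ENNReal.ofReal_mul (by positivity), mul_assoc (2 * C), inv_mul_cancel₀ hc.ne', mul_one, ENNReal.ofReal_mul (by norm_num), ENNReal.ofReal_ofNat]
        ring
    _ ≤ _ := mul_le_mul_right (hl x y hx hy) _

lemma full (H : Hyp d α δ) : ∃ C : ℝ, 0 < C ∧ ∀ t : ℝ, 0 < t → ∀ x y : Ed d, x ≠ 0 → y ≠ 0 →
    ∫⁻ s in Ioo (0:ℝ) t, GG d α δ t x y s ≤ ENNReal.ofReal (C * t ^ (δ / α)) * pT d α δ t x y := by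
  obtain ⟨C, hC, h⟩ := full3 H
  have ha := H.a0
  refine ⟨C * (3:ℝ) ^ (-(δ / α)), by positivity, fun t ht x y hx hy => ?_⟩
  set r := (t / 3) ^ (1/α) with hr
  have hr0 : 0 < r := by positivity
  have hrα : r ^ α = t / 3 := by rw [hr, ← rpow_mul (by positivity), one_div, inv_mul_cancel₀ ha.ne', rpow_one]
  have hrδ : r ^ δ = (3:ℝ) ^ (-(δ / α)) * t ^ (δ / α) := by
    rw [hr, ← rpow_mul (by positivity), one_div, inv_mul_eq_div, div_rpow ht.le (by norm_num), rpow_neg (by norm_num)]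
    field_simp
  have ht3 : r ^ α * 3 = t := by rw [hrα]; field_simp
  clear_value r
  obtain ⟨x, rfl⟩ : ∃ x', x = r • x' := ⟨r⁻¹ • x, by rw [smul_smul, mul_inv_cancel₀ hr0.ne', one_smul]⟩
  obtain ⟨y, rfl⟩ : ∃ y', y = r • y' := ⟨r⁻¹ • y, by rw [smul_smul, mul_inv_cancel₀ hr0.ne', one_smul]⟩
  have hx' : x ≠ 0 := by rintro rfl; simp at hx
  have hy' : y ≠ 0 := by rintro rfl; simp at hy
  have g : ∀ s, GG d α δ t (r • x) (r • y) (r ^ α * s) = ENNReal.ofReal (r ^ (δ - α - d)) * GG d α δ 3 x y s := by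
    intro s
    unfold GG
    have l := lint_smul d hr0 (fun z => pT d α δ (r ^ α * s) (r • x) z * hb d (α - δ) z * pT d α δ (t - r ^ α * s) z (r • y))
    have e : ∀ z, pT d α δ (r ^ α * s) (r • x) (r • z) * hb d (α - δ) (r • z) * pT d α δ (t - r ^ α * s) (r • z) (r • y) =
        ENNReal.ofReal (r ^ (-(d:ℝ)) * r ^ (δ - α) * r ^ (-(d:ℝ))) * (pT d α δ s x z * hb d (α - δ) z * pT d α δ (3 - s) z y) := by
      intro z
      rw [← ht3, ← mul_sub, pT_scale H hr0, pT_scale H hr0, hb_scale _ hr0, neg_sub, ENNReal.ofReal_mul (p := r ^ (-(d:ℝ)) * r ^ (δ - α)) (by positivity), ENNReal.ofReal_mul (p := r ^ (-(d:ℝ))) (by positivity)]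
      ring
    simp_rw [e] at l
    rw [lintegral_const_mul' _ _ ENNReal.ofReal_ne_top] at l
    have l2 := congrArg (fun u => ENNReal.ofReal (r ^ (d:ℝ)) * u) l
    rw [← mul_assoc, ← mul_assoc, ← ENNReal.ofReal_mul (by positivity), ← ENNReal.ofReal_mul (by positivity), show r ^ (d:ℝ) * r ^ (-(d:ℝ)) = 1 by rw [← rpow_add hr0, add_neg_cancel, rpow_zero], ENNReal.ofReal_one, one_mul] at l2
    rw [← l2]
    congr 2
    rw [← rpow_add hr0, ← rpow_add hr0, ← rpow_add hr0]
    congr 1; ring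
  calc ∫⁻ s in Ioo (0:ℝ) t, GG d α δ t (r • x) (r • y) s = ENNReal.ofReal (r ^ α) * ∫⁻ s in Ioo (0:ℝ) 3, GG d α δ t (r • x) (r • y) (r ^ α * s) := by
        rw [← lintegral_indicator measurableSet_Ioo, ← lintegral_indicator measurableSet_Ioo,
          lint_mul (r ^ α) (by positivity) (fun s => (Ioo (0:ℝ) t).indicator (fun s => GG d α δ t (r • x) (r • y) s) s)]
        congr 1
        refine lintegral_congr fun s => ?_
        have hp : 0 < r ^ α := by positivity
        have : r ^ α * s ∈ Ioo (0:ℝ) t ↔ s ∈ Ioo (0:ℝ) 3 := by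
          rw [← ht3, mem_Ioo, mem_Ioo, mul_pos_iff_of_pos_left hp, mul_lt_mul_iff_right₀ hp]
        simp only [indicator, this]
    _ = ENNReal.ofReal (r ^ α) * (ENNReal.ofReal (r ^ (δ - α - d)) * ∫⁻ s in Ioo (0:ℝ) 3, GG d α δ 3 x y s) := by
        simp_rw [g]
        rw [lintegral_const_mul' _ _ ENNReal.ofReal_ne_top]
    _ ≤ ENNReal.ofReal (r ^ α) * (ENNReal.ofReal (r ^ (δ - α - d)) * (ENNReal.ofReal C * pT d α δ 3 x y)) :=
        mul_le_mul_right (mul_le_mul_right (h x y hx' hy') _) _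
    _ = ENNReal.ofReal (r ^ α * r ^ (δ - α - d) * C) * pT d α δ 3 x y := by
        rw [ENNReal.ofReal_mul (p := r ^ α * r ^ (δ - α - d)) (by positivity), ENNReal.ofReal_mul (p := r ^ α) (by positivity)]; ring
    _ = _ := by
        have s := pT_scale H hr0 3 x y
        rw [ht3] at s
        rw [s, ← mul_assoc, ← ENNReal.ofReal_mul (by positivity), mul_assoc C, ← hrδ, mul_assoc C, ← rpow_add hr0, ← rpow_add hr0, mul_comm C]
        congr 4; ring

end Final2

section Final3
variable {d : ℕ} [NeZero d] {α δ : ℝ}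

lemma pT_fin (H : Hyp d α δ) {t : ℝ} (ht : 0 < t) {x y : Ed d} (hx : x ≠ 0) (hy : y ≠ 0) :
    pT d α δ t x y ≠ ⊤ := by
  obtain ⟨C, hC, h⟩ := upper H
  set r := t ^ (1 / α) with hr
  have hr0 : 0 < r := rpow_pos_of_pos ht _
  have e : r ^ α = t := by
    rw [hr, ← Real.rpow_mul ht.le, one_div_mul_cancel H.a0.ne', Real.rpow_one]
  have hs := pT_scale H hr0 1 (r⁻¹ • x) (r⁻¹ • y)
  rw [e, mul_one, smul_inv_smul₀ hr0.ne', smul_inv_smul₀ hr0.ne'] at hs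
  rw [hs]
  have hx' : r⁻¹ • x ≠ 0 := smul_ne_zero (inv_ne_zero hr0.ne') hx
  have hy' : r⁻¹ • y ≠ 0 := smul_ne_zero (inv_ne_zero hr0.ne') hy
  refine ENNReal.mul_ne_top ENNReal.ofReal_ne_top (ne_top_of_le_ne_top ?_ (h _ _ hx' hy'))
  simp [HH, hb, pb, ENNReal.mul_eq_top]

lemma pn_fin (H : Hyp d α δ) (n : ℕ) {t : ℝ} (ht : 0 < t) {x y : Ed d} (hx : x ≠ 0) (hy : y ≠ 0) :
    pn volume (kE d α) (qq d α δ) n t x y ≠ ⊤ :=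
  ne_top_of_le_ne_top (pT_fin H ht hx hy) (ENNReal.le_tsum n)

/-- transfer of a space-time convolution from extended nonnegative to Bochner integrals -/
lemma transfer {t : ℝ} {x y : Ed d} {f g : ℝ → Ed d → Ed d → ENNReal}
    {q : Ed d → ENNReal} {fr gr : ℝ → Ed d → Ed d → ℝ} {qr : Ed d → ℝ}
    (hf : MK f) (hg : MK g) (hq : Measurable q)
    (ef : ∀ s, 0 < s → ∀ z, z ≠ 0 → fr s x z = (f s x z).toReal)
    (eg : ∀ s, 0 < s → ∀ z, z ≠ 0 → gr s z y = (g s z y).toReal)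
    (eq : ∀ z, z ≠ 0 → qr z = (q z).toReal)
    (ff : ∀ s, 0 < s → ∀ z, z ≠ 0 → f s x z ≠ ⊤)
    (fg : ∀ s, 0 < s → ∀ z, z ≠ 0 → g s z y ≠ ⊤)
    (fq : ∀ z, z ≠ 0 → q z ≠ ⊤)
    (fin : (∫⁻ s in Ioo 0 t, (∫⁻ z, f s x z * q z * g (t - s) z y)) ≠ ⊤) :
    (∫ s in Ioo (0 : ℝ) t, ∫ z : Ed d, fr s x z * qr z * gr (t - s) z y) =
      (∫⁻ s in Ioo 0 t, (∫⁻ z, f s x z * q z * g (t - s) z y)).toReal := by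
  have hm : Measurable (fun p : ℝ × Ed d => f p.1 x p.2 * q p.2 * g (t - p.1) p.2 y) :=
    ((hf.comp measurable_fst measurable_const measurable_snd).mul (hq.comp measurable_snd)).mul
      (hg.comp (measurable_const.sub measurable_fst) measurable_snd measurable_const)
  have hm1 : Measurable (fun s : ℝ => ∫⁻ z, f s x z * q z * g (t - s) z y) :=
    hm.lintegral_prod_right'
  rw [← integral_toReal hm1.aemeasurable (ae_lt_top hm1 fin)]
  refine setIntegral_congr_fun measurableSet_Ioo fun s hs => ?_
  have hs0 : 0 < s := hs.1
  have hs1 : 0 < t - s := sub_pos.2 hs.2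
  have hm2 : Measurable (fun z => f s x z * q z * g (t - s) z y) :=
    hm.comp (measurable_const.prodMk measurable_id)
  show _ = _
  rw [← integral_toReal hm2.aemeasurable]
  · refine integral_congr_ae ?_
    filter_upwards [ae_ne0 d] with z hz
    rw [ENNReal.toReal_mul, ENNReal.toReal_mul, ef s hs0 z hz, eg _ hs1 z hz, eq z hz]
  · filter_upwards [ae_ne0 d] with z hz
    exact (ENNReal.mul_ne_top (ENNReal.mul_ne_top (ff s hs0 z hz) (fq z hz)) (fg _ hs1 z hz)).lt_top

lemma qq_toReal (H : Hyp d α δ) (z : Ed d) :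
    kappa d α δ * ‖z‖ ^ (-α) = (qq d α δ z).toReal := by
  have := kappa_pos d H.a0 H.d0 H.dd
  rw [qq, ENNReal.toReal_ofReal (by positivity)]

lemma k_toReal (H : Hyp d α δ) {t : ℝ} (ht : 0 < t) (x y : Ed d) :
    fracKernel d α t x y = (kE d α t x y).toReal := by
  rw [kE_pos ht, frac_eq_sk, ENNReal.toReal_ofReal (sk_nonneg d H.a0 H.a2 ht _)]

lemma pertN_eq (H : Hyp d α δ) (n : ℕ) : ∀ t : ℝ, 0 < t → ∀ x y : Ed d, x ≠ 0 → y ≠ 0 →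
    pertN d (fracKernel d α) (fun z => kappa d α δ * ‖z‖ ^ (-α)) n t x y =
      (pn volume (kE d α) (qq d α δ) n t x y).toReal := by
  induction n with
  | zero => intro t ht x y _ _; exact k_toReal H ht x y
  | succ n ih =>
    intro t ht x y hx hy
    have hM := pn_meas volume (kE_MK d α) (qq_meas d α δ) n
    have e : pn volume (kE d α) (qq d α δ) (n + 1) t x y = _ :=
      kstar_eq volume (qq_meas d α δ) hM (kE_MK d α) (pn_nonpos volume (kE_zero d α) n) (kE_zero d α) t x y
    have hfin := pn_fin H (n + 1) ht hx hy
    rw [e] at hfin ⊢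
    exact transfer hM (kE_MK d α) (qq_meas d α δ) (fun s hs z hz => ih s hs x z hx hz)
      (fun s hs z _ => k_toReal H hs z y) (fun z _ => qq_toReal H z)
      (fun s hs z hz => pn_fin H n hs hx hz) (fun s hs z _ => by rw [kE_pos hs]; simp)
      (fun z _ => by simp [qq]) hfin

lemma pert_eq (H : Hyp d α δ) {t : ℝ} (ht : 0 < t) {x y : Ed d} (hx : x ≠ 0) (hy : y ≠ 0) :
    pert d (fracKernel d α) (fun z => kappa d α δ * ‖z‖ ^ (-α)) t x y = (pT d α δ t x y).toReal := by
  unfold pert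
  simp_rw [fun n => pertN_eq H n t ht x y hx hy]
  exact (ENNReal.tsum_toReal_eq fun n => pn_fin H n ht hx hy).symm

lemma final (H : Hyp d α δ) :
    ∃ c : ℝ, 0 < c ∧ ∀ t : ℝ, 0 < t → ∀ x y : Ed d, x ≠ 0 → y ≠ 0 →
      (∫ s in Ioo (0 : ℝ) t, ∫ z : Ed d,
          pert d (fracKernel d α) (fun z => kappa d α δ * ‖z‖ ^ (-α)) s x z *
            ‖z‖ ^ (δ - α) *
            pert d (fracKernel d α) (fun z => kappa d α δ * ‖z‖ ^ (-α)) (t - s) z y) ≤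
        c * t ^ (δ / α) *
          pert d (fracKernel d α) (fun z => kappa d α δ * ‖z‖ ^ (-α)) t x y := by
  obtain ⟨C, hC, h⟩ := full H
  refine ⟨C, hC, fun t ht x y hx hy => ?_⟩
  have hb1 := h t ht x y hx hy
  have hR : ENNReal.ofReal (C * t ^ (δ / α)) * pT d α δ t x y ≠ ⊤ :=
    ENNReal.mul_ne_top ENNReal.ofReal_ne_top (pT_fin H ht hx hy)
  have hfin := ne_top_of_le_ne_top hR hb1
  have hM := pq_MK (α := α) (qq_meas d α δ)
  have h0 : 0 ≤ C * t ^ (δ / α) := by positivity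
  rw [transfer hM hM (hb_meas d (α - δ)) (fun s hs z hz => pert_eq H hs hx hz)
    (fun s hs z hz => pert_eq H hs hz hy)
    (fun z _ => by rw [hb, ENNReal.toReal_ofReal (by positivity), neg_sub])
    (fun s hs z hz => pT_fin H hs hx hz) (fun s hs z hz => pT_fin H hs hz hy)
    (fun z _ => by simp [hb]) hfin, pert_eq H ht hx hy]
  have := ENNReal.toReal_mono hR hb1
  rwa [ENNReal.toReal_mul, ENNReal.toReal_ofReal h0] at this

end Final3

/-- Relative Kato-type bound for the kernel `p̃⁰_{V⁰_δ}` against `|z|^{δ-α}` (Lemma 3.2). -/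
theorem stmt_14 (d : ℕ) (α δ : ℝ) (hα : α ∈ Ioo 0 (min 2 (d : ℝ)))
    (hδ : δ ∈ Ioc 0 (((d : ℝ) - α) / 2)) (hδα : δ < α) :
    ∃ c : ℝ, 0 < c ∧ ∀ t : ℝ, 0 < t → ∀ x y : Ed d, x ≠ 0 → y ≠ 0 →
      (∫ s in Ioo (0 : ℝ) t, ∫ z : Ed d,
          pert d (fracKernel d α) (fun z => kappa d α δ * ‖z‖ ^ (-α)) s x z *
            ‖z‖ ^ (δ - α) *
            pert d (fracKernel d α) (fun z => kappa d α δ * ‖z‖ ^ (-α)) (t - s) z y) ≤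
        c * t ^ (δ / α) *
          pert d (fracKernel d α) (fun z => kappa d α δ * ‖z‖ ^ (-α)) t x y := by
  have hd : (0:ℝ) < d := hα.1.trans (hα.2.trans_le (min_le_right _ _))
  haveI : NeZero d := ⟨by rintro rfl; simp at hd⟩
  exact final ⟨hα.1, (lt_min_iff.1 hα.2).1, (lt_min_iff.1 hα.2).2, hδ.1, hδ.2, hδα⟩
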